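/- arXiv:1902.09219 — 4 statements merged into one kernel-verified Lean document; each statement's English description precedes it below -/
import Mathlib

section
/- Let n ≥ 2, 1 ≤ p ≤ n−1, and let x = (x_1,…,x_p) ∈ ℝ^{(n,p)} with x_1,…,x_p linearly independent vectors in ℝ^n. Let 0 ≤ φ < 1/(np−1) be such that inf_{ω ∈ M(n,ℤ)\{0}} ||ωx||^p ||ω||^{(n−p)(1+φ)} > 0, and set ψ = (p/(n−p))·(1+n(n−p)φ)/(1−(np−1)φ). Then for every y ∈ ℝ^{(n,p)} there exists a constant C ≥ 1 such that for every ε ∈ (0,1) there exists γ ∈ Γ with ||γx − y|| < ε and ||γ|| < C ε^{−ψ}. -/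
open Matrix

attribute [local instance] Matrix.normedAddCommGroup

lemma sumExtend_inl' {ι V : Type*} [AddCommGroup V] [Module ℝ V] {v : ι → V}
    (hs : LinearIndependent ℝ v) (i : ι) : Module.Basis.sumExtend hs (Sum.inl i) = v i := by
  classical
  simp [Module.Basis.sumExtend]
  rfl

lemma infDist_shift {E : Type*} [NormedAddCommGroup E] (Λ : Set E) (hne : Λ.Nonempty)
    (a b μ : E) (h : ∀ y ∈ Λ, y + μ ∈ Λ) :
    Metric.infDist a Λ ≤ Metric.infDist b Λ + ‖a - b - μ‖ := by
  have h1 := Metric.infDist_le_infDist_add_dist (s := Λ) (x := a) (y := b + μ)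
  have h2 : Metric.infDist (b + μ) Λ ≤ Metric.infDist b Λ := by
    rw [Metric.le_infDist hne]
    intro y hy
    have := Metric.infDist_le_dist_of_mem (x := b + μ) (h y hy)
    simpa using this
  rw [dist_eq_norm, ← sub_sub] at h1
  linarith

lemma cover {n : ℕ} (L : (Fin n → ℝ) →ₗ[ℝ] (Fin n → ℝ)) (hdet : LinearMap.det L ≠ 0)
    (h : ∀ v : Fin n → ℤ, v ≠ 0 → 1 ≤ ‖L (fun i => (v i : ℝ))‖) (w : Fin n → ℝ) :
    ∃ v : Fin n → ℤ, ‖L w - L (fun i => (v i : ℝ))‖ < |LinearMap.det L| + 1 := by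
  by_contra! hcon
  set Λ : Set (Fin n → ℝ) := Set.range (fun v : Fin n → ℤ => L (fun i => (v i : ℝ))) with hΛ
  have hne : Λ.Nonempty := Set.range_nonempty _
  have hadd : ∀ v : Fin n → ℤ, ∀ y ∈ Λ, y + L (fun i => (v i : ℝ)) ∈ Λ := by
    rintro v _ ⟨u, rfl⟩
    refine ⟨u + v, ?_⟩
    simp only [← map_add]
    congr 1
    ext i; simp
  set g : ℝ → ℝ := fun t => Metric.infDist (t • L w) Λ with hg
  have hgc : Continuous g := by
    apply (Metric.continuous_infDist_pt Λ).comp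
    fun_prop
  have hg0 : g 0 = 0 := by
    simp only [hg, zero_smul]
    apply Metric.infDist_zero_of_mem
    refine ⟨0, ?_⟩
    have : (fun i => (((0 : Fin n → ℤ) i : ℤ) : ℝ)) = (0 : Fin n → ℝ) := by ext; simp
    change L _ = 0
    rw [this, map_zero]
  have hg1 : |LinearMap.det L| + 1 ≤ g 1 := by
    simp only [hg, one_smul]
    rw [Metric.le_infDist hne]
    rintro _ ⟨v, rfl⟩
    rw [dist_eq_norm]
    exact hcon v
  set m := ⌊|LinearMap.det L|⌋₊ with hm
  have hmle : (m : ℝ) ≤ |LinearMap.det L| := Nat.floor_le (abs_nonneg _)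
  have hmlt : |LinearMap.det L| < m + 1 := Nat.lt_floor_add_one _
  have ht : ∀ k : Fin (m + 1), ∃ t : ℝ, g t = (k : ℕ) := by
    intro k
    have hk : ((k : ℕ) : ℝ) ≤ m := by exact_mod_cast Nat.lt_succ_iff.mp k.2
    have := intermediate_value_Icc (zero_le_one (α := ℝ)) hgc.continuousOn
    rw [hg0] at this
    obtain ⟨t, -, ht⟩ := this (show ((k : ℕ) : ℝ) ∈ Set.Icc 0 (g 1) from
      ⟨by positivity, by linarith⟩)
    exact ⟨t, ht⟩
  choose t ht using ht
  set P : Fin (m + 1) → Set (Fin n → ℝ) := fun k => L ⁻¹' (Metric.ball (t k • L w) (1 / 2)) with hP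
  have hLc : Continuous L := L.continuous_of_finiteDimensional
  have hPo : ∀ k, MeasurableSet (P k) := fun k => (Metric.isOpen_ball.preimage hLc).measurableSet
  have hPv : ∀ k, MeasureTheory.volume (P k) = ENNReal.ofReal |(LinearMap.det L)⁻¹| := by
    intro k
    rw [hP]
    simp only
    rw [MeasureTheory.Measure.addHaar_preimage_linearMap _ hdet, Real.volume_pi_ball _ (by norm_num)]
    norm_num
  have hfar : ∀ (j k : Fin (m + 1)) (v : Fin n → ℤ), j ≠ k →
      1 ≤ ‖t j • L w - t k • L w - L (fun i => (v i : ℝ))‖ := by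
    intro j k v hjk
    have key : ∀ (j k : Fin (m + 1)) (v : Fin n → ℤ), ((j : ℕ) : ℝ) ≤ (k : ℕ) +
        ‖t j • L w - t k • L w - L (fun i => (v i : ℝ))‖ := by
      intro j k v
      have := infDist_shift Λ hne (t j • L w) (t k • L w) _ (hadd v)
      rw [← ht j, ← ht k]
      exact this
    have h1 := key j k v
    have h2 := key k j (-v)
    have h3 : L (fun i => (((-v) i : ℤ) : ℝ)) = - L (fun i => (v i : ℝ)) := by
      rw [← map_neg]; congr 1; ext i; simp
    rw [h3, ← norm_neg] at h2
    have h4 : -(t k • L w - t j • L w - -L (fun i => (v i : ℝ))) =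
      t j • L w - t k • L w - L (fun i => (v i : ℝ)) := by abel
    rw [h4] at h2
    rcases lt_or_gt_of_ne hjk with hlt | hlt
    · have : ((j : ℕ) : ℝ) + 1 ≤ (k : ℕ) := by exact_mod_cast hlt
      linarith
    · have : ((k : ℕ) : ℝ) + 1 ≤ (j : ℕ) := by exact_mod_cast hlt
      linarith
  have hsep : ∀ (j k : Fin (m + 1)) (v : Fin n → ℤ) (z z' : Fin n → ℝ), z ∈ P j → z' ∈ P k →
      z - z' = (fun i => (v i : ℝ)) → j = k ∧ v = 0 := by
    intro j k v z z' hz hz' hzz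
    simp only [hP, Set.mem_preimage, Metric.mem_ball, dist_eq_norm] at hz hz'
    have e : L (fun i => (v i : ℝ)) = L z - L z' := by rw [← hzz, map_sub]
    have hlt : ‖t j • L w - t k • L w - L (fun i => (v i : ℝ))‖ < 1 := by
      have : t j • L w - t k • L w - L (fun i => (v i : ℝ)) =
        (L z' - t k • L w) - (L z - t j • L w) := by rw [e]; abel
      rw [this]
      refine (norm_sub_le _ _).trans_lt ?_
      linarith
    have hjk : j = k := by
      by_contra hjk
      exact absurd hlt (not_lt.mpr (hfar j k v hjk))
    refine ⟨hjk, ?_⟩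
    by_contra hv
    subst hjk
    have := h v hv
    simp only [sub_self, zero_sub, norm_neg] at hlt
    linarith
  have hdisj : Pairwise (Function.onFun Disjoint P) := by
    intro j k hjk
    rw [Function.onFun, Set.disjoint_left]
    intro z hz hz'
    exact hjk (hsep j k 0 z z hz hz' (by ext; simp)).1
  have hvol : MeasureTheory.volume (⋃ k, P k) = (m + 1 : ℕ) * ENNReal.ofReal |(LinearMap.det L)⁻¹| := by
    rw [MeasureTheory.measure_iUnion hdisj hPo]
    simp [hPv]
  have hfund := ZSpan.isAddFundamentalDomain (Pi.basisFun ℝ (Fin n)) MeasureTheory.volume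
  have hF : MeasureTheory.volume (ZSpan.fundamentalDomain (Pi.basisFun ℝ (Fin n))) = 1 := by
    rw [ZSpan.fundamentalDomain_pi_basisFun]
    rw [MeasureTheory.volume_pi_pi]
    simp
  have hlt : MeasureTheory.volume (ZSpan.fundamentalDomain (Pi.basisFun ℝ (Fin n))) <
      MeasureTheory.volume (⋃ k, P k) := by
    rw [hF, hvol, ← ENNReal.ofReal_natCast, ← ENNReal.ofReal_mul (by positivity),
      ENNReal.one_lt_ofReal, abs_inv, ← div_eq_mul_inv, one_lt_div (abs_pos.mpr hdet)]
    push_cast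
    exact hmlt
  have : Countable (Submodule.span ℤ (Set.range (Pi.basisFun ℝ (Fin n)))) := inferInstance
  have : MeasureTheory.VAddInvariantMeasure (Submodule.span ℤ (Set.range (Pi.basisFun ℝ (Fin n))))
    (Fin n → ℝ) MeasureTheory.volume :=
    inferInstanceAs <| MeasureTheory.VAddInvariantMeasure (Submodule.span ℤ (Set.range (Pi.basisFun ℝ (Fin n)))).toAddSubgroup (Fin n → ℝ) MeasureTheory.volume
  have : MeasurableVAdd (Submodule.span ℤ (Set.range (Pi.basisFun ℝ (Fin n)))) (Fin n → ℝ) :=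
    inferInstanceAs <| MeasurableVAdd (Submodule.span ℤ (Set.range (Pi.basisFun ℝ (Fin n)))).toAddSubgroup (Fin n → ℝ)
  obtain ⟨a, b, hab, hnd⟩ := MeasureTheory.exists_pair_mem_lattice_not_disjoint_vadd hfund
    (MeasurableSet.iUnion hPo).nullMeasurableSet hlt
  rw [Set.not_disjoint_iff] at hnd
  obtain ⟨z, ⟨z1, hz1, hz1'⟩, ⟨z2, hz2, hz2'⟩⟩ := hnd
  rw [Set.mem_iUnion] at hz1 hz2
  obtain ⟨j, hj⟩ := hz1
  obtain ⟨k, hk⟩ := hz2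
  have hb : ∀ i, ∃ q : ℤ, (q : ℝ) = ((b - a : Submodule.span ℤ (Set.range (Pi.basisFun ℝ (Fin n)))) : Fin n → ℝ) i := by
    intro i
    have := ((Pi.basisFun ℝ (Fin n)).mem_span_iff_repr_mem ℤ _).mp (b - a).2 i
    simpa using this
  choose q hq using hb
  have hdiff : z1 - z2 = (fun i => (q i : ℝ)) := by
    have e1 : (a : Fin n → ℝ) + z1 = b + z2 := hz1'.trans hz2'.symm
    ext i
    have := congrFun e1 i
    rw [hq]
    simp at this ⊢
    linarith
  obtain ⟨-, hq0⟩ := hsep j k q z1 z2 hj hk hdiff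
  apply hab
  symm
  rw [← sub_eq_zero]
  ext i
  rw [← hq, hq0]
  simp

lemma hinf_vec (n p : ℕ) (hn : 2 ≤ n) (x : Matrix (Fin n) (Fin p) ℝ)
    (A c : ℝ) (hA : 0 ≤ A)
    (hinf : ∀ ω : Matrix (Fin n) (Fin n) ℤ, ω ≠ 0 →
      c ≤ ‖(ω.map (Int.cast : ℤ → ℝ)) * x‖ ^ (p : ℝ) * ‖ω.map (Int.cast : ℤ → ℝ)‖ ^ A)
    (v : Fin n → ℤ) (hv : v ≠ 0) (δ S : ℝ) (hδ : 0 ≤ δ) (hS : 0 ≤ S)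
    (h1 : ∀ j, |∑ i, (v i : ℝ) * x i j| ≤ δ) (h2 : ∀ i, |(v i : ℝ)| ≤ S) :
    c ≤ δ ^ (p : ℝ) * S ^ A := by
  set i0 : Fin n := ⟨0, by omega⟩
  have h := hinf (Matrix.of fun i j => if i = i0 then v j else 0) (by
    intro h0
    apply hv
    ext j
    have := congrFun (congrFun h0 i0) j
    simpa using this)
  refine h.trans ?_
  gcongr
  · rw [Matrix.norm_le_iff hδ]
    intro i j
    by_cases hi : i = i0
    · simpa [Matrix.mul_apply, hi] using h1 j
    · simpa [Matrix.mul_apply, hi] using hδ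
  · rw [Matrix.norm_le_iff hS]
    intro i j
    by_cases hi : i = i0
    · simpa [hi] using h2 j
    · simpa [hi] using hS

lemma approx1 (n p : ℕ) (hn : 2 ≤ n) (hp : 1 ≤ p) (hpn : p ≤ n - 1)
    (x : Matrix (Fin n) (Fin p) ℝ)
    (hx : LinearIndependent ℝ (fun j i => x i j : Fin p → Fin n → ℝ))
    (φ : ℝ) (hφ0 : 0 ≤ φ)
    (hinf : ∃ c > (0 : ℝ), ∀ ω : Matrix (Fin n) (Fin n) ℤ, ω ≠ 0 →
      c ≤ ‖(ω.map (Int.cast : ℤ → ℝ)) * x‖ ^ (p : ℝ) *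
          ‖ω.map (Int.cast : ℤ → ℝ)‖ ^ (((n : ℝ) - p) * (1 + φ))) :
    ∃ K C : ℝ, 1 ≤ K ∧ 1 ≤ C ∧ ∀ T : ℝ, 1 ≤ T → ∀ w : Fin n → ℝ, ∃ v : Fin n → ℤ,
      (∀ j, |∑ i, (w i - v i) * x i j| ≤
        K * T ^ (-(((n : ℝ) - p) * (1 + φ) / p - ((n : ℝ) - p) * φ))) ∧
      ∀ i, |w i - v i| ≤ C * T ^ (1 + ((n : ℝ) - p) * φ) := by
  classical
  obtain ⟨c, hc, hinf⟩ := hinf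
  have hpn' : (p : ℝ) + 1 ≤ n := by
    have : p + 1 ≤ n := by omega
    exact_mod_cast this
  have hp0 : (0 : ℝ) < p := by exact_mod_cast hp
  set A : ℝ := ((n : ℝ) - p) * (1 + φ) with hA
  have hA0 : 0 ≤ A := mul_nonneg (by linarith) (by linarith)
  set b := Module.Basis.sumExtend hx
  have : Fintype (Module.Basis.sumExtendIndex hx) := by
    have := Module.Finite.finite_basis b
    have : Finite (Module.Basis.sumExtendIndex hx) := Finite.of_injective (Sum.inr : _ → Fin p ⊕ _) Sum.inr_injective
    exact Fintype.ofFinite _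
  have hcard : p + Fintype.card (Module.Basis.sumExtendIndex hx) = n := by
    have := Module.finrank_eq_card_basis b
    simpa using this.symm
  let e : Fin p ⊕ Module.Basis.sumExtendIndex hx ≃ Fin n :=
    Fintype.equivFinOfCardEq (by simpa using hcard)
  let Bm : Matrix (Fin n) (Fin n) ℝ := Matrix.of fun k => b (e.symm k)
  have hBu : IsUnit Bm := by
    rw [← Matrix.linearIndependent_rows_iff_isUnit]
    exact b.linearIndependent.comp _ e.symm.injective
  have hBd : Bm.det ≠ 0 := by
    exact ((Matrix.isUnit_iff_isUnit_det _).mp hBu).ne_zero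
  have hBx : ∀ (v : Fin n → ℝ) (j : Fin p), (Bm *ᵥ v) (e (Sum.inl j)) = ∑ i, v i * x i j := by
    intro v j
    simp only [Matrix.mulVec, dotProduct, Bm, Matrix.of_apply, Equiv.symm_apply_apply, b,
      sumExtend_inl']
    exact Finset.sum_congr rfl fun _ _ => mul_comm _ _
  obtain ⟨CG, hCG1, hCG⟩ : ∃ CG : ℝ, 1 ≤ CG ∧ ∀ v : Fin n → ℝ, ‖v‖ ≤ CG * ‖Bm *ᵥ v‖ := by
    let F := LinearMap.toContinuousLinearMap (Matrix.toLin' Bm⁻¹)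
    refine ⟨max 1 ‖F‖, le_max_left _ _, fun v => ?_⟩
    have h1 : F (Bm *ᵥ v) = v := by
      simp [F, Matrix.nonsing_inv_mul Bm (isUnit_iff_ne_zero.mpr hBd)]
    calc ‖v‖ = ‖F (Bm *ᵥ v)‖ := by rw [h1]
      _ ≤ ‖F‖ * ‖Bm *ᵥ v‖ := F.le_opNorm _
      _ ≤ _ := by gcongr; exact le_max_right _ _
  obtain ⟨c2, hc20, hc21, hc2⟩ : ∃ c2 : ℝ, 0 < c2 ∧ c2 ≤ 1 ∧ c2 ^ (p : ℝ) * CG ^ A < c := by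
    have hCGA : 0 < CG ^ A := by positivity
    refine ⟨min 1 ((c / 2 / CG ^ A) ^ (1 / (p : ℝ))), by positivity, min_le_left _ _, ?_⟩
    have : (min 1 ((c / 2 / CG ^ A) ^ (1 / (p : ℝ)))) ^ (p : ℝ) ≤ c / 2 / CG ^ A := by
      calc _ ≤ ((c / 2 / CG ^ A) ^ (1 / (p : ℝ))) ^ (p : ℝ) := by
            gcongr
            exact min_le_right _ _
        _ = _ := by
            rw [← Real.rpow_mul (by positivity), one_div_mul_cancel hp0.ne', Real.rpow_one]
    calc _ ≤ c / 2 / CG ^ A * CG ^ A := by gcongr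
      _ = c / 2 := by field_simp
      _ < c := by linarith
  set D0 : ℝ := |Bm.det| * (c2 ^ (p : ℝ))⁻¹ with hD0
  have hD00 : 0 ≤ D0 := by positivity
  set C3 : ℝ := max (D0 + 1) (1 / c2) with hC3
  have hC3D : D0 + 1 ≤ C3 := le_max_left _ _
  have hC3K : 1 ≤ c2 * C3 := by
    have : 1 / c2 ≤ C3 := le_max_right _ _
    rw [div_le_iff₀ hc20] at this
    linarith
  refine ⟨c2 * C3, CG * C3, hC3K, ?_, ?_⟩
  · have : 1 ≤ C3 := by linarith
    nlinarith
  intro T hT w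
  have hT0 : 0 < T := by linarith
  set δ : ℝ := c2 * T ^ (-(A / p)) with hδ
  have hδ0 : 0 < δ := by positivity
  have hδT : δ ≤ T := by
    have : T ^ (-(A / p)) ≤ 1 := Real.rpow_le_one_of_one_le_of_nonpos hT (by
      have : 0 ≤ A / p := by positivity
      linarith)
    calc δ ≤ 1 * 1 := by rw [hδ]; gcongr
      _ ≤ T := by linarith
  have hδp : δ ^ (p : ℝ) = c2 ^ (p : ℝ) * T ^ (-A) := by
    rw [hδ, Real.mul_rpow hc20.le (by positivity), ← Real.rpow_mul hT0.le]
    congr 2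
    field_simp
  let s : Fin n → ℝ := fun k => Sum.elim (fun _ => δ) (fun _ => T) (e.symm k)
  have hs0 : ∀ k, 0 < s k := by
    intro k
    simp only [s]
    rcases e.symm k with j | j
    · exact hδ0
    · exact hT0
  have hsT : ∀ k, s k ≤ T := by
    intro k
    simp only [s]
    rcases e.symm k with j | j
    · exact hδT
    · exact le_rfl
  have hsx : ∀ j, s (e (Sum.inl j)) = δ := by intro j; simp [s]
  let L := Matrix.toLin' (Matrix.diagonal (fun k => (s k)⁻¹) * Bm)
  have hL : ∀ v k, L v k = (s k)⁻¹ * (Bm *ᵥ v) k := by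
    intro v k
    simp only [L, Matrix.toLin'_apply, ← Matrix.mulVec_mulVec, Matrix.mulVec_diagonal]
  have hprod : ∏ k, s k = δ ^ (p : ℝ) * T ^ ((n : ℝ) - p) := by
    rw [← e.prod_comp]
    have : (n : ℝ) - p = (Fintype.card (Module.Basis.sumExtendIndex hx) : ℕ) := by
      have : (n : ℝ) = p + (Fintype.card (Module.Basis.sumExtendIndex hx) : ℕ) := by exact_mod_cast hcard.symm
      linarith
    rw [this, Real.rpow_natCast, Real.rpow_natCast]
    simp [s]
  have hLd : LinearMap.det L = (∏ k, s k)⁻¹ * Bm.det := by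
    simp only [L, LinearMap.det_toLin', Matrix.det_mul, Matrix.det_diagonal, Finset.prod_inv_distrib]
  have hLd0 : LinearMap.det L ≠ 0 := by
    rw [hLd]
    exact mul_ne_zero (inv_ne_zero (Finset.prod_pos fun k _ => hs0 k).ne') hBd
  have hLdv : |LinearMap.det L| + 1 ≤ C3 * T ^ (((n : ℝ) - p) * φ) := by
    have h1 : 1 ≤ T ^ (((n : ℝ) - p) * φ) :=
      Real.one_le_rpow hT (mul_nonneg (by linarith) hφ0)
    have h2 : |LinearMap.det L| = D0 * T ^ (((n : ℝ) - p) * φ) := by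
      rw [hLd, hprod, hδp, abs_mul, abs_inv, abs_of_pos (by positivity), hD0]
      have : T ^ (((n : ℝ) - p) * φ) = (T ^ (-A) * T ^ ((n : ℝ) - p))⁻¹ := by
        rw [← Real.rpow_add hT0, ← Real.rpow_neg hT0.le]
        congr 1
        rw [hA]; ring
      rw [this, mul_assoc (c2 ^ (p : ℝ)), mul_inv]
      ring
    rw [h2]
    nlinarith
  have hbound : ∀ (v : Fin n → ℝ) (r : ℝ), ‖L v‖ ≤ r →
      (∀ j, |∑ i, v i * x i j| ≤ δ * r) ∧ ‖v‖ ≤ CG * (T * r) := by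
    intro v r hr
    have hr0 : 0 ≤ r := (norm_nonneg _).trans hr
    have hk : ∀ k, |(Bm *ᵥ v) k| ≤ s k * r := by
      intro k
      have := (norm_le_pi_norm (L v) k).trans hr
      rw [hL, Real.norm_eq_abs, abs_mul, abs_inv, abs_of_pos (hs0 k)] at this
      rwa [inv_mul_le_iff₀ (hs0 k)] at this
    constructor
    · intro j
      have := hk (e (Sum.inl j))
      rwa [hBx, hsx] at this
    · refine (hCG v).trans ?_
      gcongr
      rw [pi_norm_le_iff_of_nonneg (by positivity)]
      intro k
      refine (hk k).trans ?_
      gcongr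
      exact hsT k
  obtain ⟨v, hv⟩ := cover L hLd0 (by
    intro v hv
    by_contra! hlt
    obtain ⟨h1, h2⟩ := hbound _ _ hlt.le
    rw [mul_one] at h2
    have := hinf_vec n p hn x A c hA0 hinf v hv δ (CG * T) hδ0.le (by positivity)
      (by simpa using h1) (fun i => (norm_le_pi_norm (fun i => (v i : ℝ)) i).trans h2)
    rw [hδp, Real.mul_rpow (by linarith) hT0.le] at this
    have e1 : c2 ^ (p : ℝ) * T ^ (-A) * (CG ^ A * T ^ A) = c2 ^ (p : ℝ) * CG ^ A := by
      have : T ^ (-A) * T ^ A = 1 := by rw [← Real.rpow_add hT0]; simp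
      linear_combination (c2 ^ (p : ℝ) * CG ^ A) * this
    rw [e1] at this
    linarith) w
  rw [← map_sub] at hv
  obtain ⟨h1, h2⟩ := hbound _ _ (hv.le.trans hLdv)
  refine ⟨v, fun j => (h1 j).trans_eq ?_, fun i => ((norm_le_pi_norm _ i).trans h2).trans_eq ?_⟩
  · have e2 : -(A / p - ((n : ℝ) - p) * φ) = -(A / p) + ((n : ℝ) - p) * φ := by ring
    rw [hδ, e2, Real.rpow_add hT0]
    ring
  · rw [Real.rpow_add hT0, Real.rpow_one]
    ring

lemma approx (n p : ℕ) (hn : 2 ≤ n) (hp : 1 ≤ p) (hpn : p ≤ n - 1)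
    (x : Matrix (Fin n) (Fin p) ℝ)
    (hx : LinearIndependent ℝ (fun j i => x i j : Fin p → Fin n → ℝ))
    (φ : ℝ) (hφ0 : 0 ≤ φ) (hφ1 : φ < 1 / ((n : ℝ) * p - 1))
    (hinf : ∃ c > (0 : ℝ), ∀ ω : Matrix (Fin n) (Fin n) ℤ, ω ≠ 0 →
      c ≤ ‖(ω.map (Int.cast : ℤ → ℝ)) * x‖ ^ (p : ℝ) *
          ‖ω.map (Int.cast : ℤ → ℝ)‖ ^ (((n : ℝ) - p) * (1 + φ)))
    (ψ : ℝ)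
    (hψ : ψ = (p : ℝ) / ((n : ℝ) - p) *
      ((1 + (n : ℝ) * ((n : ℝ) - p) * φ) / (1 - ((n : ℝ) * p - 1) * φ))) :
    0 < ψ ∧ ∃ C : ℝ, 1 ≤ C ∧ ∀ η : ℝ, 0 < η → η < 1 → ∀ w : Fin n → ℝ, ∃ v : Fin n → ℤ,
      (∀ j, |∑ i, (v i - w i) * x i j| ≤ η) ∧ ∀ i, |v i - w i| ≤ C * η ^ (-ψ) := by
  obtain ⟨K, C, hK, hC, H⟩ := approx1 n p hn hp hpn x hx φ hφ0 hinf
  have hpn' : (p : ℝ) + 1 ≤ n := by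
    have : p + 1 ≤ n := by omega
    exact_mod_cast this
  have hp1 : (1 : ℝ) ≤ p := by exact_mod_cast hp
  have hn2 : (2 : ℝ) ≤ n := by exact_mod_cast hn
  have hq : 0 < (n : ℝ) - p := by linarith
  have hnp : (0 : ℝ) < n * p - 1 := by nlinarith
  have hden : 0 < 1 - ((n : ℝ) * p - 1) * φ := by
    rw [lt_div_iff₀ hnp] at hφ1
    linarith
  set q : ℝ := (n : ℝ) - p with hqdef
  have hpnp : (p : ℝ) - 1 ≤ n * p - 1 := by nlinarith
  have hden2 : 1 - ((n : ℝ) * p - 1) * φ ≤ 1 - ((p : ℝ) - 1) * φ := by nlinarith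
  have hψ0 : 0 < ψ := by rw [hψ]; positivity
  set a : ℝ := q * (1 + φ) / p - q * φ with ha
  have ha' : a = q / p * (1 - ((p : ℝ) - 1) * φ) := by rw [ha]; field_simp; ring
  have ha0 : 0 < a := by rw [ha']; exact mul_pos (by positivity) (by linarith)
  set b : ℝ := 1 + q * φ with hb
  have hb0 : 0 < b := by positivity
  have hba : b / a ≤ ψ := by
    have : b / a = (p : ℝ) / q * (b / (1 - ((p : ℝ) - 1) * φ)) := by
      rw [ha']
      have : 1 - ((p : ℝ) - 1) * φ ≠ 0 := by linarith
      field_simp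
    rw [this, hψ]
    have hbb : b ≤ 1 + n * q * φ := by
      have : 0 ≤ q * φ := by positivity
      nlinarith
    gcongr
  refine ⟨hψ0, C * K ^ (b / a), ?_, ?_⟩
  · have : 1 ≤ K ^ (b / a) := Real.one_le_rpow hK (by positivity)
    nlinarith
  intro η hη hη1 w
  have hKη : 1 ≤ K / η := by rw [one_le_div hη]; linarith
  have hKη0 : 0 < K / η := by linarith
  obtain ⟨v, h1, h2⟩ := H ((K / η) ^ (1 / a)) (Real.one_le_rpow hKη (by positivity)) w
  refine ⟨v, fun j => ?_, fun i => ?_⟩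
  · have := h1 j
    rw [← abs_neg, ← Finset.sum_neg_distrib]
    convert! this using 1
    · congr 1; exact Finset.sum_congr rfl fun _ _ => by ring
    · rw [← Real.rpow_mul hKη0.le, one_div, mul_neg, inv_mul_cancel₀ ha0.ne', Real.rpow_neg_one]
      field_simp
  · rw [abs_sub_comm]
    refine (h2 i).trans ?_
    rw [← Real.rpow_mul hKη0.le, one_div_mul_eq_div, Real.div_rpow (by linarith) hη.le, mul_assoc, div_eq_mul_inv, ← Real.rpow_neg hη.le]
    have : η ^ (-(b / a)) ≤ η ^ (-ψ) := Real.rpow_le_rpow_of_exponent_ge hη hη1.le (by linarith)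
    gcongr

lemma normal_form {U V : Type} [AddCommGroup U] [Module ℝ U] [FiniteDimensional ℝ U]
    [AddCommGroup V] [Module ℝ V] [FiniteDimensional ℝ V] (f g : U →ₗ[ℝ] V)
    (hf : Function.Injective f) (hlt : Module.finrank ℝ U < Module.finrank ℝ V) :
    ∃ (ι : Type) (_ : Fintype ι) (_ : DecidableEq ι) (b u : Module.Basis ι ℝ V) (lab : ι → Fin 3)
      (q : ι → U),
      (∀ i, lab i ≠ 2 → b i = f (q i)) ∧ (∀ i, lab i = 0 → g (q i) = u i) ∧
      (∀ i, lab i = 1 → g (q i) = 0) ∧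
      (∀ h1 h2 : U →ₗ[ℝ] V, (∀ i, lab i ≠ 2 → h1 (q i) = h2 (q i)) → h1 = h2) ∧
      0 < b.det u := by
  classical
  obtain ⟨Cc, hCc⟩ := Submodule.exists_isCompl (LinearMap.ker g)
  let qN := Module.finBasis ℝ (LinearMap.ker g)
  let qC := Module.finBasis ℝ Cc
  let qB := (qC.prod qN).map (Submodule.prodEquivOfIsCompl Cc (LinearMap.ker g) hCc.symm)
  have hqBl : ∀ i, qB (Sum.inl i) = (qC i : U) := by intro i; simp [qB]
  have hqBr : ∀ i, qB (Sum.inr i) = (qN i : U) := by intro i; simp [qB]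
  have hb0 : LinearIndependent ℝ (f ∘ qB) :=
    qB.linearIndependent.map' f (LinearMap.ker_eq_bot.mpr hf)
  have hu0 : LinearIndependent ℝ ((g.domRestrict Cc) ∘ qC) := by
    apply qC.linearIndependent.map'
    rw [LinearMap.ker_eq_bot']
    rintro ⟨m, hm⟩ h0
    have : m ∈ LinearMap.ker g ⊓ Cc := ⟨h0, hm⟩
    rw [hCc.inf_eq_bot] at this
    ext
    simpa using this
  let b := Module.Basis.sumExtend hb0
  let u0 := Module.Basis.sumExtend hu0
  have : Fintype (Module.Basis.sumExtendIndex hb0) := by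
    have := Module.Finite.finite_basis b
    have : Finite (Module.Basis.sumExtendIndex hb0) :=
      Finite.of_injective (Sum.inr : _ → (Fin (Module.finrank ℝ Cc) ⊕ Fin (Module.finrank ℝ (LinearMap.ker g))) ⊕ _) Sum.inr_injective
    exact Fintype.ofFinite _
  have : Fintype (Module.Basis.sumExtendIndex hu0) := by
    have := Module.Finite.finite_basis u0
    have : Finite (Module.Basis.sumExtendIndex hu0) :=
      Finite.of_injective (Sum.inr : _ → Fin (Module.finrank ℝ Cc) ⊕ _) Sum.inr_injective
    exact Fintype.ofFinite _
  have c1 := Module.finrank_eq_card_basis b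
  have c2 := Module.finrank_eq_card_basis u0
  have c3 := Module.finrank_eq_card_basis qB
  simp only [Fintype.card_sum] at c1 c2 c3
  have hI : 0 < Fintype.card (Module.Basis.sumExtendIndex hb0) := by omega
  obtain ⟨i00⟩ := Fintype.card_pos_iff.mp hI
  let e : Fin (Module.finrank ℝ (LinearMap.ker g)) ⊕ Module.Basis.sumExtendIndex hb0 ≃
      Module.Basis.sumExtendIndex hu0 := Fintype.equivOfCardEq (by
        rw [Fintype.card_sum]; omega)
  let u := u0.reindex ((Equiv.sumAssoc _ _ _).trans (Equiv.sumCongr (Equiv.refl _) e)).symm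
  have hu : ∀ i, u (Sum.inl (Sum.inl i)) = g (qC i) := by
    intro i
    simp [u, u0, sumExtend_inl']
  let i0 : (Fin (Module.finrank ℝ Cc) ⊕ Fin (Module.finrank ℝ (LinearMap.ker g))) ⊕
    Module.Basis.sumExtendIndex hb0 := Sum.inr i00
  let u' := u.unitsSMul (fun i => if i = i0 then -1 else 1)
  have hu' : ⇑u' = Function.update u i0 (-u i0) := by
    ext i
    by_cases hi : i = i0
    · subst hi; simp [u', Module.Basis.unitsSMul_apply]
    · simp [u', Module.Basis.unitsSMul_apply, hi]
  have hd' : b.det u' = - b.det u := by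
    rw [hu', AlternatingMap.map_update_neg, Function.update_eq_self]
  have hd0 : b.det u ≠ 0 := (b.isUnit_det u).ne_zero
  obtain ⟨u1, hu1, hd1⟩ : ∃ u1 : Module.Basis _ ℝ V,
      (∀ i, u1 (Sum.inl i) = u (Sum.inl i)) ∧ 0 < b.det u1 := by
    rcases lt_or_gt_of_ne hd0 with h | h
    · refine ⟨u', fun i => ?_, by rw [hd']; linarith⟩
      rw [hu', Function.update_of_ne]
      simp [i0]
    · exact ⟨u, fun _ => rfl, h⟩
  refine ⟨_, inferInstance, inferInstance, b, u1,
    Sum.elim (Sum.elim (fun _ => 0) (fun _ => 1)) (fun _ => 2), Sum.elim qB (fun _ => 0),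
    ?_, ?_, ?_, ?_, hd1⟩
  · rintro (i | i) hi
    · simp [b, sumExtend_inl']
    · simp at hi
  · rintro ((i | i) | i) hi
    · simp [hu1, hu, hqBl]
    · simp at hi
    · simp at hi
  · rintro ((i | i) | i) hi
    · simp at hi
    · simp [hqBr]
    · simp at hi
  · intro h1 h2 h
    apply qB.ext
    intro i
    apply h (Sum.inl i)
    rcases i with i | i <;> simp

lemma mulVec_bound {m k : ℕ} (A : Matrix (Fin m) (Fin k) ℝ) (v : Fin k → ℝ) :
    ‖A *ᵥ v‖ ≤ (k * ‖v‖) * ‖A‖ := by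
  rw [pi_norm_le_iff_of_nonneg (by positivity)]
  intro i
  rw [Matrix.mulVec, dotProduct]
  refine (norm_sum_le _ _).trans ?_
  calc ∑ j, ‖A i j * v j‖ ≤ ∑ j : Fin k, ‖A‖ * ‖v‖ := by
        apply Finset.sum_le_sum
        intro j _
        rw [norm_mul]
        gcongr
        · exact Matrix.norm_entry_le_entrywise_sup_norm A
        · exact norm_le_pi_norm v j
    _ = _ := by simp; ring

lemma robust (n p : ℕ) (hpn : p < n) (x y : Matrix (Fin n) (Fin p) ℝ)
    (hx : LinearIndependent ℝ (fun j i => x i j : Fin p → Fin n → ℝ)) :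
    ∃ W0 Z1 Z2 : Matrix (Fin n) (Fin n) ℝ, W0 * x = y ∧ Z2 * x = 0 ∧
    ∃ R κ : ℝ, 0 < R ∧ 0 < κ ∧ ∀ η T : ℝ, 0 < η → η < κ → 0 < T →
      ∀ E : Matrix (Fin n) (Fin n) ℝ, ‖E * x‖ ≤ η → ‖E‖ ≤ T →
        0 < (W0 + (η * R) • Z1 + (T * R) • Z2 + E).det := by
  have hinj : Function.Injective (Matrix.toLin' x) := by
    have : LinearIndependent ℝ x.col := hx
    rw [← Matrix.mulVec_injective_iff] at this
    exact this
  obtain ⟨ι, _, _, b, u, lab, q, hb, hu, hk, hext, hpos⟩ :=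
    normal_form (Matrix.toLin' x) (Matrix.toLin' y) hinj (by simpa using hpn)
  let Z : Fin 3 → Matrix (Fin n) (Fin n) ℝ := fun l =>
    LinearMap.toMatrix' (b.constr ℝ (fun i => if lab i = l then u i else 0))
  have hZ : ∀ l i, Z l *ᵥ b i = if lab i = l then u i else 0 := by
    intro l i
    simp only [Z, LinearMap.toMatrix'_mulVec]
    rw [b.constr_basis]
  have hxq : ∀ i, lab i ≠ 2 → x *ᵥ q i = b i := fun i hi => by
    rw [hb i hi, Matrix.toLin'_apply]
  refine ⟨Z 0, Z 1, Z 2, ?_, ?_, ?_⟩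
  · apply Matrix.toLin'.injective
    apply hext
    intro i hi
    rw [Matrix.toLin'_apply, ← Matrix.mulVec_mulVec, hxq i hi, hZ]
    split_ifs with h
    · exact (hu i h).symm
    · refine (hk i ?_).symm
      revert h hi; generalize lab i = l; fin_cases l <;> simp
  · apply Matrix.toLin'.injective
    apply hext
    intro i hi
    rw [Matrix.toLin'_apply, ← Matrix.mulVec_mulVec, hxq i hi, hZ, if_neg hi]
    simp
  obtain ⟨κ0, hκ0, hκ⟩ : ∃ κ0 > 0, ∀ v : ι → Fin n → ℝ, (∀ i, ‖v i‖ < κ0) → 0 < b.det (⇑u + v) := by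
    have hc : Continuous (fun v : ι → Fin n → ℝ => b.det (⇑u + v)) := by
      simp only [Module.Basis.det_apply]
      apply Continuous.matrix_det
      apply continuous_matrix
      intro i j
      simp only [Module.Basis.toMatrix_apply]
      have h1 : Continuous (b.coord i) := (b.coord i).continuous_of_finiteDimensional
      have h2 : Continuous (fun v : ι → Fin n → ℝ => (⇑u + v) j) := by fun_prop
      exact h1.comp h2
    have h0 : ∀ᶠ v in nhds (0 : ι → Fin n → ℝ), 0 < b.det (⇑u + v) := by
      apply hc.continuousAt.eventually_const_lt
      simpa using hpos
    obtain ⟨κ0, hκ0, h⟩ := Metric.eventually_nhds_iff.mp h0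
    refine ⟨κ0, hκ0, fun v hv => h ?_⟩
    rw [dist_zero_right, pi_norm_lt_iff hκ0]
    exact hv
  obtain ⟨c0, hc0, hcq, hcb⟩ : ∃ c0 > 0, (∀ i (A : Matrix (Fin n) (Fin p) ℝ), ‖A *ᵥ q i‖ ≤ c0 * ‖A‖) ∧
      ∀ i (A : Matrix (Fin n) (Fin n) ℝ), ‖A *ᵥ b i‖ ≤ c0 * ‖A‖ := by
    refine ⟨1 + ∑ i, ((p : ℝ) * ‖q i‖ + n * ‖b i‖), by positivity, fun i A => ?_, fun i A => ?_⟩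
    · refine (mulVec_bound _ _).trans ?_
      gcongr
      have := Finset.single_le_sum (f := fun i => (p : ℝ) * ‖q i‖ + n * ‖b i‖)
        (fun i _ => by positivity) (Finset.mem_univ i)
      have : 0 ≤ n * ‖b i‖ := by positivity
      linarith
    · refine (mulVec_bound _ _).trans ?_
      gcongr
      have := Finset.single_le_sum (f := fun i => (p : ℝ) * ‖q i‖ + n * ‖b i‖)
        (fun i _ => by positivity) (Finset.mem_univ i)
      have : 0 ≤ p * ‖q i‖ := by positivity
      linarith
  refine ⟨2 * c0 / κ0, κ0 / c0, by positivity, by positivity, ?_⟩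
  set R := 2 * c0 / κ0 with hR
  have hR0 : 0 < R := by positivity
  have hcR : c0 < κ0 * R := by
    rw [hR]
    have : κ0 * (2 * c0 / κ0) = 2 * c0 := by field_simp
    linarith
  intro η T hη hηκ hT E hEx hE
  rw [lt_div_iff₀ hc0] at hηκ
  let d : ι → ℝ := fun i => if lab i = 0 then 1 else if lab i = 1 then η * R else T * R
  have hd : ∀ i, 0 < d i := by
    intro i
    simp only [d]
    split_ifs <;> positivity
  set G := Z 0 + (η * R) • Z 1 + (T * R) • Z 2 + E with hG
  have hGb : ∀ i, G *ᵥ b i = d i • (u i + (d i)⁻¹ • (E *ᵥ b i)) := by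
    intro i
    rw [smul_add, smul_smul, mul_inv_cancel₀ (hd i).ne', one_smul, hG]
    simp only [Matrix.add_mulVec, Matrix.smul_mulVec, hZ, d]
    congr 1
    generalize lab i = l
    fin_cases l <;> simp
  have hdet : G.det = b.det (fun i => G *ᵥ b i) := by
    have h := b.det_comp (Matrix.toLin' G) b
    rw [b.det_self, mul_one, LinearMap.det_toLin'] at h
    rw [← h]
    rfl
  rw [hdet]
  simp only [hGb]
  rw [AlternatingMap.map_smul_univ, smul_eq_mul]
  refine mul_pos (Finset.prod_pos fun i _ => hd i) ?_
  apply hκ (fun i => (d i)⁻¹ • (E *ᵥ b i))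
  intro i
  rw [norm_smul, norm_inv, Real.norm_of_nonneg (hd i).le, inv_mul_lt_iff₀ (hd i)]
  have hsmall : lab i ≠ 2 → ‖E *ᵥ b i‖ ≤ c0 * η := by
    intro hi
    rw [← hxq i hi, Matrix.mulVec_mulVec]
    refine (hcq i _).trans ?_
    gcongr
  by_cases h0 : lab i = 0
  · have := hsmall (by rw [h0]; decide)
    simp only [d, h0, if_true]
    linarith
  by_cases h1 : lab i = 1
  · have := hsmall (by rw [h1]; decide)
    simp only [d, h0, h1, if_true]
    simp
    nlinarith
  · have : ‖E *ᵥ b i‖ ≤ c0 * T := (hcb i _).trans (by gcongr)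
    simp only [d, h0, h1, if_false]
    nlinarith

/-- **Theorem (Dani–Nogueira, Theorem 1.1).**
Let `n ≥ 2`, `1 ≤ p ≤ n−1`, and `x ∈ ℝ^{(n,p)}` with linearly independent columns.
Let `0 ≤ φ < 1/(np−1)` be such that
`inf_{ω ∈ M(n,ℤ)\{0}} ‖ωx‖^p ‖ω‖^{(n−p)(1+φ)} > 0`, and set
`ψ = (p/(n−p))·(1+n(n−p)φ)/(1−(np−1)φ)`. Then for every `y` there is `C ≥ 1` such
that for every `ε ∈ (0,1)` there is an integer matrix `γ` with positive determinant
satisfying `‖γx − y‖ < ε` and `‖γ‖ < C ε^{−ψ}`. -/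
theorem dani_nogueira_main
    (n p : ℕ) (hn : 2 ≤ n) (hp : 1 ≤ p) (hpn : p ≤ n - 1)
    (x : Matrix (Fin n) (Fin p) ℝ)
    (hx : LinearIndependent ℝ (fun j i => x i j : Fin p → Fin n → ℝ))
    (φ : ℝ) (hφ0 : 0 ≤ φ) (hφ1 : φ < 1 / ((n : ℝ) * p - 1))
    (hinf : ∃ c > (0 : ℝ), ∀ ω : Matrix (Fin n) (Fin n) ℤ, ω ≠ 0 →
      c ≤ ‖(ω.map (Int.cast : ℤ → ℝ)) * x‖ ^ (p : ℝ) *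
          ‖ω.map (Int.cast : ℤ → ℝ)‖ ^ (((n : ℝ) - p) * (1 + φ)))
    (ψ : ℝ)
    (hψ : ψ = (p : ℝ) / ((n : ℝ) - p) *
      ((1 + (n : ℝ) * ((n : ℝ) - p) * φ) / (1 - ((n : ℝ) * p - 1) * φ)))
    (y : Matrix (Fin n) (Fin p) ℝ) :
    ∃ C : ℝ, 1 ≤ C ∧ ∀ ε : ℝ, 0 < ε → ε < 1 →
      ∃ γ : Matrix (Fin n) (Fin n) ℤ, 0 < γ.det ∧
        ‖(γ.map (Int.cast : ℤ → ℝ)) * x - y‖ < ε ∧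
        ‖γ.map (Int.cast : ℤ → ℝ)‖ < C * ε ^ (-ψ) := by
  obtain ⟨hψ0, C, hC, H⟩ := approx n p hn hp hpn x hx φ hφ0 hφ1 hinf ψ hψ
  obtain ⟨W0, Z1, Z2, hW0, hZ2, R, κ, hR, hκ, hrob⟩ := robust n p (by omega) x y hx
  set z := ‖Z1 * x‖ with hz
  have hz0 : 0 ≤ z := norm_nonneg _
  obtain ⟨lam, hl0, hl1, hl2, hl3⟩ : ∃ lam : ℝ, 0 < lam ∧ lam < 1 ∧ lam < κ ∧ lam * (1 + R * z) < 1 := by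
    have hRz : 0 ≤ R * z := by positivity
    refine ⟨min (κ / 2) (1 / (2 * (1 + R * z))), by positivity, ?_, ?_, ?_⟩
    · refine (min_le_right _ _).trans_lt ?_
      rw [div_lt_one (by positivity)]
      linarith
    · refine (min_le_left _ _).trans_lt ?_
      linarith
    · calc _ ≤ 1 / (2 * (1 + R * z)) * (1 + R * z) := by gcongr; exact min_le_right _ _
        _ = 1 / 2 := by field_simp
        _ < 1 := by norm_num
  set M := ‖W0‖ + R * ‖Z1‖ + R * ‖Z2‖ + 2 with hM
  have hM1 : 1 ≤ M := by
    have : 0 ≤ ‖W0‖ + R * ‖Z1‖ + R * ‖Z2‖ := by positivity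
    linarith
  have hlψ : 1 ≤ lam ^ (-ψ) :=
    Real.one_le_rpow_of_pos_of_le_one_of_nonpos hl0 hl1.le (by linarith)
  refine ⟨M * (C * lam ^ (-ψ)), ?_, ?_⟩
  · have : 1 ≤ C * lam ^ (-ψ) := by nlinarith
    nlinarith
  intro ε hε hε1
  set η := lam * ε with hη
  have hη0 : 0 < η := by positivity
  have hηlam : η < lam := by rw [hη]; nlinarith
  have hη1 : η < 1 := by linarith
  set T := C * η ^ (-ψ) with hT
  have hTe : T = C * lam ^ (-ψ) * ε ^ (-ψ) := by
    rw [hT, hη, Real.mul_rpow hl0.le hε.le, mul_assoc]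
  have hT1 : 1 ≤ T := by
    have : 1 ≤ η ^ (-ψ) :=
      Real.one_le_rpow_of_pos_of_le_one_of_nonpos hη0 hη1.le (by linarith)
    rw [hT]; nlinarith
  have hT0 : 0 < T := by linarith
  set W := W0 + (η * R) • Z1 + (T * R) • Z2 with hW
  choose v hv1 hv2 using fun i => H η hη0 hη1 (W i)
  let γ : Matrix (Fin n) (Fin n) ℤ := Matrix.of v
  set E := γ.map (Int.cast : ℤ → ℝ) - W with hE
  have hγ : γ.map (Int.cast : ℤ → ℝ) = W + E := by rw [hE]; abel
  have hEx : ‖E * x‖ ≤ η := by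
    rw [Matrix.norm_le_iff hη0.le]
    intro i j
    exact hv1 i j
  have hET : ‖E‖ ≤ T := by
    rw [Matrix.norm_le_iff hT0.le]
    intro i j
    exact hv2 i j
  refine ⟨γ, ?_, ?_, ?_⟩
  · have h := hrob η T hη0 (by linarith) hT0 E hEx hET
    rw [← hW, ← hγ] at h
    have h2 : (γ.map (Int.cast : ℤ → ℝ)).det = ((γ.det : ℤ) : ℝ) :=
      ((Int.castRingHom ℝ).map_det γ).symm
    rw [h2] at h
    exact_mod_cast h
  · have e1 : γ.map (Int.cast : ℤ → ℝ) * x - y = E * x + (η * R) • (Z1 * x) := by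
      rw [hγ, hW]
      simp only [Matrix.add_mul, Matrix.smul_mul, hW0, hZ2, smul_zero]
      abel
    rw [e1]
    have e2 : ‖(η * R) • (Z1 * x)‖ ≤ η * R * z := by
      rw [Matrix.norm_le_iff (by positivity)]
      intro i j
      rw [Matrix.smul_apply, norm_smul, Real.norm_of_nonneg (by positivity)]
      gcongr
      exact Matrix.norm_entry_le_entrywise_sup_norm _
    calc _ ≤ ‖E * x‖ + ‖(η * R) • (Z1 * x)‖ := norm_add_le _ _
      _ ≤ η + η * R * z := add_le_add hEx e2
      _ = lam * (1 + R * z) * ε := by rw [hη]; ring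
      _ < 1 * ε := by gcongr
      _ = ε := one_mul _
  · rw [mul_assoc, ← hTe]
    have hs : ∀ (t : ℝ) (ht : 0 ≤ t) (A : Matrix (Fin n) (Fin n) ℝ), ‖t • A‖ ≤ t * ‖A‖ := by
      intro t ht A
      rw [Matrix.norm_le_iff (by positivity)]
      intro i j
      rw [Matrix.smul_apply, norm_smul, Real.norm_of_nonneg ht]
      gcongr
      exact Matrix.norm_entry_le_entrywise_sup_norm _
    have h1 := hs (η * R) (by positivity) Z1
    have h2 := hs (T * R) (by positivity) Z2
    have h3 : ‖W + E‖ ≤ ‖W0‖ + ‖(η * R) • Z1‖ + ‖(T * R) • Z2‖ + ‖E‖ := by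
      refine (norm_add_le _ _).trans ?_
      gcongr
      refine (norm_add_le _ _).trans ?_
      gcongr
      exact norm_add_le _ _
    rw [hγ, hM]
    have h4 : ‖W0‖ ≤ ‖W0‖ * T := le_mul_of_one_le_right (norm_nonneg _) hT1
    have h5 : η * R * ‖Z1‖ ≤ R * ‖Z1‖ * T := by
      have : 0 ≤ R * ‖Z1‖ := by positivity
      nlinarith
    nlinarith
end

section
/- Let n ≥ 2, 1 ≤ p ≤ n−1, and let x = (x_1,…,x_p) ∈ ℝ^{(n,p)} with x_1,…,x_p linearly independent vectors in ℝ^n, such that h(x) < n(n−p)/(np−1). Set φ_0 = (p/(n−p))·h(x) − 1 and ψ_0 = (p/(n−p))·(1+n(n−p)φ_0)/(1−(np−1)φ_0). If y ∈ ℝ^{(n,p)} is not of the form γx for any γ ∈ Γ, then for every ρ < 1/ψ_0 there exist infinitely many γ ∈ Γ such that ||γx − y|| < ||γ||^{−ρ}. -/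
open Matrix

attribute [local instance] Matrix.normedAddCommGroup

/-- The homogeneous exponent `h(x)` of `x ∈ ℝ^{(n,p)}`: the infimum of `u ∈ ℝ` for which
there exists `c > 0` such that `‖ωx‖ > c‖ω‖^{−u}` for all nonzero `ω ∈ M(n,ℤ)`. -/
noncomputable def homExp {n p : ℕ} (x : Matrix (Fin n) (Fin p) ℝ) : ℝ :=
  sInf {u : ℝ | ∃ c > (0 : ℝ), ∀ ω : Matrix (Fin n) (Fin n) ℤ, ω ≠ 0 →
    c * ‖ω.map (Int.cast : ℤ → ℝ)‖ ^ (-u) < ‖(ω.map (Int.cast : ℤ → ℝ)) * x‖}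


open MeasureTheory in
theorem pack {n : ℕ} (M : Matrix (Fin n) (Fin n) ℝ) (hM : M.det ≠ 0) (s : Fin n → ℝ)
    (hs : ∀ k, 0 < s k) {ι : Type} [Fintype ι] (c : ι → Fin n → ℝ)
    (hsep : ∀ i j, ∀ w : Fin n → ℤ, (i ≠ j ∨ w ≠ 0) →
      ∃ k, 2 * s k ≤ |c i k - c j k - ((fun l => (w l : ℝ)) ᵥ* M) k|) :
    (Fintype.card ι : ℝ) * ∏ k, (2 * s k) ≤ |M.det| := by
  by_contra! hlt
  have hli : LinearIndependent ℝ (fun i => M i) :=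
    Matrix.linearIndependent_rows_of_det_ne_zero hM
  let b : Module.Basis (Fin n) ℝ (Fin n → ℝ) :=
    basisOfLinearIndependentOfCardEqFinrank' (fun i => M i) hli (by simp)
  have hb : ⇑b = fun i => M i := by simp [b]
  have hvol : volume (ZSpan.fundamentalDomain b) = ENNReal.ofReal |M.det| := by
    rw [ZSpan.volume_fundamentalDomain, hb]; rfl
  let B : ι → Set (Fin n → ℝ) := fun i =>
    Set.pi Set.univ (fun k => Set.Ioo (c i k - s k) (c i k + s k))
  have hBm : ∀ i, MeasurableSet (B i) := fun i =>
    MeasurableSet.univ_pi (fun k => measurableSet_Ioo)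
  have hBv : ∀ i, volume (B i) = ENNReal.ofReal (∏ k, (2 * s k)) := by
    intro i
    rw [Real.volume_pi_Ioo, ENNReal.ofReal_prod_of_nonneg (fun k _ => by have := hs k; positivity)]
    congr 1; ext k; congr 1; ring
  have key : ∀ i j (w : Fin n → ℤ) (z z' : Fin n → ℝ), z ∈ B i → z' ∈ B j →
      z - z' = (fun l => (w l : ℝ)) ᵥ* M → i = j ∧ w = 0 := by
    intro i j w z z' hz hz' h
    by_contra hne
    have hne' : i ≠ j ∨ w ≠ 0 := by tauto
    obtain ⟨k, hk⟩ := hsep i j w hne'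
    have h1 := hz k (Set.mem_univ _)
    have h2 := hz' k (Set.mem_univ _)
    have h3 := congrFun h k
    simp only [Pi.sub_apply, Set.mem_Ioo] at h1 h2 h3
    rw [← h3] at hk
    have : |c i k - c j k - (z k - z' k)| < 2 * s k := by
      rw [abs_lt]; constructor <;> linarith
    linarith
  have hdisj : Pairwise (Function.onFun Disjoint B) := by
    intro i j hij
    rw [Function.onFun, Set.disjoint_left]
    intro z hz hz'
    exact hij (key i j 0 z z hz hz' (by ext; simp [Matrix.vecMul, dotProduct])).1
  have hX : volume (⋃ i, B i) = ENNReal.ofReal (Fintype.card ι * ∏ k, (2 * s k)) := by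
    rw [measure_iUnion hdisj hBm, tsum_fintype]
    simp only [hBv, Finset.sum_const, Finset.card_univ, nsmul_eq_mul]
    rw [ENNReal.ofReal_mul (by positivity)]
    simp
  have hlt' : volume (ZSpan.fundamentalDomain b) < volume (⋃ i, B i) := by
    rw [hvol, hX]
    exact ENNReal.ofReal_lt_ofReal_iff_of_nonneg (abs_nonneg _) |>.2 hlt
  have : Countable (Submodule.span ℤ (Set.range b)).toAddSubgroup :=
    inferInstanceAs (Countable (Submodule.span ℤ (Set.range b)))
  obtain ⟨u, v, huv, hnd⟩ := exists_pair_mem_lattice_not_disjoint_vadd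
    (ZSpan.isAddFundamentalDomain' b volume) (MeasurableSet.iUnion hBm).nullMeasurableSet hlt'
  rw [Set.not_disjoint_iff] at hnd
  obtain ⟨z, ⟨a, ha, hza⟩, ⟨a', ha', hza'⟩⟩ := hnd
  obtain ⟨i, hi⟩ := Set.mem_iUnion.1 ha
  obtain ⟨j, hj⟩ := Set.mem_iUnion.1 ha'
  have hmem : ((v : Fin n → ℝ) - u) ∈
    Submodule.span ℤ (Set.range b) := (v - u).2
  rw [Submodule.mem_span_range_iff_exists_fun] at hmem
  obtain ⟨w, hw⟩ := hmem
  have hdiff : a - a' = (fun l => (w l : ℝ)) ᵥ* M := by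
    have h1 : (u : Fin n → ℝ) + a = z := hza
    have h2 : (v : Fin n → ℝ) + a' = z := hza'
    have h3 : a - a' = (v : Fin n → ℝ) - u := by
      rw [sub_eq_sub_iff_add_eq_add, add_comm, h1, ← h2]
    rw [h3, ← hw]
    ext k
    simp [hb, Matrix.vecMul, dotProduct]
  obtain ⟨-, hw0⟩ := key i j w a a' hi hj hdiff
  apply huv
  have : (v : Fin n → ℝ) - u = 0 := by
    rw [← hw, hw0]; simp
  exact Subtype.ext (sub_eq_zero.1 this).symm

theorem extendM {n p : ℕ} (x : Matrix (Fin n) (Fin p) ℝ)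
    (hx : LinearIndependent ℝ (fun j i => x i j : Fin p → Fin n → ℝ)) :
    ∃ (M : Matrix (Fin n) (Fin n) ℝ) (f : Fin p → Fin n), M.det ≠ 0 ∧ Function.Injective f ∧
      ∀ i j, M i (f j) = x i j := by
  classical
  let b := Module.Basis.sumExtend hx
  have hb : ∀ j, b (Sum.inl j) = fun i => x i j := by
    intro j; simp [b, Module.Basis.sumExtend]; rfl
  have : Fintype (Fin p ⊕ Module.Basis.sumExtendIndex hx) := FiniteDimensional.fintypeBasisIndex b
  have hc : Fintype.card (Fin p ⊕ Module.Basis.sumExtendIndex hx) = Fintype.card (Fin n) := by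
    rw [← Module.finrank_eq_card_basis b]; simp
  let e := Fintype.equivOfCardEq hc
  let b' := b.reindex e
  refine ⟨Matrix.of fun i k => b' k i, fun j => e (Sum.inl j), ?_, ?_, ?_⟩
  · rw [← Matrix.det_transpose]
    have := b'.linearIndependent
    intro h
    have h2 : LinearIndependent ℝ (Matrix.of fun i k => b' k i)ᵀ.row := this
    rw [Matrix.linearIndependent_rows_iff_isUnit, Matrix.isUnit_iff_isUnit_det, h] at h2
    simp at h2
  · intro i j h; simpa using h
  · intro i j; simp [b', hb]

theorem cover_s2 {n : ℕ} (M : Matrix (Fin n) (Fin n) ℝ) (hM : M.det ≠ 0) (s : Fin n → ℝ)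
    (hs : ∀ k, 0 < s k) 
    (hsep : ∀ w : Fin n → ℤ, w ≠ 0 → ∃ k, 2 * s k ≤ |((fun l => (w l : ℝ)) ᵥ* M) k|)
    (z : Fin n → ℝ) :
    ∃ w : Fin n → ℤ, ∀ k, |((fun l => (w l : ℝ)) ᵥ* M) k - z k| ≤
      3 * (|M.det| / ∏ k, (2 * s k)) * s k := by
  classical
  let W : (Fin n → ℤ) → (Fin n → ℝ) := fun w => (fun l => (w l : ℝ)) ᵥ* M
  have Wadd : ∀ a b, W (a + b) = W a + W b := by
    intro a b
    simp only [W, ← Matrix.add_vecMul]; congr 1; ext; simp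
  have Wneg : ∀ a, W (-a) = - W a := by
    intro a
    simp only [W, ← Matrix.neg_vecMul]; congr 1; ext; simp
  let P : (Fin n → ℝ) → ℕ → Prop := fun v r => ∃ w, ∀ k, |W w k - v k| ≤ r * s k
  have Pex0 : ∀ v : Fin n → ℝ, ∃ r : ℕ, 0 < r ∧ ∀ k, |v k| ≤ r * s k := by
    intro v
    obtain ⟨r, hr⟩ := exists_nat_ge (∑ k, |v k| / s k)
    refine ⟨r + 1, by omega, fun k => ?_⟩
    have : |v k| / s k ≤ ∑ k, |v k| / s k :=
      Finset.single_le_sum (f := fun k => |v k| / s k)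
        (fun k _ => div_nonneg (abs_nonneg _) (hs k).le) (Finset.mem_univ k)
    rw [← div_le_iff₀ (hs k)]
    push_cast; linarith
  have W0 : W 0 = 0 := by ext; simp [W, Matrix.vecMul, dotProduct]
  have Pex : ∀ v, ∃ r, P v r := by
    intro v
    obtain ⟨r, -, hr⟩ := Pex0 v
    exact ⟨r, 0, fun k => by simpa [W0] using hr k⟩
  let g : (Fin n → ℝ) → ℕ := fun v => Nat.find (Pex v)
  have gspec : ∀ v, P v (g v) := fun v => Nat.find_spec (Pex v)
  have gle : ∀ v r, P v r → g v ≤ r := fun v r h => Nat.find_min' (Pex v) h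
  have gsub : ∀ a b r, P (a - b) r → g a ≤ g b + r := by
    intro a b r ⟨w, hw⟩
    obtain ⟨w', hw'⟩ := gspec b
    refine gle _ _ ⟨w + w', fun k => ?_⟩
    have h1 := hw k
    have h2 := hw' k
    rw [Wadd]
    simp only [Pi.add_apply, Pi.sub_apply] at *
    push_cast
    rw [abs_le] at *
    constructor <;> nlinarith
  have Psymm : ∀ a b r, P (a - b) r → P (b - a) r := by
    intro a b r ⟨w, hw⟩
    refine ⟨-w, fun k => ?_⟩
    have := hw k
    rw [Wneg]
    simp only [Pi.neg_apply, Pi.sub_apply] at *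
    rw [← abs_neg]; convert this using 2; ring
  obtain ⟨N, hN0, hN⟩ := Pex0 z
  have hN0' : (0 : ℝ) < N := by exact_mod_cast hN0
  let v : ℕ → Fin n → ℝ := fun j => ((j : ℝ) / N) • z
  have hv0 : g (v 0) = 0 := by
    apply Nat.le_zero.1; apply gle; exact ⟨0, fun k => by simp [v, W0]⟩
  have hvN : v N = z := by simp [v, hN0'.ne']
  have hstep : ∀ j, g (v (j + 1)) ≤ g (v j) + 1 := by
    intro j
    apply gsub
    refine ⟨0, fun k => ?_⟩
    have : (v (j + 1) - v j) k = z k / N := by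
      simp only [v, Pi.sub_apply, Pi.smul_apply, smul_eq_mul]; push_cast; field_simp; ring
    rw [this, W0]
    simp only [Pi.zero_apply, zero_sub, abs_neg, abs_div, abs_of_pos hN0']
    rw [div_le_iff₀ hN0']; have := hN k; push_cast; linarith
  have hivt : ∀ J t, t ≤ g (v J) → ∃ j, g (v j) = t := by
    intro J
    induction J with
    | zero => intro t ht; exact ⟨0, by omega⟩
    | succ J ih =>
      intro t ht
      by_cases h : t ≤ g (v J)
      · exact ih t h
      · exact ⟨J + 1, by have := hstep J; omega⟩
  have hm : ∀ i : Fin (g z / 3 + 1), ∃ j, g (v j) = 3 * i := by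
    intro i
    apply hivt N; rw [hvN]; have := i.2; omega
  choose J hJ using hm
  have hp := pack M hM s hs (fun i => v (J i)) (by
    intro i j w hij
    by_contra! hcon
    by_cases h : i = j
    · subst h
      obtain ⟨k, hk⟩ := hsep w (by tauto)
      have := hcon k
      simp only [sub_self, zero_sub, abs_neg] at this
      linarith
    · have hP : P (v (J i) - v (J j)) 2 := by
        refine ⟨w, fun k => ?_⟩
        have := hcon k
        rw [← abs_neg]
        simp only [Pi.sub_apply, neg_sub]
        exact_mod_cast this.le
      have h1 := gsub _ _ _ hP
      have h2 := gsub _ _ _ (Psymm _ _ _ hP)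
      rw [hJ, hJ] at h1 h2
      apply h; apply Fin.ext; omega)
  obtain ⟨w, hw⟩ := gspec z
  refine ⟨w, fun k => (hw k).trans ?_⟩
  apply mul_le_mul_of_nonneg_right _ (hs k).le
  have hpos : 0 < ∏ k, (2 * s k) := Finset.prod_pos fun k _ => by have := hs k; positivity
  rw [← le_div_iff₀ hpos] at hp
  simp only [Fintype.card_fin] at hp
  have : (g z : ℝ) ≤ 3 * ((g z / 3 + 1 : ℕ) : ℝ) := by
    have : g z ≤ 3 * (g z / 3 + 1) := by omega
    exact_mod_cast this
  linarith

theorem posdom {n : ℕ} (A : Matrix (Fin n) (Fin n) ℝ)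
    (h : ∀ k, ∑ j ∈ Finset.univ.erase k, |A k j| < A k k) : 0 < A.det := by
  classical
  let F : ℝ → ℝ := fun t => (Matrix.of fun i j => if i = j then A i j else t * A i j).det
  have hF : Continuous F := by
    apply Continuous.matrix_det
    apply continuous_matrix
    intro i j
    simp only [Matrix.of_apply]
    split_ifs <;> fun_prop
  have hne : ∀ t ∈ Set.Icc (0:ℝ) 1, F t ≠ 0 := by
    intro t ht
    apply det_ne_zero_of_sum_row_lt_diag
    intro k
    simp only [Matrix.of_apply, if_true, Real.norm_eq_abs]
    refine lt_of_le_of_lt ?_ (lt_of_lt_of_le (h k) (le_abs_self _))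
    apply Finset.sum_le_sum
    intro j hj
    have : k ≠ j := (Finset.ne_of_mem_erase hj).symm
    rw [if_neg this, abs_mul, abs_of_nonneg ht.1]
    exact mul_le_of_le_one_left (abs_nonneg _) ht.2
  have hF0 : 0 < F 0 := by
    have : (Matrix.of fun i j => if i = j then A i j else 0 * A i j) =
      Matrix.diagonal (fun i => A i i) := by
      ext i j; by_cases hij : i = j
      · subst hij; simp
      · simp [hij]
    simp only [F, this, Matrix.det_diagonal]
    exact Finset.prod_pos fun k _ => lt_of_le_of_lt (Finset.sum_nonneg fun _ _ => abs_nonneg _) (h k)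
  have hF1 : F 1 = A.det := by
    simp only [F]; congr 1; ext i j; simp
  rw [← hF1]
  by_contra! hle
  obtain ⟨t, ht, ht0⟩ := intermediate_value_Icc' (zero_le_one) hF.continuousOn ⟨hle, hF0.le⟩
  exact hne t ht ht0

set_option maxHeartbeats 1600000 in
theorem detlem {n : ℕ} (E : Matrix (Fin n) (Fin n) ℝ) (hE : E.det = 0) (σ : ℝ) (hσ : σ ≠ 0) :
    ∃ (S : Matrix (Fin n) (Fin n) ℝ) (η : ℝ), 0 < η ∧ ∀ δ : ℝ, 0 < δ → ∀ S' : Matrix (Fin n) (Fin n) ℝ,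
      (∀ i j, |S' i j - S i j| ≤ η) → 0 < σ * (E + δ • S').det := by
  classical
  obtain ⟨L, L', d, hD⟩ := Matrix.Pivot.exists_list_transvec_mul_mul_list_transvec_eq_diagonal E
  set P := (L.map TransvectionStruct.toMatrix).prod with hP
  set Q := (L'.map TransvectionStruct.toMatrix).prod with hQ
  have hPd : P.det = 1 := by simp [hP]
  have hQd : Q.det = 1 := by simp [hQ]
  clear_value P Q
  have hd0 : ∃ k, d k = 0 := by
    have := congrArg Matrix.det hD
    rw [Matrix.det_mul, Matrix.det_mul, hE, Matrix.det_diagonal] at this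
    simp only [mul_zero, zero_mul] at this
    obtain ⟨k, -, hk⟩ := Finset.prod_eq_zero_iff.1 this.symm
    exact ⟨k, hk⟩
  obtain ⟨k₀, hk₀⟩ := hd0
  -- sign vector
  obtain ⟨e, he, hed, hes⟩ : ∃ e : Fin n → ℝ, (∀ k, e k = 1 ∨ e k = -1) ∧
      (∀ k, 0 ≤ e k * d k) ∧ 0 < σ * ∏ k, e k := by
    let e0 : Fin n → ℝ := fun k => if 0 ≤ d k then 1 else -1
    have h0 : ∀ k, e0 k = 1 ∨ e0 k = -1 := by
      intro k; simp only [e0]; split_ifs <;> simp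
    have h1 : ∀ k, 0 ≤ e0 k * d k := by
      intro k; simp only [e0]; split_ifs with h
      · linarith
      · linarith
    have hprod : ∏ k, e0 k ≠ 0 := by
      rw [Finset.prod_ne_zero_iff]; intro k _
      rcases h0 k with h | h <;> rw [h] <;> norm_num
    rcases lt_or_gt_of_ne (mul_ne_zero hσ hprod) with hneg | hpos
    · refine ⟨Function.update e0 k₀ (-e0 k₀), ?_, ?_, ?_⟩
      · intro k
        by_cases hk : k = k₀
        · subst hk; rcases h0 k with h | h <;> simp [h]
        · simpa [hk] using h0 k
      · intro k
        by_cases hk : k = k₀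
        · subst hk; simp [hk₀]
        · simpa [hk] using h1 k
      · rw [Finset.prod_update_of_mem (Finset.mem_univ _)]
        rw [← Finset.mul_prod_erase _ _ (Finset.mem_univ k₀)] at hneg
        rw [Finset.sdiff_singleton_eq_erase]
        linarith
    · exact ⟨e0, h0, h1, hpos⟩
  have hPu : IsUnit P.det := by rw [hPd]; exact isUnit_one
  have hQu : IsUnit Q.det := by rw [hQd]; exact isUnit_one
  obtain ⟨S, hS⟩ : ∃ S, P * S * Q = Matrix.diagonal e := by
    refine ⟨P⁻¹ * Matrix.diagonal e * Q⁻¹, ?_⟩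
    simp only [← mul_assoc]
    rw [Matrix.mul_nonsing_inv _ hPu, one_mul, mul_assoc, Matrix.nonsing_inv_mul _ hQu, mul_one]
  -- bound
  obtain ⟨C, hCdef⟩ : ∃ C : ℝ, C = ∑ i, ∑ j, ∑ a, ∑ b, |P i a| * |Q b j| := ⟨_, rfl⟩
  have hC0 : 0 ≤ C := by rw [hCdef]; positivity
  have hC : ∀ (η : ℝ) (X : Matrix (Fin n) (Fin n) ℝ), (∀ i j, |X i j| ≤ η) →
      ∀ i j, |(P * X * Q) i j| ≤ C * η := by
    intro η X hX i j
    have hη : 0 ≤ η := (abs_nonneg _).trans (hX i j)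
    have h1 : |(P * X * Q) i j| ≤ (∑ a, ∑ b, |P i a| * |Q b j|) * η := by
      rw [Matrix.mul_apply]
      simp only [Matrix.mul_apply, Finset.sum_mul]
      rw [Finset.sum_comm]
      refine (Finset.abs_sum_le_sum_abs _ _).trans (Finset.sum_le_sum fun a _ => ?_)
      refine (Finset.abs_sum_le_sum_abs _ _).trans (Finset.sum_le_sum fun b _ => ?_)
      rw [abs_mul, abs_mul]
      have := hX a b
      have h3 : |P i a| * |Q b j| * |X a b| ≤ |P i a| * |Q b j| * η := by gcongr
      linarith
    refine h1.trans (mul_le_mul_of_nonneg_right ?_ hη)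
    rw [hCdef]
    refine le_trans ?_ (Finset.single_le_sum (f := fun i => ∑ j, ∑ a, ∑ b, |P i a| * |Q b j|)
      (fun i _ => by positivity) (Finset.mem_univ i))
    exact (Finset.single_le_sum (f := fun j => ∑ a, ∑ b, |P i a| * |Q b j|)
      (fun i _ => by positivity) (Finset.mem_univ j))
  refine ⟨S, 1 / ((C + 1) * (n + 1)), by positivity, ?_⟩
  intro δ hδ S' hS'
  have hB := hC (1 / ((C + 1) * (n + 1))) (S' - S) (by simpa using hS')
  set X := P * (S' - S) * Q with hX
  have hXb : ∀ i j, |X i j| * (n + 1) < 1 := by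
    intro i j
    have h1 := hB i j
    have h2 : C * (1 / ((C + 1) * (n + 1))) * (n + 1) = C / (C + 1) := by field_simp
    have h3 : C / (C + 1) < 1 := by rw [div_lt_one (by positivity)]; linarith
    calc _ ≤ C * (1 / ((C + 1) * (n + 1))) * (n + 1) := by gcongr
      _ < 1 := by rw [h2]; exact h3
  have hdet : (E + δ • S').det = (Matrix.diagonal d + δ • (Matrix.diagonal e + X)).det := by
    have : Matrix.diagonal d + δ • (Matrix.diagonal e + X) = P * (E + δ • S') * Q := by
      rw [← hD, ← hS, hX]
      simp only [mul_add, add_mul, mul_sub, sub_mul, Matrix.mul_smul, Matrix.smul_mul, add_sub_cancel]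
    rw [this, Matrix.det_mul, Matrix.det_mul, hPd, hQd, one_mul, mul_one]
  have hpos := posdom (Matrix.diagonal e * (Matrix.diagonal d + δ • (Matrix.diagonal e + X))) (by
    intro k
    have hek : |e k| = 1 := by rcases he k with h | h <;> simp [h]
    have hee : e k * e k = 1 := by rcases he k with h | h <;> simp [h]
    have hn : (0:ℝ) < n + 1 := by positivity
    have hsm : ∀ j, |X k j| < 1 / (n + 1) := fun j => by
      rw [lt_div_iff₀ hn]; exact hXb k j
    have h1 : ∑ j ∈ Finset.univ.erase k,
        |(Matrix.diagonal e * (Matrix.diagonal d + δ • (Matrix.diagonal e + X))) k j| ≤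
        ∑ j ∈ Finset.univ.erase k, δ * (1 / (n + 1)) := by
      apply Finset.sum_le_sum
      intro j hj
      have : k ≠ j := (Finset.ne_of_mem_erase hj).symm
      simp only [Matrix.diagonal_mul, Matrix.add_apply, Matrix.smul_apply,
        Matrix.diagonal_apply_ne _ this, zero_add, smul_eq_mul, abs_mul, hek, one_mul, abs_of_pos hδ]
      have := hsm j
      gcongr
    refine lt_of_le_of_lt h1 ?_
    rw [Finset.sum_const, Finset.card_erase_of_mem (Finset.mem_univ _), Finset.card_univ,
      Fintype.card_fin, nsmul_eq_mul]
    simp only [Matrix.diagonal_mul, Matrix.add_apply, Matrix.smul_apply,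
        Matrix.diagonal_apply_eq, smul_eq_mul]
    have h2 : |e k * X k k| < 1 / (n + 1) := by rw [abs_mul, hek, one_mul]; exact hsm k
    have h3 := (abs_lt.1 h2).1
    have h4 := hed k
    have h5 : ((n - 1 : ℕ) : ℝ) = n - 1 := by
      have := k.2
      rw [Nat.cast_sub (by omega)]; simp
    have h6 : e k * (d k + δ * (e k + X k k)) = e k * d k + δ * (1 + e k * X k k) := by
      rw [← hee]; ring
    rw [h6, h5]
    have h7 : ((n:ℝ) - 1) * (1 / (n + 1)) < 1 + e k * X k k := by
      have : ((n:ℝ) - 1) * (1 / (n + 1)) = 1 - 2 * (1 / (n + 1)) := by field_simp; ring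
      rw [this]
      have : 0 < 1 / ((n:ℝ) + 1) := by positivity
      linarith
    have := mul_lt_mul_of_pos_left h7 hδ
    linarith)
  rw [Matrix.det_mul, Matrix.det_diagonal, ← hdet] at hpos
  have h8 : (∏ k, e k) * (∏ k, e k) = 1 := by
    rw [← Finset.prod_mul_distrib]
    apply Finset.prod_eq_one; intro k _
    rcases he k with h | h <;> simp [h]
  have := mul_pos hes hpos
  calc (0:ℝ) < _ := this
    _ = σ * ((∏ k, e k) * (∏ k, e k)) * (E + δ • S').det := by ring
    _ = _ := by rw [h8, mul_one]

theorem invbound {n : ℕ} (M : Matrix (Fin n) (Fin n) ℝ) (hM : M.det ≠ 0) :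
    ∃ C : ℝ, 1 ≤ C ∧ ∀ (v : Fin n → ℝ) (B : ℝ), (∀ k, |(v ᵥ* M) k| ≤ B) → ∀ l, |v l| ≤ C * B := by
  refine ⟨1 + ∑ k, ∑ l, |M⁻¹ k l|, le_add_of_nonneg_right (by positivity), ?_⟩
  intro v B h l
  have hv : v = (v ᵥ* M) ᵥ* M⁻¹ := by
    rw [Matrix.vecMul_vecMul, Matrix.mul_nonsing_inv _ (Ne.isUnit hM), Matrix.vecMul_one]
  have hB : 0 ≤ B := (abs_nonneg _).trans (h l)
  have h1 : |v l| ≤ ∑ k, |M⁻¹ k l| * B := by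
    rw [hv]
    simp only [Matrix.vecMul, dotProduct]
    refine (Finset.abs_sum_le_sum_abs _ _).trans (Finset.sum_le_sum fun k _ => ?_)
    rw [abs_mul, mul_comm]
    have := h k
    simp only [Matrix.vecMul, dotProduct] at this
    gcongr
  refine h1.trans ?_
  rw [← Finset.sum_mul]
  apply mul_le_mul_of_nonneg_right _ hB
  have : ∑ k, |M⁻¹ k l| ≤ ∑ k, ∑ l, |M⁻¹ k l| :=
    Finset.sum_le_sum fun k _ => Finset.single_le_sum (f := fun l => |M⁻¹ k l|)
      (fun _ _ => abs_nonneg _) (Finset.mem_univ l)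
  linarith

theorem rowform {n p : ℕ} (hn : 0 < n) (x : Matrix (Fin n) (Fin p) ℝ) (u c : ℝ) (hu : 0 < u)
    (hc : 0 < c)
    (h : ∀ ω : Matrix (Fin n) (Fin n) ℤ, ω ≠ 0 →
      c * ‖ω.map (Int.cast : ℤ → ℝ)‖ ^ (-u) < ‖(ω.map (Int.cast : ℤ → ℝ)) * x‖)
    (w : Fin n → ℤ) (hw : w ≠ 0) (B : ℝ) (hB : ∀ l, |(w l : ℝ)| ≤ B) :
    ∃ j, c * B ^ (-u) < |((fun l => (w l : ℝ)) ᵥ* x) j| := by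
  by_contra! hcon
  let i0 : Fin n := ⟨0, hn⟩
  let ω : Matrix (Fin n) (Fin n) ℤ := Matrix.of fun i l => if i = i0 then w l else 0
  obtain ⟨l, hl⟩ := Function.ne_iff.1 hw
  have hω : ω ≠ 0 := by
    intro h0
    have := congrFun (congrFun h0 i0) l
    simp [ω] at this
    exact hl this
  have hB0 : 0 ≤ B := (abs_nonneg _).trans (hB l)
  have h1 : ‖ω.map (Int.cast : ℤ → ℝ)‖ ≤ B := by
    rw [Matrix.norm_le_iff hB0]
    intro i j
    simp only [ω, Matrix.map_apply, Matrix.of_apply, Real.norm_eq_abs]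
    split_ifs
    · exact hB j
    · simpa using hB0
  have h2 : 0 < ‖ω.map (Int.cast : ℤ → ℝ)‖ := by
    rw [norm_pos_iff]
    intro h0
    apply hω
    ext i j
    have := congrFun (congrFun h0 i) j
    simpa using this
  have h3 := h ω hω
  have h4 : ‖(ω.map (Int.cast : ℤ → ℝ)) * x‖ ≤ c * B ^ (-u) := by
    have hpos : 0 ≤ c * B ^ (-u) := mul_nonneg hc.le (Real.rpow_nonneg hB0 _)
    rw [Matrix.norm_le_iff hpos]
    intro i j
    by_cases hi : i = i0
    · have := hcon j
      simpa [Matrix.mul_apply, ω, hi, Matrix.vecMul, dotProduct] using this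
    · simpa [Matrix.mul_apply, ω, hi] using hpos
  have h5 : B ^ (-u) ≤ ‖ω.map (Int.cast : ℤ → ℝ)‖ ^ (-u) :=
    Real.rpow_le_rpow_of_nonpos h2 h1 (by linarith)
  have := mul_le_mul_of_nonneg_left h5 hc.le
  linarith

open Classical in
theorem step1 {n p : ℕ} (hpn : p < n) (x : Matrix (Fin n) (Fin p) ℝ)
    (hx : LinearIndependent ℝ (fun j i => x i j : Fin p → Fin n → ℝ)) (u c : ℝ) (hu : 0 < u)
    (hc : 0 < c)
    (h : ∀ ω : Matrix (Fin n) (Fin n) ℤ, ω ≠ 0 →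
      c * ‖ω.map (Int.cast : ℤ → ℝ)‖ ^ (-u) < ‖(ω.map (Int.cast : ℤ → ℝ)) * x‖) :
    0 ≤ u * p - (n - p) ∧
    ∃ (M : Matrix (Fin n) (Fin n) ℝ) (f : Fin p → Fin n) (κ Kc : ℝ), M.det ≠ 0 ∧
      Function.Injective f ∧ (∀ i j, M i (f j) = x i j) ∧ 0 < κ ∧ κ ≤ 1 ∧ 0 < Kc ∧
      ∀ T : ℝ, 1 ≤ T → ∀ z : Fin n → ℝ, ∃ w : Fin n → ℤ, ∀ k,
        |((fun l => (w l : ℝ)) ᵥ* M) k - z k| ≤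
          Kc * T ^ (u * p - (n - p)) * (if ∃ j, f j = k then κ * T ^ (-u) else T) := by
  obtain ⟨M, f, hM, hf, hMx⟩ := extendM x hx
  obtain ⟨C, hC1, hC⟩ := invbound M hM
  obtain ⟨κ, hκ0, hκ1, hκ⟩ : ∃ κ : ℝ, 0 < κ ∧ κ ≤ 1 ∧ 2 * κ ≤ c * (C * 2) ^ (-u) := by
    have h1 : 0 < c * (C * 2) ^ (-u) := by positivity
    exact ⟨min (c * (C * 2) ^ (-u) / 2) 1, by positivity, min_le_right _ _, by
      have := min_le_left (c * (C * 2) ^ (-u) / 2) 1; linarith⟩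
  let s : ℝ → Fin n → ℝ := fun T k => if ∃ j, f j = k then κ * T ^ (-u) else T
  have hεT : ∀ T : ℝ, 1 ≤ T → κ * T ^ (-u) ≤ T := by
    intro T hT
    have : T ^ (-u) ≤ 1 := Real.rpow_le_one_of_one_le_of_nonpos hT (by linarith)
    have h0 : 0 < T ^ (-u) := by positivity
    nlinarith
  have hs : ∀ T : ℝ, 1 ≤ T → ∀ k, 0 < s T k := by
    intro T hT k
    simp only [s]; split_ifs <;> positivity
  have hsT : ∀ T : ℝ, 1 ≤ T → ∀ k, s T k ≤ T := by
    intro T hT k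
    simp only [s]; split_ifs
    · exact hεT T hT
    · exact le_rfl
  have hsep : ∀ T : ℝ, 1 ≤ T → ∀ w : Fin n → ℤ, w ≠ 0 →
      ∃ k, 2 * s T k ≤ |((fun l => (w l : ℝ)) ᵥ* M) k| := by
    intro T hT w hw
    by_contra! hcon
    have h1 := hC (fun l => (w l : ℝ)) (2 * T) (fun k => (hcon k).le.trans (by
      have := hsT T hT k; linarith))
    obtain ⟨j, hj⟩ := rowform (by omega) x u c hu hc h w hw _ h1
    have h2 := hcon (f j)
    have h3 : ((fun l => (w l : ℝ)) ᵥ* M) (f j) = ((fun l => (w l : ℝ)) ᵥ* x) j := by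
      simp [Matrix.vecMul, dotProduct, hMx]
    rw [h3] at h2
    have h4 : s T (f j) = κ * T ^ (-u) := by simp [s]
    rw [h4] at h2
    have h5 : (C * (2 * T)) ^ (-u) = (C * 2) ^ (-u) * T ^ (-u) := by
      rw [← mul_assoc, Real.mul_rpow (by positivity) (by positivity)]
    rw [h5] at hj
    have h6 : 0 < T ^ (-u) := by positivity
    nlinarith
  have hprod : ∀ T : ℝ, 1 ≤ T →
      ∏ k, (2 * s T k) = 2 ^ n * κ ^ p * T ^ (-(u * p - (n - p))) := by
    intro T hT
    have hT0 : 0 < T := by linarith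
    rw [Finset.prod_mul_distrib]
    simp only [Finset.prod_const, Finset.card_univ, Fintype.card_fin, s]
    rw [Finset.prod_ite, Finset.prod_const, Finset.prod_const]
    have hcard : (Finset.univ.filter (fun k => ∃ j, f j = k)).card = p := by
      have : Finset.univ.filter (fun k => ∃ j, f j = k) = Finset.univ.image f := by
        ext k; simp
      rw [this, Finset.card_image_of_injective _ hf]; simp
    have hcard2 : (Finset.univ.filter (fun k => ¬ ∃ j, f j = k)).card = n - p := by
      have h1 := Finset.card_filter_add_card_filter_not (s := (Finset.univ : Finset (Fin n)))
        (fun k => ∃ j, f j = k)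
      rw [hcard, Finset.card_univ, Fintype.card_fin] at h1
      omega
    rw [hcard, hcard2, mul_pow, mul_assoc, mul_assoc]
    congr 2
    rw [← Real.rpow_natCast, ← Real.rpow_natCast, ← Real.rpow_mul hT0.le, ← Real.rpow_add hT0,
      Nat.cast_sub hpn.le]
    congr 1; ring
  have hdet : 0 < |M.det| := abs_pos.2 hM
  refine ⟨?_, M, f, κ, 3 * (|M.det| / (2 ^ n * κ ^ p)), hM, hf, hMx, hκ0, hκ1, by positivity, ?_⟩
  · by_contra! hneg
    have hle : ∀ T : ℝ, 1 ≤ T → 2 ^ n * κ ^ p * T ^ (-(u * p - (n - p))) ≤ |M.det| := by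
      intro T hT
      rw [← hprod T hT]
      have := pack M hM (s T) (hs T hT) (ι := Unit) (fun _ => 0) (by
        intro i j w hw
        obtain ⟨k, hk⟩ := hsep T hT w (by simpa using hw)
        exact ⟨k, by simpa using hk⟩)
      simpa using this
    have ht := (tendsto_rpow_atTop (y := -(u * p - (n - p))) (by linarith)).const_mul_atTop
      (show (0:ℝ) < 2 ^ n * κ ^ p by positivity)
    obtain ⟨T, hT1, hT2⟩ := ((ht.eventually_gt_atTop |M.det|).and
      (Filter.eventually_ge_atTop 1)).exists
    exact absurd (hle T hT2) (not_le.2 hT1)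
  · intro T hT z
    obtain ⟨w, hw⟩ := cover_s2 M hM (s T) (hs T hT) (hsep T hT) z
    refine ⟨w, fun k => (hw k).trans (le_of_eq ?_)⟩
    rw [hprod T hT, Real.rpow_neg (by linarith)]
    have : 0 < T ^ (u * p - ((n:ℝ) - p)) := by positivity
    simp only [s]
    field_simp

theorem step2 {n p : ℕ} (hpn : p < n) (x : Matrix (Fin n) (Fin p) ℝ)
    (hx : LinearIndependent ℝ (fun j i => x i j : Fin p → Fin n → ℝ)) (u c : ℝ) (hu : 0 < u)
    (hc : 0 < c)
    (h : ∀ ω : Matrix (Fin n) (Fin n) ℤ, ω ≠ 0 →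
      c * ‖ω.map (Int.cast : ℤ → ℝ)‖ ^ (-u) < ‖(ω.map (Int.cast : ℤ → ℝ)) * x‖)
    (y : Matrix (Fin n) (Fin p) ℝ) :
    ∃ C : ℝ, 0 < C ∧ ∀ T : ℝ, 1 ≤ T → ∃ γ : Matrix (Fin n) (Fin n) ℤ, 0 < γ.det ∧
      ‖(γ.map (Int.cast : ℤ → ℝ)) * x - y‖ ≤ C * T ^ ((u * p - (n - p)) - u) ∧
      ‖γ.map (Int.cast : ℤ → ℝ)‖ ≤ C * T ^ ((u * p - (n - p)) + 1) := by
  classical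
  obtain ⟨hβ, M, f, κ, Kc, hM, hf, hMx, hκ0, hκ1, hKc, hcov⟩ := step1 hpn x hx u c hu hc h
  obtain ⟨CM, hCM1, hCM⟩ := invbound M hM
  set β : ℝ := u * p - (n - p) with hβdef
  clear_value β
  -- extended y
  obtain ⟨E, hEf, hE0⟩ : ∃ E : Matrix (Fin n) (Fin n) ℝ, (∀ i j, E i (f j) = y i j) ∧
      ∀ i k, (¬ ∃ j, f j = k) → E i k = 0 := by
    refine ⟨Matrix.of fun i k => if hk : ∃ j, f j = k then y i hk.choose else 0, ?_, ?_⟩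
    · intro i j
      have hex : ∃ j', f j' = f j := ⟨j, rfl⟩
      simp only [Matrix.of_apply]
      rw [dif_pos hex, hf hex.choose_spec]
    · intro i k hk
      simp only [Matrix.of_apply]
      rw [dif_neg hk]
  have hEd : E.det = 0 := by
    have : ∃ k, ¬ ∃ j, f j = k := by
      by_contra! hs
      have := Fintype.card_le_of_surjective f hs
      simp at this; omega
    obtain ⟨k, hk⟩ := this
    exact Matrix.det_eq_zero_of_column_eq_zero k (fun i => hE0 i k hk)
  obtain ⟨S, η, hη, hS⟩ := detlem E hEd M.det hM
  obtain ⟨B, hB0, hSB⟩ : ∃ B : ℝ, 0 ≤ B ∧ ∀ i k, |S i k| ≤ B :=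
    ⟨‖S‖, norm_nonneg _, fun i k => Matrix.norm_entry_le_entrywise_sup_norm S⟩
  obtain ⟨Y, hY0, hEY⟩ : ∃ Y : ℝ, 0 ≤ Y ∧ ∀ i k, |E i k| ≤ Y :=
    ⟨‖E‖, norm_nonneg _, fun i k => Matrix.norm_entry_le_entrywise_sup_norm E⟩
  refine ⟨CM * (Y + Kc / η * (B + η)), by positivity, ?_⟩
  intro T hT
  have hT0 : 0 < T := by linarith
  set K := Kc * T ^ β with hK
  have hK0 : 0 < K := by positivity
  set ε := κ * T ^ (-u) with hε
  have hε0 : 0 < ε := by positivity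
  set s : Fin n → ℝ := fun k => if ∃ j, f j = k then ε else T with hs
  have hs0 : ∀ k, 0 < s k := by
    intro k; simp only [hs]; split_ifs <;> assumption
  have hw : ∀ i, ∃ w : Fin n → ℤ, ∀ k,
      |((fun l => (w l : ℝ)) ᵥ* M) k - (E i k + K / η * s k * S i k)| ≤ K * s k :=
    fun i => hcov T hT (fun k => E i k + K / η * s k * S i k)
  choose γ hγ using hw
  let G : Matrix (Fin n) (Fin n) ℝ := (Matrix.of γ).map (Int.cast : ℤ → ℝ)
  have hγ' : ∀ i k, |(G * M) i k - (E i k + K / η * s k * S i k)| ≤ K * s k := hγ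
  let S' : Matrix (Fin n) (Fin n) ℝ := Matrix.of fun i k => ((G * M) i k - E i k) * (η / (K * s k))
  have hS'S : ∀ i k, |S' i k - S i k| ≤ η := by
    intro i k
    have h1 := hγ' i k
    have h2 := hs0 k
    have h3 : S' i k - S i k =
      ((G * M) i k - (E i k + K / η * s k * S i k)) * (η / (K * s k)) := by
      simp only [S', Matrix.of_apply]; field_simp; ring
    rw [h3, abs_mul, abs_of_pos (show 0 < η / (K * s k) by positivity)]
    calc _ ≤ K * s k * (η / (K * s k)) := by gcongr
      _ = η := by field_simp
  have hS'B : ∀ i k, |S' i k| ≤ B + η := by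
    intro i k
    have h1 := hS'S i k
    have h2 := hSB i k
    have h3 := abs_add_le (S' i k - S i k) (S i k)
    rw [sub_add_cancel] at h3
    linarith
  have hGS : ∀ i k, (G * M) i k - E i k = K / η * s k * S' i k := by
    intro i k
    have h2 := hs0 k
    simp only [S', Matrix.of_apply]; field_simp
  have hGM : G * M = (E + (K * ε / η) • S') * Matrix.diagonal (fun k => s k / ε) := by
    ext i k
    rw [Matrix.mul_diagonal]
    simp only [Matrix.add_apply, Matrix.smul_apply, smul_eq_mul]
    have h1 : E i k * (s k / ε) = E i k := by
      by_cases hk : ∃ j, f j = k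
      · simp only [hs]; rw [if_pos hk, div_self hε0.ne', mul_one]
      · rw [hE0 i k hk, zero_mul]
    have h2 := hGS i k
    rw [add_mul, h1]
    have h3 : K * ε / η * S' i k * (s k / ε) = K / η * s k * S' i k := by field_simp
    rw [h3]; linarith
  have hdet : 0 < (Matrix.of γ).det := by
    have h1 := hS (K * ε / η) (by positivity) S' hS'S
    have h2 := congrArg Matrix.det hGM
    rw [Matrix.det_mul, Matrix.det_mul, Matrix.det_diagonal] at h2
    have h3 : 0 < ∏ k, (s k / ε) := Finset.prod_pos fun k _ => div_pos (hs0 k) hε0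
    have h4 : G.det * (M.det * M.det) = M.det * (E + (K * ε / η) • S').det * ∏ k, (s k / ε) := by
      rw [← mul_assoc, h2]; ring
    have h5 : 0 < G.det * (M.det * M.det) := by rw [h4]; positivity
    have h6 : 0 < G.det := pos_of_mul_pos_left h5 (mul_self_nonneg _)
    have h7 : G.det = (((Matrix.of γ).det : ℤ) : ℝ) := by
      simp only [G]
      exact (Int.cast_det _).symm
    rw [h7] at h6
    exact_mod_cast h6
  have hTβ1 : 1 ≤ T ^ (β + 1) := Real.one_le_rpow hT (by linarith)
  have hsT : ∀ k, s k ≤ T := by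
    intro k; simp only [hs]; split_ifs
    · have : T ^ (-u) ≤ 1 := Real.rpow_le_one_of_one_le_of_nonpos hT (by linarith)
      have h0 : 0 < T ^ (-u) := by positivity
      simp only [hε]; nlinarith
    · exact le_rfl
  refine ⟨Matrix.of γ, hdet, ?_, ?_⟩
  · rw [Matrix.norm_le_iff (by positivity)]
    intro i j
    have h1 : ((G * x) - y) i j = K / η * ε * S' i (f j) := by
      have h2 := hGS i (f j)
      have h3 : (G * M) i (f j) = (G * x) i j := by simp [Matrix.mul_apply, hMx]
      have h4 : s (f j) = ε := by simp [hs]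
      rw [h3, hEf, h4] at h2
      exact h2
    change ‖((G * x) - y) i j‖ ≤ _
    rw [h1, Real.norm_eq_abs, abs_mul, abs_of_pos (show 0 < K / η * ε by positivity)]
    have h2 : K / η * ε = Kc / η * κ * T ^ (β - u) := by
      rw [hK, hε, sub_eq_add_neg, Real.rpow_add hT0]; ring
    rw [h2]
    calc _ ≤ Kc / η * 1 * T ^ (β - u) * (B + η) := by
          gcongr
          exact hS'B _ _
      _ = 1 * (0 + Kc / η * (B + η)) * T ^ (β - u) := by ring
      _ ≤ _ := by gcongr
  · rw [Matrix.norm_le_iff (by positivity)]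
    intro i l
    have h1 := hCM (G i) ((Y + Kc / η * (B + η)) * T ^ (β + 1)) (by
      intro k
      have h2 := hGS i k
      have h3 : (G i ᵥ* M) k = E i k + K / η * s k * S' i k := by
        have : (G i ᵥ* M) k = (G * M) i k := rfl
        rw [this]; linarith
      rw [h3]
      refine (abs_add_le _ _).trans ?_
      rw [abs_mul, abs_of_pos (show 0 < K / η * s k by have := hs0 k; positivity), add_mul]
      have h4 : |E i k| ≤ Y * T ^ (β + 1) := (hEY i k).trans (le_mul_of_one_le_right hY0 hTβ1)
      have h5 : K / η * s k * |S' i k| ≤ K / η * T * (B + η) := by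
        have := hs0 k
        gcongr
        · exact hsT k
        · exact hS'B _ _
      have h6 : K / η * T * (B + η) = Kc / η * (B + η) * T ^ (β + 1) := by
        rw [hK, Real.rpow_add hT0, Real.rpow_one]; ring
      linarith) l
    change ‖G i l‖ ≤ _
    rw [Real.norm_eq_abs, mul_assoc]
    exact h1

theorem one_le_nm {n : ℕ} (ω : Matrix (Fin n) (Fin n) ℤ) (hω : ω ≠ 0) :
    1 ≤ ‖ω.map (Int.cast : ℤ → ℝ)‖ := by
  have : ∃ i j, ω i j ≠ 0 := by
    by_contra! h
    exact hω (by ext i j; exact h i j)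
  obtain ⟨i, j, hij⟩ := this
  have h1 : ‖(ω.map (Int.cast : ℤ → ℝ)) i j‖ ≤ ‖ω.map (Int.cast : ℤ → ℝ)‖ :=
    Matrix.norm_entry_le_entrywise_sup_norm _
  refine le_trans ?_ h1
  rw [Matrix.map_apply, Real.norm_eq_abs, ← Int.cast_abs]
  exact_mod_cast Int.one_le_abs hij

theorem junk {n p : ℕ} (hn : 0 < n) (x y : Matrix (Fin n) (Fin p) ℝ) (ρ : ℝ) (hρ : 1 < -ρ) :
    {γ : Matrix (Fin n) (Fin n) ℤ | 0 < γ.det ∧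
      ‖(γ.map (Int.cast : ℤ → ℝ)) * x - y‖ < ‖γ.map (Int.cast : ℤ → ℝ)‖ ^ (-ρ)}.Infinite := by
  have ht := ((tendsto_rpow_atTop (y := -ρ - 1) (by linarith)).comp
    (tendsto_natCast_atTop_atTop (R := ℝ))).eventually_gt_atTop (‖x‖ + ‖y‖)
  obtain ⟨t0, ht0⟩ := Filter.eventually_atTop.1 ht
  let g : ℕ → Matrix (Fin n) (Fin n) ℤ := fun t => Matrix.diagonal (fun _ => ((t + t0 + 1 : ℕ) : ℤ))
  apply Set.infinite_of_injective_forall_mem (f := g)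
  · intro a b hab
    have := congrFun (congrFun hab ⟨0, hn⟩) ⟨0, hn⟩
    simp only [g, Matrix.diagonal_apply_eq] at this
    omega
  · intro t
    have h1 := ht0 (t + t0 + 1) (by omega)
    simp only [Function.comp] at h1
    set τ : ℝ := ((t + t0 + 1 : ℕ) : ℝ) with hτ
    have hτ1 : 1 ≤ τ := by rw [hτ]; exact_mod_cast (by omega : 1 ≤ t + t0 + 1)
    have hτ0 : 0 < τ := by linarith
    have hmap : (g t).map (Int.cast : ℤ → ℝ) = Matrix.diagonal (fun _ => τ) := by
      simp only [g]
      rw [Matrix.diagonal_map (by simp)]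
      simp [hτ]
    refine ⟨?_, ?_⟩
    · simp only [g, Matrix.det_diagonal]
      exact Finset.prod_pos fun _ _ => by positivity
    · rw [hmap]
      have h2 : τ ≤ ‖(Matrix.diagonal (fun _ => τ) : Matrix (Fin n) (Fin n) ℝ)‖ := by
        have := Matrix.norm_entry_le_entrywise_sup_norm
          (Matrix.diagonal (fun _ => τ) : Matrix (Fin n) (Fin n) ℝ) (i := ⟨0, hn⟩) (j := ⟨0, hn⟩)
        rw [Matrix.diagonal_apply_eq, Real.norm_eq_abs, abs_of_pos hτ0] at this
        exact this
      refine lt_of_lt_of_le ?_ (Real.rpow_le_rpow hτ0.le h2 (by linarith))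
      have h3 : τ ^ (-ρ) = τ * τ ^ (-ρ - 1) := by
        rw [Real.rpow_sub_one hτ0.ne']; field_simp
      have h4 : ‖(Matrix.diagonal (fun _ => τ) : Matrix (Fin n) (Fin n) ℝ) * x - y‖ ≤
          τ * ‖x‖ + ‖y‖ := by
        rw [Matrix.norm_le_iff (by positivity)]
        intro i j
        rw [Matrix.sub_apply, Matrix.diagonal_mul]
        refine (norm_sub_le _ _).trans ?_
        rw [norm_mul, Real.norm_of_nonneg hτ0.le]
        have e1 : ‖x i j‖ ≤ ‖x‖ := Matrix.norm_entry_le_entrywise_sup_norm x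
        have e2 : ‖y i j‖ ≤ ‖y‖ := Matrix.norm_entry_le_entrywise_sup_norm y
        gcongr
      rw [h3]
      have h5 := mul_lt_mul_of_pos_left h1 hτ0
      have h6 : ‖y‖ ≤ τ * ‖y‖ := le_mul_of_one_le_left (norm_nonneg _) hτ1
      linarith

theorem step3 {n p : ℕ} (hn : 0 < n) (x y : Matrix (Fin n) (Fin p) ℝ)
    (hy : ¬ ∃ γ : Matrix (Fin n) (Fin n) ℤ, 0 < γ.det ∧ (γ.map (Int.cast : ℤ → ℝ)) * x = y)
    (ρ ρ' a b C : ℝ) (hρ' : 0 < ρ') (hρ : ρ ≤ ρ') (ha : 0 < a) (hC : 0 < C) (hab : ρ' * b < a)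
    (h : ∀ T : ℝ, 1 ≤ T → ∃ γ : Matrix (Fin n) (Fin n) ℤ, 0 < γ.det ∧
      ‖(γ.map (Int.cast : ℤ → ℝ)) * x - y‖ ≤ C * T ^ (-a) ∧
      ‖γ.map (Int.cast : ℤ → ℝ)‖ ≤ C * T ^ b) :
    {γ : Matrix (Fin n) (Fin n) ℤ | 0 < γ.det ∧
      ‖(γ.map (Int.cast : ℤ → ℝ)) * x - y‖ < ‖γ.map (Int.cast : ℤ → ℝ)‖ ^ (-ρ)}.Infinite := by
  intro hfin
  set F := {γ : Matrix (Fin n) (Fin n) ℤ | 0 < γ.det ∧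
      ‖(γ.map (Int.cast : ℤ → ℝ)) * x - y‖ < ‖γ.map (Int.cast : ℤ → ℝ)‖ ^ (-ρ)} with hF
  obtain ⟨m, hm, hmF⟩ : ∃ m : ℝ, 0 < m ∧ ∀ γ ∈ F, m ≤ ‖(γ.map (Int.cast : ℤ → ℝ)) * x - y‖ := by
    rcases F.eq_empty_or_nonempty with h0 | hne
    · exact ⟨1, one_pos, by simp [h0]⟩
    · obtain ⟨γ, hγ, hmin⟩ := Set.exists_min_image F
        (fun γ => ‖(γ.map (Int.cast : ℤ → ℝ)) * x - y‖) hfin hne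
      refine ⟨_, ?_, hmin⟩
      rw [norm_pos_iff, sub_ne_zero]
      intro he
      exact hy ⟨γ, hγ.1, he⟩
  have t1 := (tendsto_rpow_atTop ha).eventually_gt_atTop (C / m)
  have t2 := (tendsto_rpow_atTop (show 0 < a - ρ' * b by linarith)).eventually_gt_atTop
    (C / C ^ (-ρ'))
  obtain ⟨T, ⟨hT1, hT2⟩, hT⟩ := ((t1.and t2).and (Filter.eventually_ge_atTop 1)).exists
  have hT0 : 0 < T := by linarith
  obtain ⟨γ, hγd, hγ1, hγ2⟩ := h T hT
  have hγ0 : γ ≠ 0 := by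
    rintro rfl
    have : Nonempty (Fin n) := ⟨⟨0, hn⟩⟩
    rw [Matrix.det_zero] at hγd
    exact lt_irrefl _ hγd
  have hn1 := one_le_nm γ hγ0
  have hCp : 0 < C ^ (-ρ') := by positivity
  have hmem : γ ∈ F := by
    refine ⟨hγd, lt_of_le_of_lt hγ1 ?_⟩
    have h1 : ‖γ.map (Int.cast : ℤ → ℝ)‖ ^ (-ρ') ≤ ‖γ.map (Int.cast : ℤ → ℝ)‖ ^ (-ρ) :=
      Real.rpow_le_rpow_of_exponent_le hn1 (by linarith)
    have h2 : (C * T ^ b) ^ (-ρ') ≤ ‖γ.map (Int.cast : ℤ → ℝ)‖ ^ (-ρ') :=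
      Real.rpow_le_rpow_of_nonpos (by linarith) hγ2 (by linarith)
    refine lt_of_lt_of_le ?_ (h2.trans h1)
    rw [Real.mul_rpow hC.le (by positivity), ← Real.rpow_mul hT0.le]
    rw [div_lt_iff₀ hCp] at hT2
    have h3 : T ^ (b * -ρ') = T ^ (a - ρ' * b) * T ^ (-a) := by
      rw [← Real.rpow_add hT0]; congr 1; ring
    rw [h3]
    have h4 : 0 < T ^ (-a) := by positivity
    nlinarith
  have h5 := hmF γ hmem
  rw [div_lt_iff₀ hm] at hT1
  have h6 : T ^ (-a) * T ^ a = 1 := by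
    rw [← Real.rpow_add hT0]; simp
  have h4 : 0 < T ^ (-a) := by positivity
  have h7 : C * T ^ (-a) < m := by
    have := mul_lt_mul_of_pos_left hT1 h4
    calc C * T ^ (-a) = T ^ (-a) * C := by ring
      _ < _ := this
      _ = T ^ (-a) * T ^ a * m := by ring
      _ = m := by rw [h6, one_mul]
  linarith

/-- **Corollary 1.3 (second part).** If `y ∉ Γx` then for all `ρ < 1/ψ₀` there are
infinitely many `γ ∈ Γ` with `‖γx − y‖ < ‖γ‖^{−ρ}`. -/
theorem dani_nogueira_cor_infinitely_many
    (n p : ℕ) (hn : 2 ≤ n) (hp : 1 ≤ p) (hpn : p ≤ n - 1)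
    (x : Matrix (Fin n) (Fin p) ℝ)
    (hx : LinearIndependent ℝ (fun j i => x i j : Fin p → Fin n → ℝ))
    (hhx : homExp x < (n : ℝ) * ((n : ℝ) - p) / ((n : ℝ) * p - 1))
    (φ₀ ψ₀ : ℝ)
    (hφ₀ : φ₀ = (p : ℝ) / ((n : ℝ) - p) * homExp x - 1)
    (hψ₀ : ψ₀ = (p : ℝ) / ((n : ℝ) - p) *
      ((1 + (n : ℝ) * ((n : ℝ) - p) * φ₀) / (1 - ((n : ℝ) * p - 1) * φ₀)))
    (y : Matrix (Fin n) (Fin p) ℝ)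
    (hy : ¬ ∃ γ : Matrix (Fin n) (Fin n) ℤ, 0 < γ.det ∧ (γ.map (Int.cast : ℤ → ℝ)) * x = y)
    (ρ : ℝ) (hρ : ρ < 1 / ψ₀) :
    {γ : Matrix (Fin n) (Fin n) ℤ | 0 < γ.det ∧
      ‖(γ.map (Int.cast : ℤ → ℝ)) * x - y‖ < ‖γ.map (Int.cast : ℤ → ℝ)‖ ^ (-ρ)}.Infinite := by
  have hpn' : p < n := by omega
  have hpnR : (0:ℝ) < (n:ℝ) - p := by
    have : (p:ℝ) < n := by exact_mod_cast hpn'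
    linarith
  have hpR : (1:ℝ) ≤ p := by exact_mod_cast hp
  have hnR : (2:ℝ) ≤ n := by exact_mod_cast hn
  have hnp1 : (1:ℝ) ≤ (n:ℝ) - p := by
    have : ((p + 1 : ℕ) : ℝ) ≤ n := by exact_mod_cast hpn'
    push_cast at this; linarith
  set U : Set ℝ := {u : ℝ | ∃ c > (0 : ℝ), ∀ ω : Matrix (Fin n) (Fin n) ℤ, ω ≠ 0 →
    c * ‖ω.map (Int.cast : ℤ → ℝ)‖ ^ (-u) < ‖(ω.map (Int.cast : ℤ → ℝ)) * x‖} with hU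
  have hhU : homExp x = sInf U := rfl
  rcases U.eq_empty_or_nonempty with hemp | hne
  · rw [hemp, Real.sInf_empty] at hhU
    apply junk (by omega) x y ρ
    rw [hhU] at hφ₀
    have hφ : φ₀ = -1 := by linarith
    rw [hφ] at hψ₀
    have hN : (2:ℝ) ≤ (n:ℝ) * ((n:ℝ) - p) := by nlinarith
    have h1 : 1 / ψ₀ = -((n:ℝ) * ((n:ℝ) - p)) / ((n:ℝ) * ((n:ℝ) - p) - 1) := by
      have e1 : 1 + (n : ℝ) * ((n : ℝ) - p) * (-1) ≠ 0 := by
        intro h; linarith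
      have e2 : (n:ℝ) * ((n:ℝ) - p) - 1 ≠ 0 := by intro h; linarith
      have e3 : 1 - ((n : ℝ) * p - 1) * (-1) = n * p := by ring
      have e4 : 1 + (n : ℝ) * ((n : ℝ) - p) * (-1) = - ((n:ℝ) * ((n:ℝ) - p) - 1) := by ring
      rw [hψ₀, e3, e4]
      have e5 : (p:ℝ) ≠ 0 := by positivity
      have e6 : (n:ℝ) ≠ 0 := by positivity
      have e7 : (n:ℝ) - p ≠ 0 := hpnR.ne'
      field_simp
    have h2 : 1 / ψ₀ < -1 := by
      rw [h1, div_lt_iff₀ (by linarith)]; linarith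
    linarith
  · have hup : ∀ u ∈ U, ∀ u', u ≤ u' → u' ∈ U := by
      rintro u ⟨c, hc, h⟩ u' huu'
      refine ⟨c, hc, fun ω hω => lt_of_le_of_lt ?_ (h ω hω)⟩
      have := Real.rpow_le_rpow_of_exponent_le (one_le_nm ω hω) (show -u' ≤ -u by linarith)
      gcongr
    have ha0 : 0 < ((n:ℝ) - p) / p := by positivity
    have hlow : ∀ u ∈ U, ((n:ℝ) - p) / p ≤ u := by
      intro u hu
      by_contra! hlt
      obtain ⟨c, hc, h⟩ := hup u hu (max u (((n:ℝ) - p) / p / 2)) (le_max_left _ _)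
      have h1 : max u (((n:ℝ) - p) / p / 2) < ((n:ℝ) - p) / p := max_lt hlt (by linarith)
      have h2 : 0 < max u (((n:ℝ) - p) / p / 2) := lt_max_of_lt_right (by linarith)
      have h3 := (step1 hpn' x hx _ c h2 hc h).1
      rw [lt_div_iff₀ (by linarith)] at h1
      linarith
    have hh : ((n:ℝ) - p) / p ≤ homExp x := by rw [hhU]; exact le_csInf hne hlow
    set h := homExp x with hhdef
    clear_value h
    -- `h` in terms of `φ₀`
    have hhφ : h * p = (n - p) * (1 + φ₀) := by
      rw [hφ₀]; field_simp; ring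
    have hφ0 : 0 ≤ φ₀ := by
      rw [div_le_iff₀ (by linarith)] at hh
      have : 0 ≤ ((n:ℝ) - p) * φ₀ := by linarith
      exact nonneg_of_mul_nonneg_right this hpnR
    have hnp : (0:ℝ) < n * p - 1 := by nlinarith
    have hφ1 : 0 < 1 - ((n:ℝ) * p - 1) * φ₀ := by
      rw [lt_div_iff₀ hnp] at hhx
      have h1 : h * p * (n * p - 1) < n * (n - p) * p := by nlinarith
      rw [hhφ] at h1
      have h2 : 0 < ((n:ℝ) - p) * (1 - ((n:ℝ) * p - 1) * φ₀) := by nlinarith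
      exact (pos_iff_pos_of_mul_pos h2).1 hpnR
    have hden : 0 < 1 + (n:ℝ) * (n - p) * φ₀ := by positivity
    have hψ0 : 0 < ψ₀ := by rw [hψ₀]; positivity
    obtain ⟨ρ', hρ'0, hρρ', hρ'1⟩ : ∃ ρ' : ℝ, 0 < ρ' ∧ ρ ≤ ρ' ∧ ρ' < 1 / ψ₀ := by
      have : 0 < 1 / ψ₀ := by positivity
      exact ⟨max ρ (1 / ψ₀ / 2), lt_max_of_lt_right (by linarith), le_max_left _ _,
        max_lt hρ (by linarith)⟩
    have hkey : ρ' * p * (1 + n * (n - p) * φ₀) < (n - p) * (1 - (n * p - 1) * φ₀) := by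
      rw [lt_div_iff₀ hψ0, hψ₀] at hρ'1
      have : ρ' * ((p : ℝ) / ((n : ℝ) - p) * ((1 + (n : ℝ) * ((n : ℝ) - p) * φ₀) /
        (1 - ((n : ℝ) * p - 1) * φ₀))) = ρ' * p * (1 + n * (n - p) * φ₀) /
          ((n - p) * (1 - (n * p - 1) * φ₀)) := by field_simp
      rw [this, div_lt_one (by positivity)] at hρ'1
      exact hρ'1
    have hgap : 0 < h - (h * p - (n - p)) - ρ' * ((h * p - (n - p)) + 1) := by
      rw [hhφ]
      have e1 : ρ' * p * (1 + (n - p) * φ₀) ≤ ρ' * p * (1 + n * (n - p) * φ₀) := by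
        have : 0 ≤ ((n:ℝ) - p) * φ₀ := by positivity
        have : ((n:ℝ) - p) * φ₀ ≤ n * (n - p) * φ₀ := by nlinarith
        gcongr
      have e2 : ((n:ℝ) - p) * (1 - (n * p - 1) * φ₀) ≤ (n - p) * (1 - (p - 1) * φ₀) := by
        apply mul_le_mul_of_nonneg_left _ hpnR.le
        have : (p:ℝ) * φ₀ ≤ n * p * φ₀ := by
          have : 0 ≤ (p:ℝ) * φ₀ := by positivity
          nlinarith
        linarith
      have e3 : (p:ℝ) * (h - ((n - p) * (1 + φ₀) - (n - p)) -
          ρ' * (((n - p) * (1 + φ₀) - (n - p)) + 1)) =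
          (n - p) * (1 - (p - 1) * φ₀) - ρ' * p * (1 + (n - p) * φ₀) := by
        linear_combination hhφ
      have e4 : 0 < (p:ℝ) * (h - ((n - p) * (1 + φ₀) - (n - p)) -
          ρ' * (((n - p) * (1 + φ₀) - (n - p)) + 1)) := by rw [e3]; linarith
      exact (pos_iff_pos_of_mul_pos e4).1 (by linarith)
    obtain ⟨u, hug, huh⟩ : ∃ u, 0 < u - (u * p - (n - p)) - ρ' * ((u * p - (n - p)) + 1) ∧
        h < u := by
      have hcont : Continuous fun u : ℝ =>
        u - (u * p - (n - p)) - ρ' * ((u * p - (n - p)) + 1) := by fun_prop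
      have hev := (hcont.tendsto h).eventually_const_lt hgap
      exact ((hev.filter_mono nhdsWithin_le_nhds).and
        (self_mem_nhdsWithin : Set.Ioi h ∈ nhdsWithin h (Set.Ioi h))).exists
    obtain ⟨u₀, hu₀, hu₀u⟩ := exists_lt_of_csInf_lt hne (by rw [← hhU]; exact huh)
    obtain ⟨c, hc, hcω⟩ := hup u₀ hu₀ u hu₀u.le
    have hu0 : 0 < u := by linarith
    have hβ := (step1 hpn' x hx u c hu0 hc hcω).1
    obtain ⟨C, hC, hγ⟩ := step2 hpn' x hx u c hu0 hc hcω y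
    refine step3 (by omega) x y hy ρ ρ' (u - (u * p - (n - p))) ((u * p - (n - p)) + 1) C hρ'0
      hρρ' ?_ hC (by linarith) ?_
    · have : 0 ≤ ρ' * ((u * p - (n - p)) + 1) := by positivity
      linarith
    · intro T hT
      rw [neg_sub]
      exact hγ T hT
end

section
/- Let n ≥ 2 and 1 ≤ p ≤ n−1. For Lebesgue almost every pair (x,y) ∈ ℝ^{(n,p)} × ℝ^{(n,p)}, the exponent of approximation satisfies e(x,y) = (n−p)/p. -/
open Matrix MeasureTheory

attribute [local instance] Matrix.normedAddCommGroup

noncomputable instance matrixMeasureSpace {n p : ℕ} :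
    MeasureSpace (Matrix (Fin n) (Fin p) ℝ) :=
  inferInstanceAs (MeasureSpace (Fin n → Fin p → ℝ))

/-- The exponent of approximation `e(x,y)`: the supremum of `μ ∈ ℝ` such that
`‖γx − y‖ < ‖γ‖^{−μ}` for infinitely many `γ ∈ Γ` (integer matrices with positive
determinant). -/
noncomputable def approxExp {n p : ℕ} (x y : Matrix (Fin n) (Fin p) ℝ) : ℝ :=
  sSup {μ : ℝ | {γ : Matrix (Fin n) (Fin n) ℤ | 0 < γ.det ∧
    ‖(γ.map (Int.cast : ℤ → ℝ)) * x - y‖ < ‖γ.map (Int.cast : ℤ → ℝ)‖ ^ (-μ)}.Infinite}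


theorem dn_hom_qmp {G H : Type*} [AddCommGroup G] [AddCommGroup H] [MeasurableSpace G]
    [MeasurableSpace H] [MeasurableAdd G] [MeasurableAdd₂ H] (μ : Measure G) (ν : Measure H)
    [SFinite μ] [SFinite ν] [μ.IsAddLeftInvariant] [ν.IsAddLeftInvariant] [NeZero ν]
    (f : G →+ H) (hf : Measurable f) (hs : Function.Surjective f) :
    Measure.QuasiMeasurePreserving f μ ν := by
  refine ⟨hf, ?_⟩
  refine Measure.AbsolutelyContinuous.mk fun N hN h0 => ?_
  rw [Measure.map_apply hf hN]
  have h1 : ∀ᵐ v ∂μ, ∀ᵐ t ∂ν, f v + t ∉ N := by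
    refine Filter.Eventually.of_forall fun v => ?_
    have := (measurePreserving_add_left ν (f v)).quasiMeasurePreserving.ae
      (p := fun t => t ∉ N) (by rw [ae_iff]; simpa using h0)
    exact this
  rw [Measure.ae_ae_comm] at h1
  · obtain ⟨t, ht⟩ := h1.exists
    obtain ⟨u, rfl⟩ := hs t
    have := (measurePreserving_add_left μ (-u)).quasiMeasurePreserving.ae ht
    have h2 : ∀ᵐ v ∂μ, f v ∉ N := by
      filter_upwards [this] with v hv
      simpa using hv
    rw [ae_iff] at h2
    simp only [not_not] at h2
    exact h2
  · have : Measurable (fun x : G × H => f x.1 + x.2) := by fun_prop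
    exact this hN.compl

abbrev DNT := UnitAddCircle

abbrev DNOmega (m p : ℕ) := (Fin m → Fin p → DNT) × (Fin p → DNT)

instance dn_prob : IsProbabilityMeasure (volume : Measure DNT) := ⟨by simp⟩

instance dn_b1 (p : ℕ) : BorelSpace (Fin p → DNT) := inferInstance
instance dn_b2 (m p : ℕ) : BorelSpace (Fin m → Fin p → DNT) :=
  Pi.borelSpace (X := fun _ : Fin m => Fin p → DNT)
instance dn_b3 (m p : ℕ) : BorelSpace (DNOmega m p) := inferInstance
instance dn_b4 (p : ℕ) : MeasurableAdd₂ (Fin p → DNT) := inferInstance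
instance dn_b5 (m p : ℕ) : MeasurableAdd₂ (Fin m → Fin p → DNT) := inferInstance
instance dn_b6 (m p : ℕ) : MeasurableAdd₂ (DNOmega m p) := inferInstance
instance dn_b7 (p : ℕ) : (volume : Measure (Fin p → DNT)).IsAddHaarMeasure := inferInstance
instance dn_b8 (m p : ℕ) : (volume : Measure (Fin m → Fin p → DNT)).IsAddHaarMeasure :=
  Measure.pi.isAddHaarMeasure (α := fun _ : Fin m => Fin p → DNT) _
instance dn_b9 (m p : ℕ) : (volume : Measure (DNOmega m p)).IsAddHaarMeasure :=
  Measure.prod.instIsAddHaarMeasure _ _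

def dnD {m p : ℕ} (a : Fin m → ℤ) : DNOmega m p →+ (Fin p → DNT) where
  toFun ω := (∑ j, a j • ω.1 j) - ω.2
  map_zero' := by simp
  map_add' x y := by
    simp only [Prod.fst_add, Prod.snd_add, Pi.add_apply, smul_add, Finset.sum_add_distrib]
    abel

theorem dnD_apply {m p : ℕ} (a : Fin m → ℤ) (ω : DNOmega m p) :
  dnD a ω = (∑ j, a j • ω.1 j) - ω.2 := rfl

theorem dnD_cont {m p : ℕ} (a : Fin m → ℤ) : Continuous (dnD (p := p) a) := by
  have : (dnD (p := p) a : DNOmega m p → _) = fun ω => (∑ j, a j • ω.1 j) - ω.2 := rfl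
  rw [this]
  fun_prop

theorem dnD_mp {m p : ℕ} (a : Fin m → ℤ) :
    MeasurePreserving (dnD (p := p) a) volume volume := by
  refine AddMonoidHom.measurePreserving (dnD_cont a) ?_ ?_
  · intro t
    exact ⟨(0, -t), by simp [dnD_apply]⟩
  · simp

theorem dnD_pair_mp {m p : ℕ} (a a' : Fin m → ℤ) (h : a ≠ a') :
    MeasurePreserving (fun ω => (dnD (p := p) a ω, dnD a' ω)) volume (volume.prod volume) := by
  haveI : ((volume : Measure (Fin p → DNT)).prod
      (volume : Measure (Fin p → DNT))).IsAddHaarMeasure :=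
    Measure.prod.instIsAddHaarMeasure _ _
  refine AddMonoidHom.measurePreserving (f := (dnD (p := p) a).prod (dnD a'))
    ((dnD_cont a).prodMk (dnD_cont a')) ?_ ?_
  · rintro ⟨u, w⟩
    obtain ⟨j, hj⟩ := Function.ne_iff.mp h
    have hj' : a j - a' j ≠ 0 := sub_ne_zero.mpr hj
    let s : Fin p → DNT := fun i => DivisibleBy.div (u i - w i) (a j - a' j)
    have hs : (a j - a' j) • s = u - w := by
      ext i
      exact DivisibleBy.div_cancel (u i - w i) hj'
    refine ⟨(Pi.single j s, a j • s - u), ?_⟩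
    have h1 : ∀ b : Fin m → ℤ, ∑ k, b k • (Pi.single j s : Fin m → Fin p → DNT) k = b j • s := by
      intro b
      rw [Finset.sum_eq_single j]
      · simp
      · intro k _ hk
        simp [Pi.single_eq_of_ne hk]
      · simp
    have e1 : dnD a (Pi.single j s, a j • s - u) = u := by
      rw [dnD_apply, h1]; simp
    have e2 : dnD a' (Pi.single j s, a j • s - u) = w := by
      rw [dnD_apply, h1]
      rw [sub_smul] at hs
      simp only
      have : w = u - (a j • s - a' j • s) := by rw [hs]; abel
      rw [this]; abel
    exact Prod.ext e1 e2
  · simp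

theorem dn_vol_ball {p : ℕ} {ε : ℝ} (hε : 0 ≤ ε) :
    volume (Metric.closedBall (0 : Fin p → DNT) ε) = ENNReal.ofReal ((min 1 (2 * ε)) ^ p) := by
  rw [closedBall_pi _ hε, volume_pi_pi]
  simp only [Pi.zero_apply, AddCircle.volume_closedBall, Finset.prod_const, Finset.card_univ,
    Fintype.card_fin]
  rw [ENNReal.ofReal_pow]
  positivity

theorem dn_summable {m : ℕ} {r : ℝ} (hr : (m : ℝ) < r) :
    Summable (fun a : Fin m → ℤ => ‖a‖ ^ (-r)) := by
  let L := Submodule.span ℤ (Set.range (Pi.basisFun ℝ (Fin m)))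
  have h := ZLattice.summable_norm_rpow L (-r) (by
    rw [ZLattice.rank ℝ L]; simpa using hr)
  have hmem : ∀ a : Fin m → ℤ, (fun i => (a i : ℝ)) ∈ L := by
    intro a
    rw [(Pi.basisFun ℝ (Fin m)).mem_span_iff_repr_mem ℤ]
    intro i
    exact ⟨a i, by simp⟩
  have := h.comp_injective (i := fun a : Fin m → ℤ => (⟨_, hmem a⟩ : L)) (by
    intro a b hab
    have := congrArg Subtype.val hab
    ext i
    have := congrFun this i
    simpa using this)
  refine this.congr fun a => ?_
  simp only [Function.comp]
  congr 1

theorem dn_U {m p : ℕ} {μ : ℝ} (hμ : (m : ℝ) < μ * p) :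
    ∀ᵐ ω : DNOmega m p, ∀ C : ℕ, {a : Fin m → ℤ | ‖dnD a ω‖ ≤ C * ‖a‖ ^ (-μ)}.Finite := by
  rw [ae_all_iff]
  intro C
  refine ae_finite_setOfPred_mem (s := fun a : Fin m → ℤ =>
    {ω : DNOmega m p | ‖dnD a ω‖ ≤ C * ‖a‖ ^ (-μ)}) ?_
  have hb : ∀ a : Fin m → ℤ, volume {ω : DNOmega m p | ‖dnD a ω‖ ≤ C * ‖a‖ ^ (-μ)}
      ≤ ENNReal.ofReal ((2 * C) ^ p * ‖a‖ ^ (-(μ * p))) := by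
    intro a
    have h0 : 0 ≤ C * ‖a‖ ^ (-μ) := by positivity
    have : {ω : DNOmega m p | ‖dnD a ω‖ ≤ C * ‖a‖ ^ (-μ)} =
        dnD a ⁻¹' (Metric.closedBall 0 (C * ‖a‖ ^ (-μ))) := by
      ext; simp
    rw [this, (dnD_mp a).measure_preimage Metric.isClosed_closedBall.measurableSet.nullMeasurableSet,
      dn_vol_ball h0]
    apply ENNReal.ofReal_le_ofReal
    calc (min 1 (2 * (C * ‖a‖ ^ (-μ)))) ^ p ≤ (2 * (C * ‖a‖ ^ (-μ))) ^ p := by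
          gcongr
          exact min_le_right _ _
      _ = _ := by
        rw [← mul_assoc, mul_pow, ← Real.rpow_mul_natCast (norm_nonneg _), neg_mul]
  refine ne_top_of_le_ne_top ?_ (ENNReal.tsum_le_tsum hb)
  exact ((dn_summable hμ).mul_left _).tsum_ofReal_ne_top

theorem dn_second {m p : ℕ} (S : Finset (Fin m → ℤ)) {ε : ℝ} (hε : 0 < ε) (hε1 : ε ≤ 1)
    (hS : S.Nonempty) :
    volume {ω : DNOmega m p | ∀ a ∈ S, ε < ‖dnD a ω‖} ≤
      ENNReal.ofReal (1 / (S.card * ε ^ p)) := by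
  set β : ℝ := (min 1 (2 * ε)) ^ p with hβ
  have hβε : ε ^ p ≤ β := by
    exact pow_le_pow_left₀ hε.le (le_min hε1 (by linarith)) p
  have hε0 : 0 < ε ^ p := by positivity
  have hβ0 : 0 < β := by positivity
  let B := Metric.closedBall (0 : Fin p → DNT) ε
  have hB : MeasurableSet B := Metric.isClosed_closedBall.measurableSet
  have hvB : volume.real B = β := by
    rw [Measure.real, dn_vol_ball hε.le, ENNReal.toReal_ofReal hβ0.le]
  let g : (Fin p → DNT) → ℝ := B.indicator 1
  have hg : Measurable g := measurable_one.indicator hB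
  let X : (Fin m → ℤ) → DNOmega m p → ℝ := fun a ω => g (dnD a ω)
  have hX : ∀ a, Measurable (X a) := fun a => hg.comp (dnD_cont a).measurable
  have hL : ∀ a, MemLp (X a) 2 volume := by
    intro a
    refine MemLp.of_bound (hX a).aestronglyMeasurable 1 (Filter.Eventually.of_forall fun ω => ?_)
    simp only [X, g, Set.indicator]
    split_ifs <;> simp
  have hE : ∀ a, ∫ ω, X a ω = β := by
    intro a
    have h1 : ∫ ω, X a ω = ∫ t, g t ∂(Measure.map (dnD (p := p) a) volume) :=
      (integral_map (dnD_cont a).measurable.aemeasurable hg.aestronglyMeasurable).symm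
    rw [h1, (dnD_mp a).map_eq, integral_indicator_one hB, hvB]
  have hV : ∀ a, ProbabilityTheory.variance (X a) volume ≤ β := by
    intro a
    refine (ProbabilityTheory.variance_le_expectation_sq (hX a).aestronglyMeasurable).trans ?_
    rw [← hE a]
    apply le_of_eq
    congr 1
    ext ω
    simp only [X, g, Set.indicator, Pi.pow_apply]
    split_ifs <;> simp
  have hI : ∀ a b, a ≠ b → ProbabilityTheory.IndepFun (X a) (X b) volume := by
    intro a b hab
    have : ProbabilityTheory.IndepFun (dnD (p := p) a) (dnD b) volume := by
      rw [ProbabilityTheory.indepFun_iff_map_prod_eq_prod_map_map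
        (dnD_cont a).measurable.aemeasurable (dnD_cont b).measurable.aemeasurable,
        (dnD_pair_mp a b hab).map_eq, (dnD_mp a).map_eq, (dnD_mp b).map_eq]
    exact this.comp hg hg
  have hVs : ProbabilityTheory.variance (∑ a ∈ S, X a) volume ≤ S.card * β := by
    rw [ProbabilityTheory.IndepFun.variance_sum (fun a _ => hL a) (fun a _ b _ h => hI a b h)]
    refine (Finset.sum_le_sum fun a _ => hV a).trans ?_
    simp
  have hEs : ∫ ω, (∑ a ∈ S, X a) ω = S.card * β := by
    simp only [Finset.sum_apply]
    rw [integral_finsetSum _ fun a _ => (hL a).integrable (by norm_num)]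
    simp [hE]
  have hc : (0 : ℝ) < S.card := by exact_mod_cast hS.card_pos
  have hpos : 0 < S.card * β := by positivity
  have key := ProbabilityTheory.meas_ge_le_variance_div_sq
    (memLp_finsetSum' S (fun a _ => hL a)) hpos
  refine (measure_mono ?_).trans (key.trans ?_)
  · intro ω hω
    have : (∑ a ∈ S, X a) ω = 0 := by
      rw [Finset.sum_apply]
      refine Finset.sum_eq_zero fun a ha => ?_
      have := hω a ha
      simp only [X, g]
      rw [Set.indicator_of_notMem]
      simpa [B] using this
    rw [Set.mem_ofPred_eq, hEs, this]
    simp [abs_of_pos hpos]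
  · apply ENNReal.ofReal_le_ofReal
    calc _ ≤ S.card * β / (S.card * β) ^ 2 := by gcongr
      _ = 1 / (S.card * β) := by field_simp
      _ ≤ _ := by gcongr

def dnBox {m : ℕ} (c : Fin m → ℤ) (k : ℕ) : Finset (Fin m → ℤ) :=
  Finset.univ.image (fun (i : Fin m → Fin (2 ^ k)) (j : Fin m) => c j * 2 ^ k + ((i j : ℕ) : ℤ))

theorem dnBox_card {m : ℕ} (c : Fin m → ℤ) (k : ℕ) : (dnBox c k).card = (2 ^ k) ^ m := by
  rw [dnBox, Finset.card_image_of_injective]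
  · simp
  · intro i i' h
    ext j
    have := congrFun h j
    simpa using this

theorem dnBox_mem {m : ℕ} {c : Fin m → ℤ} {k : ℕ} {a : Fin m → ℤ} (h : a ∈ dnBox c k) (j : Fin m) :
    (c j * 2 ^ k : ℝ) ≤ a j ∧ (a j : ℝ) ≤ (c j + 1) * 2 ^ k := by
  simp only [dnBox, Finset.mem_image, Finset.mem_univ, true_and] at h
  obtain ⟨i, rfl⟩ := h
  have h1 := (i j).2
  have h2 : ((i j : ℕ) : ℝ) ≤ 2 ^ k := by exact_mod_cast h1.le
  push_cast
  constructor
  · have : (0 : ℝ) ≤ ((i j : ℕ) : ℝ) := by positivity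
    linarith
  · linarith

theorem dn_L {m p : ℕ} {μ : ℝ} (hμ : μ * p < m) (hμ0 : 0 ≤ μ) :
    ∀ᵐ ω : DNOmega m p, ∀ c : Fin m → ℤ, ∀ᶠ k : ℕ in Filter.atTop,
      ∃ a ∈ dnBox c k, ‖dnD a ω‖ ≤ ((2 : ℝ) ^ k) ^ (-μ) := by
  rw [ae_all_iff]
  intro c
  have key : ∀ᵐ ω : DNOmega m p, ∀ᶠ k : ℕ in Filter.atTop,
      ω ∉ {ω : DNOmega m p | ∀ a ∈ dnBox c k, ((2 : ℝ) ^ k) ^ (-μ) < ‖dnD a ω‖} := by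
    apply ae_eventually_notMem
    have hb : ∀ k : ℕ, volume {ω : DNOmega m p | ∀ a ∈ dnBox c k, ((2 : ℝ) ^ k) ^ (-μ) < ‖dnD a ω‖}
        ≤ ENNReal.ofReal (((2 : ℝ) ^ (-(m - μ * p))) ^ k) := by
      intro k
      have h1 : (1 : ℝ) ≤ 2 ^ k := one_le_pow₀ (by norm_num)
      refine (dn_second (dnBox c k) (by positivity)
        (Real.rpow_le_one_of_one_le_of_nonpos h1 (by linarith)) ?_).trans ?_
      · rw [← Finset.card_pos, dnBox_card]; positivity
      · apply ENNReal.ofReal_le_ofReal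
        apply le_of_eq
        rw [dnBox_card]
        push_cast
        rw [← Real.rpow_mul_natCast (by positivity), ← Real.rpow_natCast _ m,
          ← Real.rpow_add (by positivity), one_div, ← Real.rpow_neg (by positivity),
          ← Real.rpow_natCast 2 k, ← Real.rpow_mul (by norm_num), ← Real.rpow_mul_natCast (by norm_num)]
        congr 1
        ring
    refine ne_top_of_le_ne_top ?_ (ENNReal.tsum_le_tsum hb)
    refine (summable_geometric_of_lt_one (by positivity) ?_).tsum_ofReal_ne_top
    exact Real.rpow_lt_one_of_one_lt_of_neg (by norm_num) (by linarith)
  filter_upwards [key] with ω hω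
  filter_upwards [hω] with k hk
  simpa using hk


abbrev DNV (m p : ℕ) := (Fin m → Fin p → ℝ) × (Fin p → ℝ)
abbrev DNE (m p : ℕ) := (Fin p → Fin p → ℝ) × DNV m p

instance dn_c1 (m p : ℕ) : (volume : Measure (Fin m → Fin p → ℝ)).IsAddHaarMeasure :=
  Measure.pi.isAddHaarMeasure (α := fun _ : Fin m => Fin p → ℝ) _
instance dn_c2 (m p : ℕ) : (volume : Measure (DNV m p)).IsAddHaarMeasure :=
  Measure.prod.instIsAddHaarMeasure _ _
instance dn_c3 (m p : ℕ) : (volume : Measure (DNE m p)).IsAddHaarMeasure :=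
  Measure.prod.instIsAddHaarMeasure _ _
instance dn_c4 (n p : ℕ) :
    (volume : Measure ((Fin n → Fin p → ℝ) × (Fin n → Fin p → ℝ))).IsAddHaarMeasure :=
  Measure.prod.instIsAddHaarMeasure _ _

def dnI (p : ℕ) : Fin p → Fin p → ℝ := fun i j => if i = j then 1 else 0

theorem dn_det_ae (p : ℕ) : ∀ᵐ g : Fin p → Fin p → ℝ, (Matrix.of g).det ≠ 0 := by
  have hc : Continuous (fun x : (Fin p → Fin p → ℝ) × ℝ =>
      (Matrix.of (x.1 + x.2 • dnI p : Fin p → Fin p → ℝ)).det) := by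
    apply Continuous.matrix_det
    have : Continuous (fun x : (Fin p → Fin p → ℝ) × ℝ => x.1 + x.2 • dnI p) := by fun_prop
    exact this
  have h1 : ∀ᵐ g : Fin p → Fin p → ℝ, ∀ᵐ t : ℝ,
      (Matrix.of (g + t • dnI p : Fin p → Fin p → ℝ)).det ≠ 0 := by
    refine Filter.Eventually.of_forall fun g => ?_
    have hfin : {t : ℝ | (Matrix.of (g + t • dnI p :
        Fin p → Fin p → ℝ)).det = 0}.Finite := by
      refine ((-(Matrix.of g)).charpoly.roots.toFinset.finite_toSet).subset ?_
      intro t ht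
      have hne : (-(Matrix.of g)).charpoly ≠ 0 := (Matrix.charpoly_monic _).ne_zero
      simp only [Finset.mem_coe, Multiset.mem_toFinset, Polynomial.mem_roots hne,
        Polynomial.IsRoot.def, Matrix.eval_charpoly]
      have ht' : (Matrix.of (g + t • dnI p : Fin p → Fin p → ℝ)).det = 0 := ht
      refine Eq.trans ?_ ht'
      congr 1
      ext i j
      by_cases hij : i = j
      · simp [dnI, hij, add_comm]
      · simp [dnI, hij]
    rw [ae_iff]
    simpa using hfin.measure_zero volume
  rw [Measure.ae_ae_comm] at h1
  · obtain ⟨t, ht⟩ := h1.exists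
    have := (measurePreserving_add_left volume
      (-(t • dnI p : Fin p → Fin p → ℝ))).quasiMeasurePreserving.ae ht
    filter_upwards [this] with v hv
    simpa [add_assoc] using hv
  · exact (hc.measurable (measurableSet_singleton (0 : ℝ))).compl

def dnR {m p : ℕ} (q : (Fin m → ℤ) × (Fin p → ℤ)) (e : DNE m p) : Fin p → ℝ :=
  (∑ j, (q.1 j : ℝ) • e.2.1 j) + (∑ j, (q.2 j : ℝ) • e.1 j) - e.2.2

theorem dnR_cont {m p : ℕ} (q : (Fin m → ℤ) × (Fin p → ℤ)) : Continuous (dnR (m := m) (p := p) q) := by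
  unfold dnR
  fun_prop

/-- reduction mod 1 after multiplication by `h` -/
noncomputable def dnPi {m p : ℕ} (h : Matrix (Fin p) (Fin p) ℝ) : DNV m p →+ DNOmega m p where
  toFun v := (fun j i => ((v.1 j ᵥ* h) i : DNT), fun i => ((v.2 ᵥ* h) i : DNT))
  map_zero' := by
    ext <;> simp
  map_add' x y := by
    refine Prod.ext ?_ ?_
    · funext j i
      simp [Matrix.add_vecMul]
    · funext i
      simp [Matrix.add_vecMul]

theorem dnPi_cont {m p : ℕ} (h : Matrix (Fin p) (Fin p) ℝ) : Continuous (dnPi (m := m) h) := by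
  have hv : Continuous fun w : Fin p → ℝ => w ᵥ* h := continuous_id.matrix_vecMul continuous_const
  refine Continuous.prodMk ?_ ?_
  · refine continuous_pi fun j => continuous_pi fun i => ?_
    exact (AddCircle.continuous_mk' 1).comp ((continuous_apply i).comp
      (hv.comp ((continuous_apply j).comp continuous_fst)))
  · refine continuous_pi fun i => ?_
    exact (AddCircle.continuous_mk' 1).comp ((continuous_apply i).comp (hv.comp continuous_snd))

theorem dnPi_surj {m p : ℕ} (g h : Matrix (Fin p) (Fin p) ℝ) (hgh : g * h = 1) :
    Function.Surjective (dnPi (m := m) h) := by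
  rintro ⟨X, Y⟩
  have hs : Function.Surjective (fun r : ℝ => (r : DNT)) := QuotientAddGroup.mk_surjective
  choose s hs using hs
  refine ⟨(fun j => (fun i => s (X j i)) ᵥ* g, (fun i => s (Y i)) ᵥ* g), ?_⟩
  refine Prod.ext ?_ ?_
  · funext j i
    simp [dnPi, Matrix.vecMul_vecMul, hgh, hs]
  · funext i
    simp [dnPi, Matrix.vecMul_vecMul, hgh, hs]

theorem dnPi_qmp {m p : ℕ} (g h : Matrix (Fin p) (Fin p) ℝ) (hgh : g * h = 1) :
    Measure.QuasiMeasurePreserving (dnPi (m := m) h) volume volume :=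
  dn_hom_qmp _ _ _ (dnPi_cont h).measurable (dnPi_surj g h hgh)

theorem dn_mulbound {p : ℕ} (h : Matrix (Fin p) (Fin p) ℝ) :
    ∃ C : ℕ, ∀ w : Fin p → ℝ, ‖w ᵥ* h‖ ≤ C * ‖w‖ := by
  let T := LinearMap.toContinuousLinearMap (Matrix.vecMulLinear h)
  obtain ⟨C, hC⟩ := exists_nat_ge ‖T‖
  refine ⟨C, fun w => ?_⟩
  have : ‖T w‖ ≤ ‖T‖ * ‖w‖ := T.le_opNorm w
  exact this.trans (by gcongr)

theorem dnR_mul {m p : ℕ} (q : (Fin m → ℤ) × (Fin p → ℤ)) (g h : Matrix (Fin p) (Fin p) ℝ)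
    (hgh : g * h = 1) (v : DNV m p) (i : Fin p) :
    (dnR q (g, v) ᵥ* h) i = (∑ j, (q.1 j : ℝ) * (v.1 j ᵥ* h) i) + q.2 i - (v.2 ᵥ* h) i := by
  have h1 : ∑ j, (q.2 j : ℝ) • (g j) = (fun j => (q.2 j : ℝ)) ᵥ* g := by
    funext i
    simp [Matrix.vecMul, dotProduct]
  have : dnR q (g, v) = (∑ j, (q.1 j : ℝ) • v.1 j) + (fun j => (q.2 j : ℝ)) ᵥ* g - v.2 := by
    rw [← h1]; rfl
  rw [this, Matrix.sub_vecMul, Matrix.add_vecMul, Matrix.vecMul_vecMul, hgh, Matrix.vecMul_one,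
    Matrix.sum_vecMul]
  simp [Matrix.smul_vecMul]

theorem dnD_pi {m p : ℕ} (q : (Fin m → ℤ) × (Fin p → ℤ)) (g h : Matrix (Fin p) (Fin p) ℝ)
    (hgh : g * h = 1) (v : DNV m p) (i : Fin p) :
    dnD q.1 (dnPi h v) i = (((dnR q (g, v) ᵥ* h) i : ℝ) : DNT) := by
  rw [dnR_mul q g h hgh]
  have : ((q.2 i : ℝ) : DNT) = 0 := by
    rw [AddCircle.coe_eq_zero_iff]
    exact ⟨q.2 i, by simp⟩
  rw [AddCircle.coe_sub, AddCircle.coe_add, this, add_zero]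
  simp only [dnD_apply, dnPi, Pi.sub_apply, Finset.sum_apply, AddMonoidHom.coe_mk, ZeroHom.coe_mk,
    Pi.smul_apply]
  congr 1
  rw [← QuotientAddGroup.mk'_apply, map_sum]
  refine Finset.sum_congr rfl fun j _ => ?_
  rw [← zsmul_eq_mul, map_zsmul]
  rfl

def dnQU {m p : ℕ} (μ : ℝ) (e : DNE m p) : Prop :=
  {q : (Fin m → ℤ) × (Fin p → ℤ) | ‖dnR q e‖ < ‖q‖ ^ (-μ)}.Finite

def dnQL {m p : ℕ} (μ : ℝ) (e : DNE m p) : Prop :=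
  ∀ c : Fin m → ℤ, ∃ L : ℕ, ∃ K : ℕ, ∀ k : ℕ, K ≤ k → ∃ a : Fin m → ℤ, a ∈ dnBox c k ∧
    ∃ b : Fin p → ℤ, ‖dnR (a, b) e‖ ≤ L * ((2 : ℝ) ^ k) ^ (-μ)

theorem dnQU_meas {m p : ℕ} (μ : ℝ) : MeasurableSet {e : DNE m p | dnQU μ e} := by
  have : {e : DNE m p | dnQU μ e} = {e | ∃ F : Finset ((Fin m → ℤ) × (Fin p → ℤ)),
      ∀ q, q ∈ F ∨ ‖q‖ ^ (-μ) ≤ ‖dnR q e‖} := by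
    ext e
    simp only [dnQU, Set.mem_ofPred_eq]
    constructor
    · intro h
      refine ⟨h.toFinset, fun q => ?_⟩
      by_cases hq : ‖dnR q e‖ < ‖q‖ ^ (-μ)
      · left; simpa using hq
      · right; exact not_lt.mp hq
    · rintro ⟨F, hF⟩
      refine F.finite_toSet.subset fun q hq => ?_
      exact (hF q).resolve_right (not_le.mpr hq)
  rw [this, measurableSet_setOfPred]
  refine Measurable.exists fun F => Measurable.forall fun q => ?_
  refine Measurable.or measurable_const ?_
  rw [← measurableSet_setOfPred]
  exact measurableSet_le measurable_const (dnR_cont q).norm.measurable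

theorem dnQL_meas {m p : ℕ} (μ : ℝ) : MeasurableSet {e : DNE m p | dnQL μ e} := by
  rw [measurableSet_setOfPred]
  unfold dnQL
  refine Measurable.forall fun c => Measurable.exists fun L => Measurable.exists fun K =>
    Measurable.forall fun k => Measurable.forall fun _ => Measurable.exists fun a =>
    Measurable.and measurable_const <| Measurable.exists fun b => ?_
  rw [← measurableSet_setOfPred]
  exact measurableSet_le (dnR_cont _).norm.measurable measurable_const

theorem dnQU_ae {m p : ℕ} {μ : ℝ} (hμ : (m : ℝ) < μ * p) (hμ0 : 0 ≤ μ) :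
    ∀ᵐ e : DNE m p, dnQU μ e := by
  refine (Measure.ae_prod_iff_ae_ae (dnQU_meas μ)).mpr ?_
  filter_upwards [dn_det_ae p] with g hg
  set G : Matrix (Fin p) (Fin p) ℝ := Matrix.of g with hG
  have hgh : G * G⁻¹ = 1 := Matrix.mul_nonsing_inv G (isUnit_iff_ne_zero.mpr hg)
  obtain ⟨C, hC⟩ := dn_mulbound G⁻¹
  filter_upwards [(dnPi_qmp G G⁻¹ hgh).ae (dn_U (m := m) hμ)] with v hv
  change dnQU μ (G, v)
  have hF := (hv C).union (Set.finite_singleton (0 : Fin m → ℤ))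
  set F : Set (Fin m → ℤ) := {a | ‖dnD a (dnPi G⁻¹ v)‖ ≤ C * ‖a‖ ^ (-μ)} ∪ {0} with hFdef
  have hball : ∀ M : ℝ, {b : Fin p → ℤ | ‖b‖ ≤ M}.Finite := by
    intro M
    have := (isCompact_closedBall (0 : Fin p → ℤ) M).finite_of_discrete
    simpa [Metric.closedBall] using this
  let A : (Fin m → ℤ) → Fin p → ℝ := fun a i => (∑ j, (a j : ℝ) * (v.1 j ᵥ* G⁻¹) i) - (v.2 ᵥ* G⁻¹) i
  refine (hF.biUnion fun a _ => (Set.finite_singleton a).prod (hball (C + ‖A a‖))).subset ?_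
  rintro ⟨a, b⟩ hq
  simp only [Set.mem_ofPred_eq] at hq
  simp only [Set.mem_iUnion, Set.mem_prod, Set.mem_singleton_iff, Set.mem_ofPred_eq, exists_prop]
  have hint : ∀ {N : ℕ} (c : Fin N → ℤ), c ≠ 0 → 1 ≤ ‖c‖ := by
    intro N c hc
    obtain ⟨j, hj⟩ := Function.ne_iff.mp hc
    refine le_trans ?_ (norm_le_pi_norm c j)
    rw [Int.norm_eq_abs]
    exact_mod_cast Int.one_le_abs hj
  have hle1 : ‖dnR (a, b) (G, v)‖ ≤ 1 := by
    refine hq.le.trans ?_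
    by_cases h0 : (a, b) = 0
    · rw [h0, norm_zero]
      exact Real.zero_rpow_le_one _
    · refine Real.rpow_le_one_of_one_le_of_nonpos ?_ (by linarith)
      by_cases ha : a = 0
      · have hb : b ≠ 0 := by rintro rfl; exact h0 (by rw [ha]; rfl)
        exact (hint b hb).trans (norm_snd_le (a, b))
      · exact (hint a ha).trans (norm_fst_le (a, b))
  refine ⟨a, ?_, rfl, ?_⟩
  · by_cases ha : a = 0
    · right; exact ha
    · left
      have ha1 := hint a ha
      simp only [Set.mem_ofPred_eq]
      have h1 : ‖dnD a (dnPi G⁻¹ v)‖ ≤ ‖dnR (a, b) (G, v) ᵥ* G⁻¹‖ := by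
        rw [pi_norm_le_iff_of_nonneg (norm_nonneg _)]
        intro i
        have := dnD_pi (a, b) G G⁻¹ hgh v i
        simp only at this
        rw [this]
        refine le_trans ?_ (norm_le_pi_norm _ i)
        exact QuotientAddGroup.norm_mk_le_norm
      refine h1.trans ((hC _).trans ?_)
      gcongr
      refine hq.le.trans ?_
      apply Real.rpow_le_rpow_of_nonpos (by linarith) (norm_fst_le (a, b)) (by linarith)
  · rw [pi_norm_le_iff_of_nonneg (by positivity)]
    intro i
    have h1 := dnR_mul (a, b) G G⁻¹ hgh v i
    simp only at h1
    have h2 : ((b i : ℤ) : ℝ) = (dnR (a, b) (G, v) ᵥ* G⁻¹) i - A a i := by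
      rw [h1]; simp only [A]; ring
    rw [Int.norm_eq_abs, h2, ← Real.norm_eq_abs]
    refine (norm_sub_le _ _).trans (add_le_add ?_ (norm_le_pi_norm _ i))
    refine (norm_le_pi_norm _ i).trans ((hC _).trans ?_)
    calc (C : ℝ) * _ ≤ C * 1 := by gcongr
      _ = C := mul_one _

theorem dnQL_ae {m p : ℕ} {μ : ℝ} (hμ : μ * p < m) (hμ0 : 0 ≤ μ) :
    ∀ᵐ e : DNE m p, dnQL μ e := by
  refine (Measure.ae_prod_iff_ae_ae (dnQL_meas μ)).mpr ?_
  filter_upwards [dn_det_ae p] with g hg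
  set G : Matrix (Fin p) (Fin p) ℝ := Matrix.of g with hG
  have hgh : G * G⁻¹ = 1 := Matrix.mul_nonsing_inv G (isUnit_iff_ne_zero.mpr hg)
  have hhg : G⁻¹ * G = 1 := Matrix.nonsing_inv_mul G (isUnit_iff_ne_zero.mpr hg)
  obtain ⟨C, hC⟩ := dn_mulbound G
  filter_upwards [(dnPi_qmp G G⁻¹ hgh).ae (dn_L (m := m) hμ hμ0)] with v hv
  change dnQL μ (G, v)
  intro c
  obtain ⟨K, hK⟩ := Filter.eventually_atTop.mp (hv c)
  refine ⟨C, K, fun k hk => ?_⟩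
  obtain ⟨a, ha, hn⟩ := hK k hk
  set A : Fin p → ℝ := dnR (a, 0) (G, v) ᵥ* G⁻¹ with hA
  refine ⟨a, ha, fun i => -round (A i), ?_⟩
  set w := dnR (a, fun i => -round (A i)) (G, v) with hw
  have h1 : w = (w ᵥ* G⁻¹) ᵥ* G := by rw [Matrix.vecMul_vecMul, hhg, Matrix.vecMul_one]
  rw [h1]
  refine (hC _).trans ?_
  gcongr
  refine le_trans ?_ hn
  rw [pi_norm_le_iff_of_nonneg (norm_nonneg _)]
  intro i
  refine le_trans (le_of_eq ?_) (norm_le_pi_norm _ i)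
  have h2 := dnD_pi (a, 0) G G⁻¹ hgh v i
  simp only at h2
  rw [h2, UnitAddCircle.norm_eq, Real.norm_eq_abs, ← hA]
  congr 1
  have h3 : A i = _ := dnR_mul (a, 0) G G⁻¹ hgh v i
  rw [hw, dnR_mul _ G G⁻¹ hgh v i]
  have h4 : (∑ j, (a j : ℝ) * (v.1 j ᵥ* G⁻¹) i) = A i + (v.2 ᵥ* G⁻¹) i := by
    rw [h3]; simp
  simp only
  rw [h4]
  push_cast
  ring

def dnRow {m p : ℕ} (i : Fin (m + p)) :
    ((Fin (m + p) → Fin p → ℝ) × (Fin (m + p) → Fin p → ℝ)) →+ DNE m p where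
  toFun z := (fun j => z.1 (Fin.natAdd m j), (fun j => z.1 (Fin.castAdd p j), z.2 i))
  map_zero' := rfl
  map_add' _ _ := rfl

def dnBot {m p : ℕ} :
    ((Fin (m + p) → Fin p → ℝ) × (Fin (m + p) → Fin p → ℝ)) →+ (Fin p → Fin p → ℝ) where
  toFun z := fun j => z.2 (Fin.natAdd m j)
  map_zero' := rfl
  map_add' _ _ := rfl

def dnTop {m p : ℕ} :
    ((Fin (m + p) → Fin p → ℝ) × (Fin (m + p) → Fin p → ℝ)) →+ (Fin p → Fin p → ℝ) where
  toFun z := fun j => z.1 (Fin.natAdd m j)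
  map_zero' := rfl
  map_add' _ _ := rfl

theorem dnRow_qmp {m p : ℕ} (i : Fin (m + p)) :
    Measure.QuasiMeasurePreserving (dnRow (m := m) (p := p) i) volume volume := by
  refine dn_hom_qmp _ _ _ ?_ ?_
  · have : Continuous (dnRow (m := m) (p := p) i) := by
      change Continuous fun z : (Fin (m + p) → Fin p → ℝ) × (Fin (m + p) → Fin p → ℝ) =>
        ((fun j => z.1 (Fin.natAdd m j), (fun j => z.1 (Fin.castAdd p j), z.2 i)) : DNE m p)
      fun_prop
    exact this.measurable
  · rintro ⟨g, x, v⟩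
    refine ⟨(Fin.append x g, fun _ => v), ?_⟩
    simp [dnRow]

theorem dnBot_qmp {m p : ℕ} :
    Measure.QuasiMeasurePreserving (dnBot (m := m) (p := p)) volume volume := by
  refine dn_hom_qmp _ _ _ ?_ ?_
  · have : Continuous (dnBot (m := m) (p := p)) := by
      change Continuous fun z : (Fin (m + p) → Fin p → ℝ) × (Fin (m + p) → Fin p → ℝ) =>
        fun j => z.2 (Fin.natAdd m j)
      fun_prop
    exact this.measurable
  · intro g
    refine ⟨(0, Fin.append 0 g), ?_⟩
    simp [dnBot]

theorem dnTop_qmp {m p : ℕ} :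
    Measure.QuasiMeasurePreserving (dnTop (m := m) (p := p)) volume volume := by
  refine dn_hom_qmp _ _ _ ?_ ?_
  · have : Continuous (dnTop (m := m) (p := p)) := by
      change Continuous fun z : (Fin (m + p) → Fin p → ℝ) × (Fin (m + p) → Fin p → ℝ) =>
        fun j => z.1 (Fin.natAdd m j)
      fun_prop
    exact this.measurable
  · intro g
    refine ⟨(Fin.append 0 g, 0), ?_⟩
    simp [dnTop]

def dnSplit {m p : ℕ} (r : Fin (m + p) → ℤ) : (Fin m → ℤ) × (Fin p → ℤ) :=
  (fun j => r (Fin.castAdd p j), fun j => r (Fin.natAdd m j))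

theorem dn_row_eq {m p : ℕ} (γ : Matrix (Fin (m + p)) (Fin (m + p)) ℤ)
    (x y : Matrix (Fin (m + p)) (Fin p) ℝ) (i : Fin (m + p)) :
    (γ.map (Int.cast : ℤ → ℝ) * x - y) i = dnR (dnSplit (γ i)) (dnRow i (x, y)) := by
  funext l
  simp [Matrix.mul_apply, Fin.sum_univ_add, dnR, dnSplit, dnRow]

theorem dn_upper {m p : ℕ} (x y : Matrix (Fin (m + p)) (Fin p) ℝ) {μ : ℝ} (hμ : 0 ≤ μ)
    (h : ∀ i, dnQU μ (dnRow (m := m) i (x, y))) {ν : ℝ} (hν : μ ≤ ν) :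
    {γ : Matrix (Fin (m + p)) (Fin (m + p)) ℤ | 0 < γ.det ∧
    ‖(γ.map (Int.cast : ℤ → ℝ)) * x - y‖ < ‖γ.map (Int.cast : ℤ → ℝ)‖ ^ (-ν)}.Finite := by
  have hinj : Function.Injective (dnSplit (m := m) (p := p)) := by
    intro r s hrs
    have h1 := congrArg Prod.fst hrs
    have h2 := congrArg Prod.snd hrs
    funext i
    refine Fin.addCases (fun j => ?_) (fun j => ?_) i
    · exact congrFun h1 j
    · exact congrFun h2 j
  have hfin := Set.Finite.pi' fun i => Set.Finite.preimage hinj.injOn (h i)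
  refine hfin.subset ?_
  intro (γ : Matrix (Fin (m + p)) (Fin (m + p)) ℤ) hγ0
  obtain ⟨hdet, hγ⟩ := hγ0
  intro i
  change ‖dnR (dnSplit (γ i)) (dnRow i (x, y))‖ < ‖dnSplit (γ i)‖ ^ (-μ)
  have hrow := dn_row_eq γ x y i
  refine lt_of_eq_of_lt (congrArg norm hrow.symm) ?_
  have hne : γ i ≠ 0 := by
    intro h0
    exact hdet.ne' (Matrix.det_eq_zero_of_row_eq_zero i fun j => congrFun h0 j)
  have hent : ∀ k, |(γ i k : ℝ)| ≤ ‖γ.map (Int.cast : ℤ → ℝ)‖ := fun k => by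
    have := Matrix.norm_entry_le_entrywise_sup_norm (γ.map (Int.cast : ℤ → ℝ)) (i := i) (j := k)
    simpa using this
  have hs0 : 0 < ‖dnSplit (γ i)‖ := by
    rw [norm_pos_iff]
    intro h0
    exact hne (hinj (h0.trans rfl))
  have hsle : ‖dnSplit (γ i)‖ ≤ ‖γ.map (Int.cast : ℤ → ℝ)‖ := by
    refine max_le ?_ ?_
    · rw [pi_norm_le_iff_of_nonneg (norm_nonneg _)]
      intro j
      rw [Int.norm_eq_abs]
      exact hent _
    · rw [pi_norm_le_iff_of_nonneg (norm_nonneg _)]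
      intro j
      rw [Int.norm_eq_abs]
      exact hent _
  have h1 : 1 ≤ ‖γ.map (Int.cast : ℤ → ℝ)‖ := by
    obtain ⟨j, hj⟩ := Function.ne_iff.mp hne
    refine le_trans ?_ (hent j)
    exact_mod_cast Int.one_le_abs hj
  calc ‖(γ.map (Int.cast : ℤ → ℝ) * x - y) i‖ ≤ ‖γ.map (Int.cast : ℤ → ℝ) * x - y‖ :=
        norm_le_pi_norm (fun i => (γ.map (Int.cast : ℤ → ℝ) * x - y) i) i
    _ < _ := hγ
    _ ≤ ‖γ.map (Int.cast : ℤ → ℝ)‖ ^ (-μ) := Real.rpow_le_rpow_of_exponent_le h1 (by linarith)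
    _ ≤ _ := Real.rpow_le_rpow_of_nonpos hs0 hsle (by linarith)

/-- the matrix `(C | w)` -/
def dnM {m p : ℕ} (C : Fin (m + p) → Fin m → ℝ) (w : Fin (m + p) → Fin p → ℝ) :
    Matrix (Fin m ⊕ Fin p) (Fin m ⊕ Fin p) ℝ :=
  Matrix.of fun r => Sum.elim (C (finSumFinEquiv r)) (w (finSumFinEquiv r))

theorem dn_det1 {m p : ℕ} (γ : Matrix (Fin (m + p)) (Fin (m + p)) ℤ)
    (x y : Matrix (Fin (m + p)) (Fin p) ℝ) (s : ℝ) (hs : s ≠ 0) :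
    (γ.det : ℝ) * (Matrix.of (dnTop (m := m) (x, y))).det =
      s ^ m * (dnM (fun i j => (γ i (Fin.castAdd p j) : ℝ) / s)
        (γ.map (Int.cast : ℤ → ℝ) * x)).det := by
  have h1 : (γ.det : ℝ) = ((γ.map (Int.cast : ℤ → ℝ)).submatrix
      (finSumFinEquiv (m := m) (n := p)) finSumFinEquiv).det := by
    rw [Matrix.det_submatrix_equiv_self]
    exact Int.cast_det γ
  have h2 : (Matrix.of (dnTop (m := m) (x, y))).det =
      (Matrix.fromBlocks (1 : Matrix (Fin m) (Fin m) ℝ)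
        (Matrix.of fun j l => x (Fin.castAdd p j) l) 0 (Matrix.of (dnTop (m := m) (x, y)))).det := by
    rw [Matrix.det_fromBlocks_zero₂₁]; simp
  have h3 : s ^ m = (Matrix.diagonal (Sum.elim (fun _ : Fin m => s) (fun _ : Fin p => (1 : ℝ)))).det := by
    rw [Matrix.det_diagonal]; simp
  rw [h1, h2, h3, ← Matrix.det_mul, mul_comm (Matrix.det _), ← Matrix.det_mul]
  congr 1
  ext r c
  rw [Matrix.mul_diagonal]
  rcases c with c | c
  · simp [Matrix.mul_apply, dnM, Matrix.one_apply, div_mul_cancel₀ _ hs]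
  · simp [Matrix.mul_apply, dnM, Fin.sum_univ_add, dnTop]

theorem dn_openC {m p : ℕ} (hm : 1 ≤ m) (x y : Matrix (Fin (m + p)) (Fin p) ℝ)
    (hg : (Matrix.of (dnTop (m := m) (x, y))).det ≠ 0)
    (hy : (Matrix.of (dnBot (m := m) (x, y))).det ≠ 0) :
    ∃ C₀ : Fin (m + p) → Fin m → ℝ, ∃ δ > 0, ∃ r > 0, ∀ C : Fin (m + p) → Fin m → ℝ,
      ∀ w : Fin (m + p) → Fin p → ℝ, (∀ i j, |C i j - C₀ i j| < r) → (∀ i, ‖w i - y i‖ < r) →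
      δ < (dnM C w).det * (Matrix.of (dnTop (m := m) (x, y))).det := by
  set dg := (Matrix.of (dnTop (m := m) (x, y))).det with hdg
  set dy := (Matrix.of (dnBot (m := m) (x, y))).det with hdy
  let S : Matrix (Fin m) (Fin m) ℝ :=
    Matrix.diagonal (Function.update (fun _ => (1 : ℝ)) (⟨0, hm⟩ : Fin m) (dg * dy))
  have hS : S.det = dg * dy := by
    rw [Matrix.det_diagonal, Finset.prod_update_of_mem (Finset.mem_univ _)]
    simp
  let C₀ : Fin (m + p) → Fin m → ℝ := Fin.append (fun i j => S i j) 0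
  have hM0 : dnM C₀ y = Matrix.fromBlocks S (Matrix.of fun j l => y (Fin.castAdd p j) l) 0
      (Matrix.of (dnBot (m := m) (x, y))) := by
    ext r c
    rcases r with r | r <;> rcases c with c | c <;> simp [dnM, C₀, dnBot]
  have hdet0 : (dnM C₀ y).det = dg * dy * dy := by
    rw [hM0, Matrix.det_fromBlocks_zero₂₁, hS]
  let F : (Fin (m + p) → Fin m → ℝ) × (Fin (m + p) → Fin p → ℝ) → ℝ :=
    fun u => (dnM u.1 u.2).det * dg
  have hF : Continuous F := by
    refine Continuous.mul ?_ continuous_const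
    apply Continuous.matrix_det
    refine continuous_matrix fun r c => ?_
    rcases c with c | c
    · simp only [dnM, Matrix.of_apply, Sum.elim_inl]; fun_prop
    · simp only [dnM, Matrix.of_apply, Sum.elim_inr]; fun_prop
  have hF0 : 0 < F (C₀, y) := by
    simp only [F, hdet0]
    have : dg * dy * dy * dg = (dg * dy) ^ 2 := by ring
    rw [this]
    positivity
  have hev := (hF.continuousAt (x := (C₀, y))).eventually_const_lt (half_lt_self hF0)
  obtain ⟨r, hr, hball⟩ := Metric.eventually_nhds_iff.mp hev
  refine ⟨C₀, F (C₀, y) / 2, by positivity, r, hr, fun C w hC hw => ?_⟩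
  refine hball (y := (C, w)) ?_
  rw [Prod.dist_eq, max_lt_iff]
  constructor
  · rw [dist_pi_lt_iff hr]
    intro i
    rw [dist_pi_lt_iff hr]
    intro j
    exact hC i j
  · refine (dist_pi_lt_iff (f := w) (g := fun i => y i) hr).mpr ?_
    intro i
    rw [dist_eq_norm]
    exact hw i

theorem dn_lower {m p : ℕ} (hm : 1 ≤ m) (x y : Matrix (Fin (m + p)) (Fin p) ℝ)
    (hg : (Matrix.of (dnTop (m := m) (x, y))).det ≠ 0)
    (hy : (Matrix.of (dnBot (m := m) (x, y))).det ≠ 0) {μ ν : ℝ} (hν : 0 ≤ ν) (hνμ : ν < μ)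
    (h : ∀ i, dnQL μ (dnRow (m := m) i (x, y))) :
    {γ : Matrix (Fin (m + p)) (Fin (m + p)) ℤ | 0 < γ.det ∧
    ‖(γ.map (Int.cast : ℤ → ℝ)) * x - y‖ < ‖γ.map (Int.cast : ℤ → ℝ)‖ ^ (-ν)}.Infinite := by
  obtain ⟨C₀, δ, hδ, r, hr, hopen⟩ := dn_openC hm x y hg hy
  set G : Matrix (Fin p) (Fin p) ℝ := Matrix.of (dnTop (m := m) (x, y)) with hG
  have hgh : G * G⁻¹ = 1 := Matrix.mul_nonsing_inv G (isUnit_iff_ne_zero.mpr hg)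
  obtain ⟨t, ht⟩ := exists_nat_gt (max 1 (1 / r))
  have ht1 : (1 : ℝ) < t := (le_max_left _ _).trans_lt ht
  have htr : 1 / (t : ℝ) < r := by
    have := (le_max_right _ _).trans_lt ht
    rw [div_lt_iff₀ (by linarith)]
    rw [div_lt_iff₀ hr] at this
    linarith
  let c : Fin (m + p) → Fin m → ℤ := fun i j => ⌊t * C₀ i j⌋
  choose L K hLK using fun i => h i (c i)
  let L₀ : ℝ := ∑ i, (L i : ℝ)
  have hL₀ : ∀ i, (L i : ℝ) ≤ L₀ := fun i =>
    Finset.single_le_sum (f := fun i => (L i : ℝ)) (fun i _ => by positivity) (Finset.mem_univ i)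
  have hL₀0 : 0 ≤ L₀ := Finset.sum_nonneg fun i _ => by positivity
  let K₀ : ℕ := ∑ i, K i
  have hK₀ : ∀ i, K i ≤ K₀ := fun i =>
    Finset.single_le_sum (f := fun i => K i) (fun i _ => by positivity) (Finset.mem_univ i)
  obtain ⟨Ch, hCh⟩ := dn_mulbound G⁻¹
  -- bounds
  let xh : Fin m → Fin p → ℝ := fun j => x (Fin.castAdd p j) ᵥ* G⁻¹
  let yh : Fin (m + p) → Fin p → ℝ := fun i => y i ᵥ* G⁻¹
  let c₀ : ℝ := ‖c‖ + 1
  let B : ℝ := Ch * L₀ + m * (c₀ * ‖xh‖) + ‖yh‖ + c₀ + 1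
  have hB : 0 < B := by positivity
  -- the limits
  have hpow : Filter.Tendsto (fun k : ℕ => (2 : ℝ) ^ k) Filter.atTop Filter.atTop :=
    tendsto_pow_atTop_atTop_of_one_lt (by norm_num)
  have hlim1 : ∀ᶠ k : ℕ in Filter.atTop, L₀ * ((2 : ℝ) ^ k) ^ (-μ) < r := by
    have h1 : Filter.Tendsto (fun k : ℕ => L₀ * ((2 : ℝ) ^ k) ^ (-μ)) Filter.atTop (nhds (L₀ * 0)) :=
      ((tendsto_rpow_neg_atTop (by linarith)).comp hpow).const_mul L₀
    rw [mul_zero] at h1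
    exact h1.eventually_lt_const hr
  have hlim2 : ∀ᶠ k : ℕ in Filter.atTop, L₀ * ((2 : ℝ) ^ k) ^ (-(μ - ν)) < B ^ (-ν) := by
    have h1 : Filter.Tendsto (fun k : ℕ => L₀ * ((2 : ℝ) ^ k) ^ (-(μ - ν))) Filter.atTop
        (nhds (L₀ * 0)) :=
      ((tendsto_rpow_neg_atTop (by linarith)).comp hpow).const_mul L₀
    rw [mul_zero] at h1
    exact h1.eventually_lt_const (by positivity)
  intro hfin
  obtain ⟨D, hD⟩ := (hfin.image (fun γ => (γ.det : ℝ))).bddAbove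
  have hlim3 : ∀ᶠ k : ℕ in Filter.atTop, D * G.det ^ 2 / δ < (2 : ℝ) ^ k :=
    hpow.eventually_gt_atTop _
  obtain ⟨k, hk1, hk2, hk3, hkK⟩ :=
    (hlim1.and (hlim2.and (hlim3.and (Filter.eventually_ge_atTop K₀)))).exists
  choose a ha b hb using fun i => hLK i k ((hK₀ i).trans hkK)
  have h2k : (1 : ℝ) ≤ 2 ^ k := one_le_pow₀ (by norm_num)
  have h2k0 : (0 : ℝ) < 2 ^ k := by positivity
  let γ : Matrix (Fin (m + p)) (Fin (m + p)) ℤ := Matrix.of fun i => Fin.append (a i) (b i)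
  have hγs : ∀ i, dnSplit (m := m) (γ i) = (a i, b i) := by
    intro i
    refine Prod.ext ?_ ?_
    · funext j; simp [dnSplit, γ]
    · funext j; simp [dnSplit, γ]
  have herr : ∀ i, ‖(γ.map (Int.cast : ℤ → ℝ) * x - y) i‖ ≤ L₀ * ((2 : ℝ) ^ k) ^ (-μ) := by
    intro i
    rw [dn_row_eq, hγs]
    refine (hb i).trans ?_
    gcongr
    exact hL₀ i
  have hab : ∀ i j, |(a i j : ℝ)| ≤ c₀ * 2 ^ k := by
    intro i j
    have h1 := dnBox_mem (ha i) j
    have h2 : |(c i j : ℝ)| ≤ ‖c‖ := by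
      have : ‖c i j‖ ≤ ‖c‖ := (norm_le_pi_norm (c i) j).trans (norm_le_pi_norm c i)
      rwa [Int.norm_eq_abs] at this
    have h3 := abs_le.mp h2
    rw [abs_le]
    simp only [c₀]
    constructor
    · nlinarith
    · nlinarith
  have hclose : ∀ i j, |(γ i (Fin.castAdd p j) : ℝ) / (t * 2 ^ k) - C₀ i j| < r := by
    intro i j
    refine lt_of_le_of_lt ?_ htr
    have h1 := dnBox_mem (ha i) j
    have h2 : (γ i (Fin.castAdd p j) : ℝ) = a i j := by simp [γ]
    have h3 : (c i j : ℝ) ≤ t * C₀ i j := Int.floor_le _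
    have h4 : t * C₀ i j < c i j + 1 := Int.lt_floor_add_one _
    rw [h2]
    have ht0 : (0 : ℝ) < t := by linarith
    have h5 : (a i j : ℝ) / (t * 2 ^ k) - C₀ i j = ((a i j : ℝ) / 2 ^ k - t * C₀ i j) / t := by
      field_simp
    rw [h5, abs_div, abs_of_pos ht0]
    gcongr
    have h6 : (c i j : ℝ) ≤ a i j / 2 ^ k := by rw [le_div_iff₀ h2k0]; exact h1.1
    have h7 : (a i j : ℝ) / 2 ^ k ≤ c i j + 1 := by rw [div_le_iff₀ h2k0]; exact h1.2
    rw [abs_le]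
    constructor <;> linarith
  have hdet := hopen _ (γ.map (Int.cast : ℤ → ℝ) * x) hclose (fun i => (herr i).trans_lt hk1)
  have hdet1 := dn_det1 γ x y (t * 2 ^ k) (by positivity)
  rw [← hG] at hdet1
  have hdet2 : (2 : ℝ) ^ k * δ < γ.det * G.det ^ 2 := by
    have e : (γ.det : ℝ) * G.det ^ 2 = (t * 2 ^ k) ^ m *
        ((dnM (fun i j => (γ i (Fin.castAdd p j) : ℝ) / (t * 2 ^ k))
          (γ.map (Int.cast : ℤ → ℝ) * x)).det * G.det) := by
      rw [← mul_assoc, ← hdet1]; ring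
    rw [e]
    have h1 : (2 : ℝ) ^ k ≤ (t * 2 ^ k) ^ m := by
      have h3 : (2 : ℝ) ^ k ≤ t * 2 ^ k := le_mul_of_one_le_left h2k0.le ht1.le
      exact h3.trans (le_self_pow₀ (h2k.trans h3) (by omega))
    have h2 : (0 : ℝ) < (t * 2 ^ k) ^ m := by positivity
    calc (2 : ℝ) ^ k * δ ≤ (t * 2 ^ k) ^ m * δ := by gcongr
      _ < _ := by gcongr
  have hG2 : 0 < G.det ^ 2 := by positivity
  have hdetpos : 0 < γ.det := by
    have : (0 : ℝ) < γ.det := by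
      have h1 : 0 < (2 : ℝ) ^ k * δ := by positivity
      exact pos_of_mul_pos_left (h1.trans hdet2) hG2.le
    exact_mod_cast this
  have hγB : ‖γ.map (Int.cast : ℤ → ℝ)‖ ≤ B * 2 ^ k := by
    rw [Matrix.norm_le_iff (by positivity)]
    intro i j
    rw [Matrix.map_apply, Real.norm_eq_abs]
    refine Fin.addCases (fun j => ?_) (fun j => ?_) j
    · have h2 : (γ i (Fin.castAdd p j) : ℝ) = a i j := by simp [γ]
      rw [h2]
      refine (hab i j).trans ?_
      gcongr
      have : 0 ≤ Ch * L₀ + m * (c₀ * ‖xh‖) + ‖yh‖ := by positivity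
      simp only [B]
      linarith
    · have h2 : (γ i (Fin.natAdd m j) : ℝ) = b i j := by simp [γ]
      rw [h2]
      have h3 := dnR_mul (a i, b i) G G⁻¹ hgh (dnRow (m := m) i (x, y)).2 j
      have h4 : (dnR (a i, b i) (G, (dnRow (m := m) i (x, y)).2)) =
        dnR (a i, b i) (dnRow (m := m) i (x, y)) := rfl
      rw [h4] at h3
      have h5 : (b i j : ℝ) = (dnR (a i, b i) (dnRow (m := m) i (x, y)) ᵥ* G⁻¹) j
          - (∑ l, (a i l : ℝ) * xh l j) + yh i j := by
        rw [h3]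
        simp only [xh, yh]
        change _ = (∑ l, (a i l : ℝ) * (x (Fin.castAdd p l) ᵥ* G⁻¹) j) + (b i j : ℝ) - (y i ᵥ* G⁻¹) j - _ + _
        ring
      have h6 : |(dnR (a i, b i) (dnRow (m := m) i (x, y)) ᵥ* G⁻¹) j| ≤ Ch * L₀ := by
        rw [← Real.norm_eq_abs]
        refine (norm_le_pi_norm _ j).trans ((hCh _).trans ?_)
        gcongr
        refine (hb i).trans ?_
        calc (L i : ℝ) * ((2 : ℝ) ^ k) ^ (-μ) ≤ L i * 1 := by
              gcongr
              exact Real.rpow_le_one_of_one_le_of_nonpos h2k (by linarith)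
          _ ≤ L₀ := by rw [mul_one]; exact hL₀ i
      have h7 : |∑ l, (a i l : ℝ) * xh l j| ≤ m * (c₀ * ‖xh‖) * 2 ^ k := by
        refine (Finset.abs_sum_le_sum_abs _ _).trans ?_
        have : ∀ l ∈ (Finset.univ : Finset (Fin m)), |(a i l : ℝ) * xh l j| ≤ c₀ * 2 ^ k * ‖xh‖ := by
          intro l _
          rw [abs_mul]
          gcongr
          · exact hab i l
          · exact (norm_le_pi_norm (xh l) j).trans (norm_le_pi_norm xh l)
        refine (Finset.sum_le_sum this).trans (le_of_eq ?_)
        simp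
        ring
      have h8 : |yh i j| ≤ ‖yh‖ := (norm_le_pi_norm (yh i) j).trans (norm_le_pi_norm yh i)
      have h9 : |(b i j : ℝ)| ≤ Ch * L₀ + m * (c₀ * ‖xh‖) * 2 ^ k + ‖yh‖ := by
        rw [h5]
        refine (abs_add_le _ _).trans (add_le_add ((abs_sub _ _).trans (add_le_add h6 h7)) h8)
      refine h9.trans ?_
      have e1 : Ch * L₀ ≤ Ch * L₀ * 2 ^ k := le_mul_of_one_le_right (by positivity) h2k
      have e2 : ‖yh‖ ≤ ‖yh‖ * 2 ^ k := le_mul_of_one_le_right (by positivity) h2k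
      have e3 : 0 ≤ (c₀ + 1) * 2 ^ k := by positivity
      simp only [B]
      linarith
  have hγ0 : 0 < ‖γ.map (Int.cast : ℤ → ℝ)‖ := by
    rw [norm_pos_iff]
    intro h0
    have h1 : (γ.det : ℝ) = 0 := by
      have h2 : ((γ.map (Int.cast : ℤ → ℝ))).det = 0 := by
        rw [h0]
        haveI : Nonempty (Fin (m + p)) := ⟨⟨0, by omega⟩⟩
        exact Matrix.det_zero
      rw [← h2]
      exact Int.cast_det γ
    have h3 : γ.det = 0 := by exact_mod_cast h1
    omega
  have hmem : ‖γ.map (Int.cast : ℤ → ℝ) * x - y‖ < ‖γ.map (Int.cast : ℤ → ℝ)‖ ^ (-ν) := by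
    calc ‖γ.map (Int.cast : ℤ → ℝ) * x - y‖ ≤ L₀ * ((2 : ℝ) ^ k) ^ (-μ) := by
          rw [Matrix.norm_le_iff (by positivity)]
          intro i j
          exact (norm_le_pi_norm ((γ.map (Int.cast : ℤ → ℝ) * x - y) i) j).trans (herr i)
      _ = (L₀ * ((2 : ℝ) ^ k) ^ (-(μ - ν))) * ((2 : ℝ) ^ k) ^ (-ν) := by
          rw [mul_assoc, ← Real.rpow_add h2k0]
          congr 2
          ring
      _ < B ^ (-ν) * ((2 : ℝ) ^ k) ^ (-ν) := by gcongr
      _ = (B * 2 ^ k) ^ (-ν) := (Real.mul_rpow hB.le h2k0.le).symm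
      _ ≤ _ := Real.rpow_le_rpow_of_nonpos hγ0 hγB (by linarith)
  have hle : (γ.det : ℝ) ≤ D := hD ⟨γ, ⟨hdetpos, hmem⟩, rfl⟩
  rw [div_lt_iff₀ hδ] at hk3
  have := mul_le_mul_of_nonneg_right hle hG2.le
  linarith

theorem dn_main (m p : ℕ) (hm : 1 ≤ m) (hp : 1 ≤ p) :
    ∀ᵐ z : (Fin (m + p) → Fin p → ℝ) × (Fin (m + p) → Fin p → ℝ),
      approxExp (Matrix.of z.1) (Matrix.of z.2) = (m : ℝ) / p := by
  have hp0 : (0 : ℝ) < p := by exact_mod_cast hp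
  have hm0 : (0 : ℝ) < m := by exact_mod_cast hm
  have hU : ∀ᵐ z : (Fin (m + p) → Fin p → ℝ) × (Fin (m + p) → Fin p → ℝ), ∀ N : ℕ, ∀ i,
      dnQU ((m : ℝ) / p + 1 / (N + 1)) (dnRow (m := m) i z) := by
    rw [ae_all_iff]; intro N
    rw [ae_all_iff]; intro i
    refine (dnRow_qmp i).ae (dnQU_ae ?_ (by positivity))
    rw [add_mul, div_mul_cancel₀ _ hp0.ne']
    have : 0 < 1 / ((N : ℝ) + 1) * p := by positivity
    linarith
  have hL : ∀ᵐ z : (Fin (m + p) → Fin p → ℝ) × (Fin (m + p) → Fin p → ℝ), ∀ N : ℕ, ∀ i,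
      dnQL ((m : ℝ) / p * (1 - 1 / (N + 1))) (dnRow (m := m) i z) := by
    rw [ae_all_iff]; intro N
    rw [ae_all_iff]; intro i
    have h1 : 0 < 1 / ((N : ℝ) + 1) := by positivity
    have h2 : 1 / ((N : ℝ) + 1) ≤ 1 := by
      rw [div_le_one (by positivity)]
      have : (0 : ℝ) ≤ N := by positivity
      linarith
    refine (dnRow_qmp i).ae (dnQL_ae ?_ (mul_nonneg (by positivity) (by linarith)))
    have : (m : ℝ) / p * (1 - 1 / (N + 1)) * p = m * (1 - 1 / (N + 1)) := by
      field_simp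
    rw [this]
    nlinarith
  filter_upwards [hU, hL, dnTop_qmp.ae (dn_det_ae p), dnBot_qmp.ae (dn_det_ae p)]
    with z hzU hzL hz1 hz2
  have hup : ∀ ν : ℝ, (m : ℝ) / p < ν → ¬ {γ : Matrix (Fin (m + p)) (Fin (m + p)) ℤ | 0 < γ.det ∧
      ‖(γ.map (Int.cast : ℤ → ℝ)) * (Matrix.of z.1) - (Matrix.of z.2)‖
        < ‖γ.map (Int.cast : ℤ → ℝ)‖ ^ (-ν)}.Infinite := by
    intro ν hν
    rw [Set.not_infinite]
    obtain ⟨N, hN⟩ := exists_nat_one_div_lt (sub_pos.mpr hν)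
    exact dn_upper (Matrix.of z.1) (Matrix.of z.2) (by positivity) (hzU N) (by linarith)
  have hlow : ∀ ν : ℝ, 0 ≤ ν → ν < (m : ℝ) / p →
      {γ : Matrix (Fin (m + p)) (Fin (m + p)) ℤ | 0 < γ.det ∧
      ‖(γ.map (Int.cast : ℤ → ℝ)) * (Matrix.of z.1) - (Matrix.of z.2)‖
        < ‖γ.map (Int.cast : ℤ → ℝ)‖ ^ (-ν)}.Infinite := by
    intro ν hν0 hν
    have hmp : 0 < (m : ℝ) / p := by positivity
    obtain ⟨N, hN⟩ := exists_nat_one_div_lt (div_pos (sub_pos.mpr hν) hmp)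
    rw [lt_div_iff₀ hmp] at hN
    refine dn_lower hm (Matrix.of z.1) (Matrix.of z.2) hz1 hz2 hν0 ?_ (hzL N)
    linarith
  unfold approxExp
  apply csSup_eq_of_forall_le_of_forall_lt_exists_gt
  · exact ⟨0, hlow 0 le_rfl (by positivity)⟩
  · intro ν hν
    by_contra hlt
    exact hup ν (not_le.mp hlt) hν
  · intro w hw
    obtain ⟨ν, h1, h2⟩ := exists_between (max_lt hw (show 0 < (m : ℝ) / p by positivity))
    exact ⟨ν, hlow ν ((le_max_right _ _).trans h1.le) h2, (le_max_left _ _).trans_lt h1⟩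


/-- **Theorem 1.5.** For Lebesgue almost every pair `(x,y) ∈ ℝ^{(n,p)} × ℝ^{(n,p)}`,
the exponent of approximation is exactly `(n−p)/p`. -/
theorem dani_nogueira_exact_exponent
    (n p : ℕ) (hn : 2 ≤ n) (hp : 1 ≤ p) (hpn : p ≤ n - 1) :
    ∀ᵐ z : Matrix (Fin n) (Fin p) ℝ × Matrix (Fin n) (Fin p) ℝ,
      approxExp z.1 z.2 = ((n : ℝ) - p) / p := by
  obtain ⟨m, rfl⟩ : ∃ m, n = m + p := ⟨n - p, by omega⟩
  have h := dn_main m p (by omega) hp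
  have e : (((m + p : ℕ) : ℝ) - p) / p = (m : ℝ) / p := by push_cast; ring
  rw [e]
  exact h
end

section
/- Let n ≥ 2 and 1 ≤ p ≤ n−1, and let x = (x_1,…,x_p) ∈ ℝ^{(n,p)} with x_1,…,x_p linearly independent vectors in ℝ^n. Then for Lebesgue almost every y ∈ ℝ^{(n,p)}, the exponent of approximation satisfies e(x,y) ≤ (n−p)/p. -/
open Matrix MeasureTheory

attribute [local instance] Matrix.normedAddCommGroup

theorem aux_J (n p : ℕ) (x : Matrix (Fin n) (Fin p) ℝ)
    (hx : LinearIndependent ℝ (fun j i => x i j : Fin p → Fin n → ℝ)) :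
    ∃ J : Finset (Fin n), J.card + p = n ∧ ∀ v : Fin n → ℝ,
      (∀ j, ∑ i, v i * x i j = 0) → (∀ i ∈ J, v i = 0) → v = 0 := by
  classical
  have hrank : xᵀ.rank = p := by
    have := LinearIndependent.rank_matrix (M := xᵀ) hx
    simpa using this
  rw [Matrix.rank_transpose, Matrix.rank_eq_finrank_span_row] at hrank
  obtain ⟨κ, a, ha, hspan, hli⟩ := exists_linearIndependent' ℝ x.row
  have : Finite κ := Finite.of_injective a ha
  have := Fintype.ofFinite κ
  have hcard : Fintype.card κ = p := by
    rw [← hrank, ← hspan, finrank_span_eq_card hli]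
  refine ⟨(Finset.univ.image a)ᶜ, ?_, ?_⟩
  · have h1 := Finset.card_compl_add_card (Finset.univ.image a)
    rw [Finset.card_image_of_injective _ ha, Finset.card_univ, hcard, Fintype.card_fin] at h1
    exact h1
  · intro v hv hJ
    have h2 : ∑ k, v (a k) • (x.row ∘ a) k = 0 := by
      ext j
      have := hv j
      rw [← Finset.sum_subset (Finset.subset_univ (Finset.univ.image a)),
        Finset.sum_image (fun _ _ _ _ h => ha h)] at this
      · rw [Finset.sum_apply]; exact this
      · intro i _ hi
        rw [hJ i (by simpa using hi)]; simp
    have h3 := Fintype.linearIndependent_iff.mp hli _ h2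
    ext i
    by_cases hi : i ∈ Finset.univ.image a
    · obtain ⟨k, -, rfl⟩ := Finset.mem_image.mp hi
      exact h3 k
    · exact hJ i (by simpa using hi)

theorem aux_lat {ι : Type*} [Fintype ι] (s : ℝ) (hs : (Fintype.card ι : ℝ) < s) :
    Summable fun w : ι → ℤ => ‖(fun i => (w i : ℝ))‖ ^ (-s) := by
  classical
  let L := Submodule.span ℤ (Set.range (Pi.basisFun ℝ ι))
  have hr : Module.finrank ℤ L = Fintype.card ι := by
    rw [ZLattice.rank ℝ L]; simp
  have h := ZLattice.summable_norm_rpow L (-s) (by rw [hr]; linarith)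
  let f : (ι → ℤ) → L := fun w => ⟨fun i => (w i : ℝ), by
    rw [Module.Basis.mem_span_iff_repr_mem]
    intro i; exact ⟨w i, by simp⟩⟩
  have hf : Function.Injective f := by
    intro w w' hw
    ext i
    have := congrFun (congrArg Subtype.val hw) i
    simpa [f] using this
  have h2 := h.comp_injective hf
  refine h2.congr ?_
  intro w
  rfl

theorem aux_sum (n p : ℕ) (x : Fin n → Fin p → ℝ) (J : Finset (Fin n))
    (hJ : ∀ v : Fin n → ℝ,
      (∀ j, ∑ i, v i * x i j = 0) → (∀ i ∈ J, v i = 0) → v = 0)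
    (s : ℝ) (hs0 : 0 < s) (hs : (n : ℝ) * J.card < s) (R : ℝ) :
    Summable fun γ : {γ : Fin n → Fin n → ℤ // ∀ i j, |∑ k, (γ i k : ℝ) * x k j| ≤ R} =>
      ‖(fun i k => (γ.1 i k : ℝ) : Fin n → Fin n → ℝ)‖ ^ (-s) := by
  classical
  let Φ : (Fin n → Fin n → ℝ) →ₗ[ℝ] (Fin n → Fin p → ℝ) × (Fin n × J → ℝ) :=
    { toFun := fun v => (fun i j => ∑ k, v i k * x k j, fun q => v q.1 q.2)
      map_add' := by
        intro v w
        ext <;> simp [add_mul, Finset.sum_add_distrib]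
      map_smul' := by
        intro c v
        ext <;> simp [Finset.mul_sum, mul_assoc] }
  have hker : LinearMap.ker Φ = ⊥ := by
    rw [LinearMap.ker_eq_bot']
    intro v hv
    funext i
    apply hJ
    · intro j
      exact congrFun (congrFun (congrArg Prod.fst hv) i) j
    · intro k hk
      exact congrFun (congrArg Prod.snd hv) (i, ⟨k, hk⟩)
  obtain ⟨K, hK, hanti⟩ := LinearMap.exists_antilipschitzWith Φ hker
  obtain ⟨N, hN⟩ := exists_nat_gt (K : ℝ)
  have hN0 : (0 : ℝ) < N := lt_of_le_of_lt K.2 hN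
  obtain ⟨B, hB⟩ := exists_nat_gt (N * R + 1)
  let F := Set.Icc (fun _ _ => -(B : ℤ) : Fin n → Fin p → ℤ) (fun _ _ => (B : ℤ))
  let A := {γ : Fin n → Fin n → ℤ // ∀ i j, |∑ k, (γ i k : ℝ) * x k j| ≤ R}
  have hFfin : Finite F := (Set.finite_Icc _ _).to_subtype
  let c : A → F := fun γ => ⟨fun i j => ⌊N * ∑ k, (γ.1 i k : ℝ) * x k j⌋, by
    have key : ∀ i j, -(B : ℤ) ≤ ⌊N * ∑ k, (γ.1 i k : ℝ) * x k j⌋ ∧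
        ⌊N * ∑ k, (γ.1 i k : ℝ) * x k j⌋ ≤ (B : ℤ) := by
      intro i j
      have h := abs_le.mp (γ.2 i j)
      have h1 := mul_le_mul_of_nonneg_left h.1 hN0.le
      have h2 := mul_le_mul_of_nonneg_left h.2 hN0.le
      constructor
      · rw [Int.le_floor]; push_cast; linarith
      · have : ((⌊N * ∑ k, (γ.1 i k : ℝ) * x k j⌋ : ℤ) : ℝ) ≤ ((B : ℤ) : ℝ) := by
          refine (Int.floor_le _).trans ?_
          push_cast; linarith
        exact_mod_cast this
    exact ⟨fun i j => (key i j).1, fun i j => (key i j).2⟩⟩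
  let f : A → F × (Fin n × J → ℤ) := fun γ => (c γ, fun q => γ.1 q.1 q.2)
  have hf : Function.Injective f := by
    intro γ γ' h
    have hc : ∀ i j, ⌊N * ∑ k, (γ.1 i k : ℝ) * x k j⌋ = ⌊N * ∑ k, (γ'.1 i k : ℝ) * x k j⌋ :=
      fun i j => congrFun (congrFun (congrArg Subtype.val (congrArg Prod.fst h)) i) j
    have hw : ∀ q : Fin n × J, γ.1 q.1 q.2 = γ'.1 q.1 q.2 :=
      fun q => congrFun (congrArg Prod.snd h) q
    let g : A → Fin n → Fin n → ℝ := fun γ i k => (γ.1 i k : ℝ)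
    have hd : dist (Φ (g γ)) (Φ (g γ')) ≤ 1 / N := by
      rw [Prod.dist_eq, max_le_iff]
      have hpos : (0 : ℝ) ≤ 1 / N := by positivity
      refine ⟨?_, ?_⟩
      · rw [dist_pi_le_iff hpos]; intro i
        rw [dist_pi_le_iff hpos]; intro j
        have := Int.abs_sub_lt_one_of_floor_eq_floor (hc i j)
        rw [← mul_sub, abs_mul, abs_of_pos hN0] at this
        rw [Real.dist_eq, le_div_iff₀ hN0, mul_comm]
        exact this.le
      · rw [dist_pi_le_iff hpos]; intro q
        have : (Φ (g γ)).2 q = (Φ (g γ')).2 q := by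
          change ((γ.1 q.1 q.2 : ℤ) : ℝ) = ((γ'.1 q.1 q.2 : ℤ) : ℝ)
          rw [hw q]
        rw [this, dist_self]; exact hpos
    have hd2 : dist (g γ) (g γ') < 1 := by
      refine (hanti.le_mul_dist _ _).trans_lt ?_
      refine (mul_le_mul_of_nonneg_left hd K.2).trans_lt ?_
      change (K : ℝ) * (1 / N) < 1
      rw [mul_one_div, div_lt_one hN0]; exact hN
    apply Subtype.ext
    funext i k
    have h1 : dist (g γ i k) (g γ' i k) < 1 :=
      ((dist_le_pi_dist _ _ k).trans (dist_le_pi_dist (g γ) (g γ') i)).trans_lt hd2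
    rw [Real.dist_eq] at h1
    have h2 : |γ.1 i k - γ'.1 i k| < 1 := by
      have : ((|γ.1 i k - γ'.1 i k| : ℤ) : ℝ) < 1 := by push_cast; exact h1
      exact_mod_cast this
    have := Int.abs_lt_one_iff.mp h2
    omega
  let G : (Fin n × J → ℤ) → ℝ := fun w => ‖(fun i => (w i : ℝ))‖ ^ (-s) + if w = 0 then 1 else 0
  have hG : Summable G := by
    refine (aux_lat s (by simpa using hs)).add ?_
    exact (hasSum_ite_eq 0 1).summable
  have hG0 : ∀ w, 0 ≤ G w := by intro w; simp only [G]; split_ifs <;> positivity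
  have hFG : Summable fun q : F × (Fin n × J → ℤ) => (1 : ℝ) * G q.2 :=
    Summable.mul_of_nonneg (f := fun _ : F => (1 : ℝ)) Summable.of_finite hG
      (fun _ => zero_le_one) hG0
  refine Summable.of_nonneg_of_le (fun _ => by positivity) ?_ (hFG.comp_injective hf)
  intro γ
  simp only [Function.comp, f, one_mul, G]
  by_cases hw : (fun q : Fin n × J => γ.1 q.1 q.2) = 0
  · rw [if_pos hw]
    have : ‖(fun i k => (γ.1 i k : ℝ) : Fin n → Fin n → ℝ)‖ ^ (-s) ≤ 1 := by
      by_cases h0 : γ.1 = 0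
      · rw [h0]
        have : ‖(fun i k => (((0 : Fin n → Fin n → ℤ) i k : ℤ) : ℝ) : Fin n → Fin n → ℝ)‖ = 0 := by
          rw [norm_eq_zero]; ext; simp
        rw [this, Real.zero_rpow (by linarith)]; exact zero_le_one
      · apply Real.rpow_le_one_of_one_le_of_nonpos _ (by linarith)
        obtain ⟨i, hi⟩ := Function.ne_iff.mp h0
        obtain ⟨k, hk⟩ := Function.ne_iff.mp hi
        have h1 : (1 : ℝ) ≤ ‖(γ.1 i k : ℝ)‖ := by
          rw [Real.norm_eq_abs]
          exact_mod_cast Int.one_le_abs hk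
        exact h1.trans ((norm_le_pi_norm (fun k => (γ.1 i k : ℝ)) k).trans
          (norm_le_pi_norm (fun i k => (γ.1 i k : ℝ) : Fin n → Fin n → ℝ) i))
    have h2 : 0 ≤ ‖(fun q : Fin n × J => (γ.1 q.1 q.2 : ℝ))‖ ^ (-s) := by positivity
    linarith
  · rw [if_neg hw, add_zero]
    apply Real.rpow_le_rpow_of_nonpos
    · rw [norm_pos_iff]
      intro h
      apply hw
      funext q
      have := congrFun h q
      simpa using this
    · rw [pi_norm_le_iff_of_nonneg (norm_nonneg _)]
      intro q
      exact (norm_le_pi_norm (fun k => (γ.1 q.1 k : ℝ)) q.2).trans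
          (norm_le_pi_norm (fun i k => (γ.1 i k : ℝ) : Fin n → Fin n → ℝ) q.1)
    · linarith

theorem aux_one_le {n : ℕ} (γ : Fin n → Fin n → ℤ) (h0 : γ ≠ 0) :
    1 ≤ ‖(fun i k => (γ i k : ℝ) : Fin n → Fin n → ℝ)‖ := by
  obtain ⟨i, hi⟩ := Function.ne_iff.mp h0
  obtain ⟨k, hk⟩ := Function.ne_iff.mp hi
  have h1 : (1 : ℝ) ≤ ‖(γ i k : ℝ)‖ := by
    rw [Real.norm_eq_abs]
    exact_mod_cast Int.one_le_abs hk
  exact h1.trans ((norm_le_pi_norm (fun k => (γ i k : ℝ)) k).trans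
    (norm_le_pi_norm (fun i k => (γ i k : ℝ) : Fin n → Fin n → ℝ) i))

theorem aux_bc (n p : ℕ) (hp : 1 ≤ p) (hpn : p < n) (x : Matrix (Fin n) (Fin p) ℝ)
    (hx : LinearIndependent ℝ (fun j i => x i j : Fin p → Fin n → ℝ))
    (μ : ℝ) (hμ : ((n : ℝ) - p) / p < μ) (R : ℝ) :
    ∀ᵐ y : Fin n → Fin p → ℝ, ‖y‖ ≤ R → {γ : Fin n → Fin n → ℤ | γ ≠ 0 ∧
      ‖(fun i j => ∑ k, (γ i k : ℝ) * x k j) - y‖ <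
        ‖(fun i k => (γ i k : ℝ) : Fin n → Fin n → ℝ)‖ ^ (-μ)}.Finite := by
  obtain ⟨J, hJc, hJ⟩ := aux_J n p x hx
  have hp0 : (0 : ℝ) < p := by exact_mod_cast hp
  have hn0 : (0 : ℝ) < n := by exact_mod_cast (by omega : 0 < n)
  have hnp : (0 : ℝ) < (n : ℝ) - p := by
    have : (p : ℝ) < n := by exact_mod_cast hpn
    linarith
  have hμ0 : 0 < μ := lt_trans (by positivity) hμ
  have hJr : (J.card : ℝ) = n - p := by
    rw [eq_sub_iff_add_eq]; exact_mod_cast hJc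
  have hs : (n : ℝ) * J.card < n * (μ * p) := by
    rw [hJr]
    apply mul_lt_mul_of_pos_left _ hn0
    rwa [div_lt_iff₀ hp0] at hμ
  have hsum := aux_sum n p x J hJ (n * (μ * p)) (by positivity) hs (R + 1)
  let A := {γ : Fin n → Fin n → ℤ // ∀ i j, |∑ k, (γ i k : ℝ) * x k j| ≤ R + 1}
  let g : A → Fin n → Fin n → ℝ := fun γ i k => (γ.1 i k : ℝ)
  let S : A → Set (Fin n → Fin p → ℝ) := fun γ =>
    Metric.ball (fun i j => ∑ k, (γ.1 i k : ℝ) * x k j) (‖g γ‖ ^ (-μ))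
  have hvol : ∀ γ, volume (S γ) ≤
      ENNReal.ofReal ((2 ^ p) ^ n * ‖g γ‖ ^ (-((n : ℝ) * (μ * p)))) := by
    intro γ
    rcases (Real.rpow_nonneg (norm_nonneg (g γ)) (-μ)).eq_or_lt with h | h
    · simp [S, ← h]
    · simp only [S]
      rw [MeasureTheory.volume_pi_ball _ h]
      simp only [Real.volume_pi_ball _ h, Finset.prod_const, Finset.card_univ, Fintype.card_fin]
      rw [← ENNReal.ofReal_pow (by positivity)]
      apply ENNReal.ofReal_le_ofReal
      rw [mul_pow, mul_pow]
      apply le_of_eq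
      congr 1
      rw [← pow_mul, ← Real.rpow_natCast, ← Real.rpow_mul (norm_nonneg _)]
      congr 1
      push_cast; ring
  have htsum : ∑' γ, volume (S γ) ≠ ⊤ := by
    refine ne_top_of_le_ne_top ?_ (ENNReal.tsum_le_tsum hvol)
    exact (hsum.mul_left ((2 ^ p) ^ n)).tsum_ofReal_ne_top
  filter_upwards [ae_finite_setOfPred_mem htsum] with y hy hyR
  refine (hy.image Subtype.val).subset ?_
  rintro γ ⟨h0, hγ⟩
  have hle : ‖(fun i k => (γ i k : ℝ) : Fin n → Fin n → ℝ)‖ ^ (-μ) ≤ 1 :=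
    Real.rpow_le_one_of_one_le_of_nonpos (aux_one_le γ h0) (by linarith)
  have hA : ∀ i j, |∑ k, (γ i k : ℝ) * x k j| ≤ R + 1 := by
    intro i j
    have h1 : ‖(fun i j => ∑ k, (γ i k : ℝ) * x k j : Fin n → Fin p → ℝ)‖ ≤ R + 1 := by
      have := norm_add_le ((fun i j => ∑ k, (γ i k : ℝ) * x k j : Fin n → Fin p → ℝ) - y) y
      rw [sub_add_cancel] at this
      linarith
    exact ((norm_le_pi_norm (fun j => ∑ k, (γ i k : ℝ) * x k j) j).trans
      (norm_le_pi_norm (fun i j => ∑ k, (γ i k : ℝ) * x k j : Fin n → Fin p → ℝ) i)).trans h1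
  refine ⟨⟨γ, hA⟩, ?_, rfl⟩
  change y ∈ Metric.ball _ _
  rw [Metric.mem_ball, dist_comm, dist_eq_norm]
  exact hγ

/-- If `x` has linearly independent columns, then for Lebesgue almost every
`y ∈ ℝ^{(n,p)}` the exponent of approximation satisfies `e(x,y) ≤ (n−p)/p`. -/
theorem dani_nogueira_upper_bound_exponent
    (n p : ℕ) (hn : 2 ≤ n) (hp : 1 ≤ p) (hpn : p ≤ n - 1)
    (x : Matrix (Fin n) (Fin p) ℝ)
    (hx : LinearIndependent ℝ (fun j i => x i j : Fin p → Fin n → ℝ)) :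
    ∀ᵐ y : Matrix (Fin n) (Fin p) ℝ, approxExp x y ≤ ((n : ℝ) - p) / p := by
  have hpn' : p < n := by omega
  have hp0 : (0 : ℝ) < p := by exact_mod_cast hp
  have hnp : (0 : ℝ) < (n : ℝ) - p := by
    have : (p : ℝ) < n := by exact_mod_cast hpn'
    linarith
  have key : ∀ᵐ y : Fin n → Fin p → ℝ, ∀ (m R : ℕ), ‖y‖ ≤ R →
      {γ : Fin n → Fin n → ℤ | γ ≠ 0 ∧ ‖(fun i j => ∑ k, (γ i k : ℝ) * x k j) - y‖ <
        ‖(fun i k => (γ i k : ℝ) : Fin n → Fin n → ℝ)‖ ^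
          (-(((n : ℝ) - p) / p + 1 / ((m : ℝ) + 1)))}.Finite := by
    rw [ae_all_iff]; intro m
    rw [ae_all_iff]; intro R
    refine aux_bc n p hp hpn' x hx _ ?_ R
    have : (0 : ℝ) < 1 / ((m : ℝ) + 1) := by positivity
    linarith
  have main : ∀ y : Fin n → Fin p → ℝ, (∀ (m R : ℕ), ‖y‖ ≤ R →
      {γ : Fin n → Fin n → ℤ | γ ≠ 0 ∧ ‖(fun i j => ∑ k, (γ i k : ℝ) * x k j) - y‖ <
        ‖(fun i k => (γ i k : ℝ) : Fin n → Fin n → ℝ)‖ ^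
          (-(((n : ℝ) - p) / p + 1 / ((m : ℝ) + 1)))}.Finite) →
      approxExp x y ≤ ((n : ℝ) - p) / p := by
    intro y hy
    apply Real.sSup_le _ (by positivity)
    intro μ hμ
    by_contra! hlt
    obtain ⟨m, hm⟩ := exists_nat_one_div_lt (sub_pos.mpr hlt)
    obtain ⟨R, hR⟩ := exists_nat_ge ‖y‖
    refine hμ ((hy m R hR).subset ?_)
    rintro γ ⟨hdet, hγ⟩
    have h0 : γ ≠ 0 := by
      rintro rfl
      have : Nonempty (Fin n) := ⟨⟨0, by omega⟩⟩
      exact hdet.ne' (Matrix.det_zero (n := Fin n) (R := ℤ))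
    refine ⟨h0, lt_of_lt_of_le hγ ?_⟩
    exact Real.rpow_le_rpow_of_exponent_le (aux_one_le γ h0) (by linarith)
  exact key.mono main
end
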